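/- arXiv:1801.09981 — 4 statements merged into one kernel-verified Lean document; each statement's English description precedes it below -/
import Mathlib

section
/- Let n ≥ c ≥ 5 and s ≥ 2 be integers. If G is a 2-connected simple graph on n vertices whose circumference (length of a longest cycle) is less than c, then the number of copies of K_s in G satisfies N_s(G) ≤ max{ f_s(n,2,c), f_s(n,⌊(c-1)/2⌋,c) }. -/
/-- `cliqueCount G j` is `N_j(G)`, the number of `j`-vertex cliques (copies of `K_j`) in `G`. -/
noncomputable def cliqueCount {V : Type*} (G : SimpleGraph V) (j : ℕ) : ℕ :=
  Set.ncard {s : Finset V | G.IsNClique j s}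

/-- `f s n k c = f_s(n,k,c) = C(c-k, s) + (n-(c-k))·C(k, s-1)`, the number of copies of
`K_s` in the graph `H(n,k,c)`. -/
def f (s n k c : ℕ) : ℕ :=
  Nat.choose (c - k) s + (n - (c - k)) * Nat.choose k (s - 1)

/-- A graph is 2-connected if it has at least 3 vertices, is connected, and deleting
any single vertex leaves a connected graph. -/
def TwoConnected {V : Type*} [Fintype V] (G : SimpleGraph V) : Prop :=
  3 ≤ Fintype.card V ∧ G.Connected ∧ ∀ v : V, (G.induce ({v}ᶜ : Set V)).Connected

namespace LK
open Finset
open Classical in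
inductive Pth {V : Type*} (G : SimpleGraph V) : V → V → Finset V → Prop
  | single (a : V) : Pth G a a {a}
  | cons {a b c : V} {S : Finset V} : G.Adj a b → Pth G b c S → a ∉ S → Pth G a c (insert a S)

section
open Classical
variable {V : Type*} {G : SimpleGraph V}

lemma Pth.left {a b : V} {S : Finset V} (h : Pth G a b S) : a ∈ S := by
  cases h <;> simp

lemma Pth.right {a b : V} {S : Finset V} (h : Pth G a b S) : b ∈ S := by
  induction h with
  | single => simp
  | cons _ _ _ ih => exact mem_insert_of_mem ih

lemma Pth.join {a b c d : V} {S T : Finset V} (h : Pth G a b S) (hbc : G.Adj b c)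
    (h' : Pth G c d T) (hd : Disjoint S T) : Pth G a d (S ∪ T) := by
  induction h with
  | single a =>
    rw [← insert_eq]
    exact Pth.cons hbc h' (by simpa using hd)
  | @cons a b' e S hab _ ha ih =>
    rw [disjoint_insert_left] at hd
    rw [insert_union]
    exact Pth.cons hab (ih hbc hd.2) (by simp [ha, hd.1])

lemma Pth.symm {a b : V} {S : Finset V} (h : Pth G a b S) : Pth G b a S := by
  induction h with
  | single => exact Pth.single _
  | @cons a b' e S hab _ ha ih =>
    have := ih.join hab.symm (Pth.single a) (by simpa using ha)
    rwa [union_comm, ← insert_eq] at this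

lemma Pth.uncons {a b : V} {S : Finset V} (h : Pth G a b S) (hab : a ≠ b) :
    ∃ c, G.Adj a c ∧ Pth G c b (S.erase a) := by
  cases h with
  | single => exact absurd rfl hab
  | @cons a b' e S h1 h2 ha => exact ⟨b', h1, by rwa [erase_insert ha]⟩

lemma Pth.same {a : V} {S : Finset V} (h : Pth G a a S) : S = {a} := by
  cases h with
  | single => rfl
  | cons h1 h2 ha => exact absurd h2.right ha

lemma Pth.glue {a b c : V} {S T : Finset V} (h : Pth G a b S)
    (h' : Pth G b c T) (hd : ∀ u ∈ S, u ∈ T → u = b) : Pth G a c (S ∪ T) := by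
  by_cases hbc : b = c
  · subst hbc
    rw [h'.same]
    rwa [union_eq_left.2 (by simpa using h.right)]
  · obtain ⟨d, h1, h2⟩ := h'.uncons hbc
    have := h.join h1 h2 (by
      rw [disjoint_left]; intro u hu hu'
      rw [mem_erase] at hu'
      exact hu'.1 (hd u hu hu'.2))
    convert this using 1
    ext u
    have := h.right
    simp only [mem_union, mem_erase]
    by_cases hu : u = b
    · subst hu; simp [this]
    · simp [hu]

/-- split at a vertex -/
lemma Pth.split {a b z : V} {S : Finset V} (h : Pth G a b S) (hz : z ∈ S) :
    ∃ S1 S2, S1 ⊆ S ∧ S2 ⊆ S ∧ Pth G a z S1 ∧ Pth G z b S2 ∧ (∀ u ∈ S1, u ∈ S2 → u = z) := by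
  induction h with
  | single a =>
    obtain rfl : z = a := by simpa using hz
    exact ⟨{z}, {z}, subset_rfl, subset_rfl, Pth.single _, Pth.single _, by simp⟩
  | @cons a b' e S hab h2 ha ih =>
    by_cases hza : z = a
    · subst hza
      exact ⟨{z}, insert z S, by simp, subset_rfl, Pth.single _, Pth.cons hab h2 ha, by simp⟩
    · obtain ⟨S1, S2, s1, s2, p1, p2, hd⟩ := ih (by simpa [hza] using hz)
      refine ⟨insert a S1, S2, insert_subset_insert _ s1, s2.trans (subset_insert _ _),
        Pth.cons hab p1 (fun h => ha (s1 h)), p2, ?_⟩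
      intro u hu hu'
      rcases mem_insert.1 hu with rfl | hu
      · exact absurd (s2 hu') ha
      · exact hd u hu hu'

lemma Pth.mono {G' : SimpleGraph V} (hG : G ≤ G') {a b : V} {S : Finset V} (h : Pth G a b S) :
    Pth G' a b S := by
  induction h with
  | single => exact Pth.single _
  | cons hab _ ha ih => exact Pth.cons (hG hab) ih ha

lemma Pth.induce {s : Set V} {a b : s} {S : Finset s} (h : Pth (G.induce s) a b S) :
    Pth G a.1 b.1 (S.image Subtype.val) := by
  induction h with
  | single => simpa using Pth.single _
  | @cons a b c S hab _ ha ih =>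
    have hab' : G.Adj a.1 b.1 := hab
    have := Pth.cons hab' ih (by simpa using ha)
    refine Eq.subst (motive := fun X => Pth G _ _ X) ?_ this
    ext u; simp only [mem_image, mem_insert]; grind

lemma pth_of_walk {a b : V} (p : G.Walk a b) (hp : p.IsPath) :
    Pth G a b p.support.toFinset := by
  induction p with
  | nil => simpa using Pth.single _
  | cons h p ih =>
    rw [SimpleGraph.Walk.cons_isPath_iff] at hp
    rw [SimpleGraph.Walk.support_cons, List.toFinset_cons]
    exact Pth.cons h (ih hp.1) (by simpa using hp.2)

lemma Pth.walk {a b : V} {S : Finset V} (h : Pth G a b S) :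
    ∃ p : G.Walk a b, p.IsPath ∧ p.support.toFinset = S := by
  induction h with
  | single a => exact ⟨.nil, by simp, by simp⟩
  | cons hab _ ha ih =>
    obtain ⟨p, h1, h2⟩ := ih
    refine ⟨.cons hab p, ?_, ?_⟩
    · rw [SimpleGraph.Walk.cons_isPath_iff]
      refine ⟨h1, ?_⟩
      rwa [← List.mem_toFinset, h2]
    · rw [SimpleGraph.Walk.support_cons, List.toFinset_cons, h2]

lemma card_walk {a b : V} (p : G.Walk a b) (hp : p.IsPath) :
    p.support.toFinset.card = p.length + 1 := by
  rw [List.toFinset_card_of_nodup hp.support_nodup, SimpleGraph.Walk.length_support]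

lemma cycle_of_pth {a b : V} {S : Finset V} (h : Pth G a b S) (hab : G.Adj a b)
    (hS : 3 ≤ S.card) : ∃ (v : V) (w : G.Walk v v), w.IsCycle ∧ w.length = S.card := by
  obtain ⟨p, hp, rfl⟩ := h.walk
  rw [card_walk p hp] at *
  refine ⟨b, .cons hab.symm p, ?_, by simp⟩
  rw [SimpleGraph.Walk.cons_isCycle_iff]
  refine ⟨hp, ?_⟩
  cases p with
  | nil => simp at hS
  | @cons _ x _ hx q =>
    rw [SimpleGraph.Walk.cons_isPath_iff] at hp
    intro he
    rw [SimpleGraph.Walk.edges_cons, List.mem_cons] at he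
    rcases he with he | he
    · have : b = x := by
        have hne := hab.ne
        simp at he
        rcases he with he | he
        · exact absurd he.1.symm hne
        · exact he
      subst this
      have := SimpleGraph.Walk.isPath_iff_nil.1 hp.1 |>.eq_nil
      subst this
      simp at hS
    · exact hp.2 (q.snd_mem_support_of_mem_edges he)

lemma pth_of_cycle {v : V} (w : G.Walk v v) (hw : w.IsCycle) :
    ∃ a b S, Pth G a b S ∧ G.Adj a b ∧ S.card = w.length := by
  cases w with
  | nil => simp at hw
  | @cons _ x _ hx q =>
    rw [SimpleGraph.Walk.cons_isCycle_iff] at hw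
    exact ⟨x, v, _, pth_of_walk q hw.1, hx.symm, by rw [card_walk q hw.1]; simp⟩

def NoLong (G : SimpleGraph V) (c : ℕ) : Prop := ∀ a b S, Pth G a b S → G.Adj a b → S.card < c
def TC (G : SimpleGraph V) : Prop := ∀ w a b, a ≠ w → b ≠ w → ∃ S, Pth G a b S ∧ w ∉ S

lemma TC_of [Fintype V] (h : ∀ v : V, (G.induce ({v}ᶜ : Set V)).Connected) : TC G := by
  intro w a b ha hb
  obtain ⟨p⟩ := (h w).preconnected ⟨a, ha⟩ ⟨b, hb⟩
  exact ⟨_, (pth_of_walk _ p.toPath.2).induce, by simp⟩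

lemma TC.mono {G' : SimpleGraph V} (hG : G ≤ G') (h : TC G) : TC G' := by
  intro w a b ha hb
  obtain ⟨S, h1, h2⟩ := h w a b ha hb
  exact ⟨S, h1.mono hG, h2⟩

/-- first hit -/
lemma first_hit (Y X : Finset V) : ∀ (N : ℕ) (S : Finset V) (a b : V), S.card ≤ N → Pth G a b S →
    a ∈ Y → b ∈ X → ∃ z ∈ Y, ∃ t ∈ X, ∃ S' ⊆ S, Pth G z t S' ∧ (∀ u ∈ S', u ∈ Y → u = z) ∧
      (∀ u ∈ S', u ∈ X → u = t) := by
  intro N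
  induction N with
  | zero =>
    intro S a b hS h
    have := h.left
    simp at hS; simp [hS] at this
  | succ N ih =>
    intro S a b hS h ha hb
    by_cases h1 : ∀ u ∈ S, u ∈ Y → u = a
    · by_cases h2 : ∀ u ∈ S, u ∈ X → u = b
      · exact ⟨a, ha, b, hb, S, subset_rfl, h, h1, h2⟩
      · push Not at h2
        obtain ⟨u, huS, huX, hub⟩ := h2
        obtain ⟨S1, S2, s1, s2, p1, p2, hd⟩ := h.split huS
        have : S1.card < S.card := card_lt_card ⟨s1, fun hh => hub (hd b (hh h.right) p2.right).symm⟩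
        obtain ⟨z, hz, t, ht, S', hS', r⟩ := ih S1 a u (by omega) p1 ha huX
        exact ⟨z, hz, t, ht, S', hS'.trans s1, r⟩
    · push Not at h1
      obtain ⟨u, huS, huX, hub⟩ := h1
      obtain ⟨S1, S2, s1, s2, p1, p2, hd⟩ := h.split huS
      have : S2.card < S.card := card_lt_card ⟨s2, fun hh => hub (hd a p1.left (hh h.left)).symm⟩
      obtain ⟨z, hz, t, ht, S', hS', r⟩ := ih S2 u b (by omega) p2 huX hb
      exact ⟨z, hz, t, ht, S', hS'.trans s2, r⟩

lemma TC.hit (h : TC G) (w : V) (Y X : Finset V) {a b : V} (ha : a ∈ Y) (hb : b ∈ X)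
    (haw : a ≠ w) (hbw : b ≠ w) :
    ∃ z ∈ Y, ∃ t ∈ X, ∃ S', w ∉ S' ∧ Pth G z t S' ∧ (∀ u ∈ S', u ∈ Y → u = z) ∧
      (∀ u ∈ S', u ∈ X → u = t) := by
  obtain ⟨S, h1, h2⟩ := h w a b haw hbw
  obtain ⟨z, hz, t, ht, S', hS', r⟩ := first_hit Y X _ S a b le_rfl h1 ha hb
  exact ⟨z, hz, t, ht, S', fun h => h2 (hS' h), r⟩

lemma Pth.param {a b : V} {S : Finset V} (h : Pth G a b S) :
    ∃ (v : ℕ → V) (m : ℕ), S.card = m + 1 ∧ v 0 = a ∧ v m = b ∧ S = (range (m+1)).image v ∧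
      (∀ i ≤ m, ∀ j ≤ m, v i = v j → i = j) ∧ ∀ i < m, G.Adj (v i) (v (i+1)) := by
  obtain ⟨p, hp, rfl⟩ := h.walk
  refine ⟨p.getVert, p.length, card_walk p hp, by simp, by simp, ?_, ?_, ?_⟩
  · ext u
    simp only [List.mem_toFinset, SimpleGraph.Walk.mem_support_iff_exists_getVert, mem_image,
      mem_range]
    constructor
    · rintro ⟨n, h1, h2⟩; exact ⟨n, by omega, h1⟩
    · rintro ⟨n, h1, h2⟩; exact ⟨n, h2, by omega⟩
  · intro i hi j hj hij
    exact hp.getVert_injOn hi hj hij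
  · intro i hi
    exact p.adj_getVert_succ hi

lemma clique_pth (N : ℕ) : ∀ (H : Finset V) (a b : V), H.card ≤ N → (∀ x ∈ H, ∀ y ∈ H, x ≠ y → G.Adj x y) →
    a ∈ H → b ∈ H → a ≠ b → Pth G a b H := by
  induction N with
  | zero => intro H a b hH _ ha; simp at hH; simp [hH] at ha
  | succ N ih =>
    intro H a b hH hcl ha hb hab
    by_cases h : ∃ d ∈ H, d ≠ a ∧ d ≠ b
    · obtain ⟨d, hd, hda, hdb⟩ := h
      have := ih (H.erase a) d b (by rw [card_erase_of_mem ha]; omega)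
        (fun x hx y hy => hcl x (mem_of_mem_erase hx) y (mem_of_mem_erase hy))
        (by simp [hd, hda]) (by simp [hb, hab.symm]) hdb
      have := Pth.cons (hcl a ha d hd hda.symm) this (by simp)
      rwa [insert_erase ha] at this
    · push Not at h
      have : H = insert a {b} := by
        ext u; simp only [mem_insert, mem_singleton]
        constructor
        · intro hu
          by_cases hua : u = a
          · exact Or.inl hua
          · exact Or.inr (h u hu hua)
        · rintro (rfl | rfl) <;> assumption
      rw [this]
      exact Pth.cons (hcl a ha b hb hab) (Pth.single b) (by simpa using hab)

lemma pth_add_edge (u v : V) {a b : V} {S : Finset V} (h : Pth (G ⊔ SimpleGraph.edge u v) a b S) :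
    Pth G a b S ∨ ∃ S1 S2, S1 ∪ S2 = S ∧ Disjoint S1 S2 ∧
      ((Pth G a u S1 ∧ Pth G v b S2) ∨ (Pth G a v S1 ∧ Pth G u b S2)) := by
  induction h with
  | single a => exact Or.inl (Pth.single a)
  | @cons a b e S hab h ha ih =>
    rcases ih with ih | ⟨S1, S2, rfl, hd, ih⟩
    · rw [SimpleGraph.sup_adj, SimpleGraph.edge_adj] at hab
      rcases hab with hab | ⟨⟨rfl, rfl⟩ | ⟨rfl, rfl⟩, hne⟩
      · exact Or.inl (Pth.cons hab ih ha)
      · exact Or.inr ⟨{a}, S, by rw [insert_eq], by simpa using ha, Or.inl ⟨Pth.single _, ih⟩⟩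
      · exact Or.inr ⟨{a}, S, by rw [insert_eq], by simpa using ha, Or.inr ⟨Pth.single _, ih⟩⟩
    · simp only [mem_union, not_or] at ha
      rw [SimpleGraph.sup_adj, SimpleGraph.edge_adj] at hab
      have hd' : Disjoint (insert a S1) S2 := by
        rw [disjoint_insert_left]; exact ⟨ha.2, hd⟩
      rcases hab with hab | hab
      · right
        refine ⟨insert a S1, S2, by rw [insert_union], hd', ?_⟩
        rcases ih with ⟨h1, h2⟩ | ⟨h1, h2⟩
        · exact Or.inl ⟨Pth.cons hab h1 ha.1, h2⟩
        · exact Or.inr ⟨Pth.cons hab h1 ha.1, h2⟩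
      · exfalso
        rcases hab with ⟨⟨rfl, rfl⟩ | ⟨rfl, rfl⟩, hne⟩
        · rcases ih with ⟨h1, h2⟩ | ⟨h1, h2⟩
          · exact ha.1 h1.right
          · exact ha.2 h2.left
        · rcases ih with ⟨h1, h2⟩ | ⟨h1, h2⟩
          · exact ha.2 h2.left
          · exact ha.1 h1.right

lemma long_of_add_edge {c : ℕ} (hc : 3 ≤ c) (hG : NoLong G c) {u v : V} (huv : u ≠ v)
    (h : ¬ NoLong (G ⊔ SimpleGraph.edge u v) c) : ∃ S, Pth G u v S ∧ c ≤ S.card := by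
  unfold NoLong at h
  push Not at h
  obtain ⟨a, b, S, hp, hab, hcS⟩ := h
  rw [SimpleGraph.sup_adj, SimpleGraph.edge_adj] at hab
  rcases pth_add_edge u v hp with h1 | ⟨S1, S2, rfl, hd, h1⟩
  · rcases hab with hab | ⟨⟨rfl, rfl⟩ | ⟨rfl, rfl⟩, hne⟩
    · exact absurd (hG _ _ _ h1 hab) (by omega)
    · exact ⟨S, h1, hcS⟩
    · exact ⟨S, h1.symm, hcS⟩
  · rcases hab with hab | hab
    · rcases h1 with ⟨h1, h2⟩ | ⟨h1, h2⟩
      · exact ⟨_, h1.symm.join hab h2.symm hd, hcS⟩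
      · exact ⟨_, (h1.symm.join hab h2.symm hd).symm, hcS⟩
    · exfalso
      have key : ∀ {a b : V} {S1 S2 : Finset V}, Disjoint S1 S2 → c ≤ (S1 ∪ S2).card → 
          Pth G a a S1 → Pth G b b S2 → False := by
        intro a b S1 S2 hd hcS h1 h2
        rw [h1.same, h2.same] at hcS
        have := card_le_two (a := a) (b := b)
        rw [← insert_eq] at hcS
        omega
      rw [disjoint_left] at hd
      rcases hab with ⟨⟨rfl, rfl⟩ | ⟨rfl, rfl⟩, hne⟩
      · rcases h1 with ⟨h1, h2⟩ | ⟨h1, h2⟩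
        · exact key (disjoint_left.2 hd) hcS h1 h2
        · exact hd h1.left h2.left
      · rcases h1 with ⟨h1, h2⟩ | ⟨h1, h2⟩
        · exact hd h1.left h2.left
        · exact key (disjoint_left.2 hd) hcS h1 h2
end
end LK
namespace LK
open Finset
section
open Classical
variable {V : Type*} {G : SimpleGraph V}

lemma seg {v : ℕ → V} {m : ℕ} (hinj : ∀ i ≤ m, ∀ j ≤ m, v i = v j → i = j)
    (hadj : ∀ i < m, G.Adj (v i) (v (i+1))) (i j : ℕ) (hij : i ≤ j) (hj : j ≤ m) :
    Pth G (v i) (v j) ((Icc i j).image v) := by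
  induction j, hij using Nat.le_induction with
  | base => simpa using Pth.single (v i)
  | succ j hij ih =>
    have h1 := (ih (by omega)).join (hadj j (by omega)) (Pth.single (v (j+1))) (by
      rw [disjoint_singleton_right]
      intro h
      obtain ⟨k, hk, hk'⟩ := mem_image.1 h
      rw [mem_Icc] at hk
      have := hinj _ (by omega) _ (by omega) hk'
      omega)
    convert h1 using 1
    rw [← image_singleton v (j+1), ← image_union]
    congr 1
    ext k; simp only [mem_Icc, mem_union, mem_singleton]; omega

/-- arc covering the neighbours of `v 0` -/
lemma arc {v : ℕ → V} {m : ℕ} (hinj : ∀ i ≤ m, ∀ j ≤ m, v i = v j → i = j)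
    (hadj : ∀ i < m, G.Adj (v i) (v (i+1))) (i p : ℕ) (hip : i < p) (hp : p ≤ m)
    (hx : G.Adj (v 0) (v p)) :
    ∃ T ⊆ (Icc 0 p).image v, Pth G (v i) (v p) T ∧ v 0 ∈ T ∧
      ∀ j ≤ p, G.Adj (v 0) (v j) → v j ∈ T := by
  have hex : ∃ j, i < j ∧ G.Adj (v 0) (v j) := ⟨p, hip, hx⟩
  obtain ⟨h1, h2⟩ := Nat.find_spec hex
  have hmin := fun k => Nat.find_min' hex (m := k)
  generalize Nat.find hex = j at *
  have hjp : j ≤ p := hmin p ⟨hip, hx⟩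
  refine ⟨(Icc 0 i).image v ∪ (Icc j p).image v, ?_, ?_, ?_, ?_⟩
  · rw [← image_union]
    apply image_subset_image
    intro k; simp only [mem_Icc, mem_union]; omega
  · refine (seg hinj hadj 0 i (by omega) (by omega)).symm.join h2 (seg hinj hadj j p hjp hp) ?_
    rw [disjoint_left]
    intro u hu hu'
    obtain ⟨a, ha, rfl⟩ := mem_image.1 hu
    obtain ⟨b, hb, hb'⟩ := mem_image.1 hu'
    rw [mem_Icc] at ha hb
    have := hinj _ (by omega) _ (by omega) hb'
    omega
  · exact mem_union_left _ (mem_image_of_mem _ (by simp))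
  · intro k hk hk'
    rw [mem_union]
    rcases Nat.lt_or_ge i k with h | h
    · right; exact mem_image_of_mem _ (mem_Icc.2 ⟨hmin k ⟨h, hk'⟩, hk⟩)
    · left; exact mem_image_of_mem _ (by simp [h])

lemma two_paths (hTC : TC G) {v : ℕ → V} {m : ℕ} (hinj : ∀ i ≤ m, ∀ j ≤ m, v i = v j → i = j)
    (hadj : ∀ i < m, G.Adj (v i) (v (i+1))) (p : ℕ) (hp : 1 ≤ p) (q : ℕ) (hpq : p ≤ q) :
    q + 1 ≤ m → ∃ (a b : ℕ) (h1 h2 : V) (S1 S2 : Finset V), a < p ∧ q < b ∧ b ≤ m ∧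
      ((h1 = v p ∧ h2 = v a) ∨ (h2 = v p ∧ h1 = v a)) ∧
      Pth G h1 (v q) S1 ∧ Pth G h2 (v b) S2 ∧ Disjoint S1 S2 ∧
      (∀ i ≤ p, v i ∈ S1 → v i = h1) ∧ (∀ i ≤ p, v i ∈ S2 → v i = h2) ∧
      (∀ i ≤ m, q ≤ i → v i ∈ S1 → i = q) ∧ (∀ i ≤ m, q ≤ i → v i ∈ S2 → i = b) := by
  induction q, hpq using Nat.le_induction with
  | base =>
    intro hpm
    obtain ⟨z, hz, t, ht, S, hS, hP, hY, hX⟩ := hTC.hit (v p) ((range p).image v)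
      ((Icc (p+1) m).image v) (a := v 0) (b := v m)
      (mem_image_of_mem _ (by simp; omega)) (mem_image_of_mem _ (by simp; omega))
      (fun h => by have := hinj _ (by omega) _ (by omega) h; omega)
      (fun h => by have := hinj _ (by omega) _ (by omega) h; omega)
    obtain ⟨a, ha, rfl⟩ := mem_image.1 hz
    obtain ⟨b, hb, rfl⟩ := mem_image.1 ht
    rw [mem_range] at ha
    rw [mem_Icc] at hb
    refine ⟨a, b, v p, v a, {v p}, S, ha, by omega, by omega, Or.inl ⟨rfl, rfl⟩, Pth.single _, hP,
      by simpa using hS, ?_, ?_, ?_, ?_⟩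
    · intro i hi h; simpa using h
    · intro i hi h
      rcases hi.lt_or_eq with hi | rfl
      · exact hY _ h (mem_image_of_mem _ (by simpa using hi))
      · exact absurd h hS
    · intro i hi _ h; exact hinj _ hi _ (by omega) (by simpa using h)
    · intro i hi hpi h
      rcases hpi.lt_or_eq with hpi | rfl
      · exact hinj _ hi _ (by omega) (hX _ h (mem_image_of_mem _ (by simp; omega)))
      · exact absurd h hS
  | succ q hpq ih =>
    intro hqm
    obtain ⟨a, b, h1, h2, S1, S2, hap, hqb, hbm, hh, P1, P2, hd, A1, A2, B1, B2⟩ := ih (by omega)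
    have hnew : v (q+1) ∉ S1 := fun h => by have := B1 (q+1) (by omega) (by omega) h; omega
    have hext : Pth G h1 (v (q+1)) (insert (v (q+1)) S1) := by
      have := P1.join (hadj q (by omega)) (Pth.single (v (q+1))) (by simpa using hnew)
      rwa [union_comm, ← insert_eq] at this
    have A1' : ∀ i ≤ p, v i ∈ insert (v (q+1)) S1 → v i = h1 := by
      intro i hi h
      rcases mem_insert.1 h with h | h
      · have := hinj _ (by omega) _ (by omega) h; omega
      · exact A1 i hi h
    have B1' : ∀ i ≤ m, q + 1 ≤ i → v i ∈ insert (v (q+1)) S1 → i = q + 1 := by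
      intro i hi hqi h
      rcases mem_insert.1 h with h | h
      · exact hinj _ (by omega) _ (by omega) h
      · have := B1 i hi (by omega) h; omega
    by_cases hb : b = q + 1
    swap
    · refine ⟨a, b, h1, h2, _, S2, hap, by omega, hbm, hh, hext, P2, ?_, A1', A2, B1', ?_⟩
      · rw [disjoint_insert_left]
        refine ⟨fun h => hb (B2 (q+1) (by omega) (by omega) h).symm, hd⟩
      · intro i hi hqi h; exact B2 i hi (by omega) h
    subst hb
    have hw2 := P2.right
    -- new path
    obtain ⟨z, hz, t, ht, S, hS, hP, hY, hX⟩ := hTC.hit (v (q+1))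
      (((range (p+1)).image v ∪ S1 ∪ S2).erase (v (q+1)))
      ((Icc (q+2) m).image v) (a := v 0) (b := v m)
      (by
        rw [mem_erase]
        refine ⟨fun h => by have := hinj _ (by omega) _ (by omega) h; omega, ?_⟩
        exact mem_union_left _ (mem_union_left _ (mem_image_of_mem _ (by simp))))
      (mem_image_of_mem _ (by simp; omega))
      (fun h => by have := hinj _ (by omega) _ (by omega) h; omega)
      (fun h => by have := hinj _ (by omega) _ (by omega) h; omega)
    obtain ⟨b', hb', rfl⟩ := mem_image.1 ht
    rw [mem_Icc] at hb'
    have BS : ∀ i ≤ m, q + 1 ≤ i → v i ∈ S → i = b' := by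
      intro i hi hqi h
      rcases hqi.lt_or_eq with hqi | rfl
      · exact hinj _ hi _ (by omega) (hX _ h (mem_image_of_mem _ (by simp; omega)))
      · exact absurd h hS
    have SA : ∀ i ≤ p, v i ∈ S → v i = z := by
      intro i hi h
      refine hY _ h (mem_erase.2 ⟨fun h' => hS (h' ▸ h), ?_⟩)
      exact mem_union_left _ (mem_union_left _ (mem_image_of_mem _ (by simp; omega)))
    have SS1 : ∀ u ∈ S, u ∈ S1 → u = z := by
      intro u h hu
      refine hY _ h (mem_erase.2 ⟨fun h' => hS (h' ▸ h), ?_⟩)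
      exact mem_union_left _ (mem_union_right _ hu)
    have SS2 : ∀ u ∈ S, u ∈ S2 → u = z := by
      intro u h hu
      refine hY _ h (mem_erase.2 ⟨fun h' => hS (h' ▸ h), ?_⟩)
      exact mem_union_right _ hu
    rw [mem_erase] at hz
    obtain ⟨hzw, hz⟩ := hz
    rw [disjoint_left] at hd
    by_cases hz1 : z ∈ S1
    · obtain ⟨T, T', hT, -, Q, -, -⟩ := P1.split hz1
      have hg := Q.glue hP (fun u hu hu' => SS1 u hu' (hT hu))
      refine ⟨a, b', h2, h1, S2, T ∪ S, hap, by omega, by omega, hh.symm, P2, hg, ?_, A2, ?_, ?_, ?_⟩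
      · rw [disjoint_left]
        intro u hu hu'
        rcases mem_union.1 hu' with h | h
        · exact hd (hT h) hu
        · have := SS2 u h hu
          subst this; exact hd hz1 hu
      · intro i hi h
        rcases mem_union.1 h with h | h
        · exact A1 i hi (hT h)
        · have := SA i hi h
          exact A1 i hi (this ▸ hz1)
      · intro i hi hqi h; exact B2 i hi (by omega) h
      · intro i hi hqi h
        rcases mem_union.1 h with h | h
        · have := B1 i hi (by omega) (hT h); omega
        · exact BS i hi hqi h
    by_cases hz2 : z ∈ S2
    · obtain ⟨T, T', hT, -, Q, Q', hdT⟩ := P2.split hz2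
      have hwT : v (q+1) ∉ T := fun h => hzw (hdT _ h Q'.right).symm
      have hg := Q.glue hP (fun u hu hu' => SS2 u hu' (hT hu))
      refine ⟨a, b', h1, h2, _, T ∪ S, hap, by omega, by omega, hh, hext, hg, ?_, A1', ?_, B1', ?_⟩
      · rw [disjoint_left]
        intro u hu hu'
        rcases mem_insert.1 hu with rfl | hu
        · rcases mem_union.1 hu' with h | h
          · exact hwT h
          · exact hS h
        · rcases mem_union.1 hu' with h | h
          · exact hd hu (hT h)
          · have := SS1 u h hu
            subst this; exact hz1 hu
      · intro i hi h
        rcases mem_union.1 h with h | h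
        · exact A2 i hi (hT h)
        · have := SA i hi h
          exact A2 i hi (this ▸ hz2)
      · intro i hi hqi h
        rcases mem_union.1 h with h | h
        · have := B2 i hi (by omega) (hT h)
          subst this; exact absurd h hwT
        · exact BS i hi hqi h
    have hzA : z ∈ (range (p+1)).image v := by
      rcases mem_union.1 hz with h | h
      · rcases mem_union.1 h with h | h
        · exact h
        · exact absurd h hz1
      · exact absurd h hz2
    obtain ⟨a', ha', rfl⟩ := mem_image.1 hzA
    rw [mem_range] at ha'
    have hd1 : ∀ u ∈ S, u ∉ S1 := fun u h hu => hz1 (SS1 u h hu ▸ hu)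
    have hd2 : ∀ u ∈ S, u ∉ S2 := fun u h hu => hz2 (SS2 u h hu ▸ hu)
    have hP1 := P1.left
    have hP2 := P2.left
    rcases hh with ⟨hh, hh'⟩ | ⟨hh, hh'⟩
    · have hap' : a' ≠ p := by
        rintro rfl; exact hz1 (hh ▸ hP1)
      refine ⟨a', b', h1, v a', _, S, by omega, by omega, by omega, Or.inl ⟨hh, rfl⟩, hext, hP, ?_,
        A1', SA, B1', BS⟩
      rw [disjoint_left]
      intro u hu hu'
      rcases mem_insert.1 hu with rfl | hu
      · exact hS hu'
      · exact hd1 u hu' hu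
    · have hap' : a' ≠ p := by
        rintro rfl; exact hz2 (hh ▸ hP2)
      refine ⟨a', b', h2, v a', S2, S, by omega, by omega, by omega, Or.inl ⟨hh, rfl⟩, P2, hP, ?_,
        A2, SA, fun i hi hqi h => B2 i hi (by omega) h, BS⟩
      rw [disjoint_left]
      intro u hu hu'
      exact hd2 u hu' hu
end
end LK
namespace LK
open Finset
def f0 (s n k c : ℕ) : ℕ :=
  Nat.choose (c - k) s + (n - (c - k)) * Nat.choose k (s - 1)

lemma convex_max (g : ℕ → ℕ) (a b : ℕ) (hg : ∀ k, a ≤ k → k + 2 ≤ b → 2 * g (k+1) ≤ g k + g (k+2))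
    (k : ℕ) (hak : a ≤ k) (hkb : k ≤ b) : g k ≤ max (g a) (g b) := by
  by_contra hcon
  rw [not_le, max_lt_iff] at hcon
  -- once increasing, it stays increasing
  have step : ∀ j, a ≤ j → j < b → g j < g (j+1) → ∀ i, j + 1 ≤ i → i ≤ b → g (j+1) ≤ g i ∧ (i + 1 ≤ b → g i < g (i+1)) := by
    intro j haj hjb hlt i hi
    induction i, hi using Nat.le_induction with
    | base =>
      intro _
      refine ⟨le_rfl, fun h => ?_⟩
      have := hg j haj (by omega)
      rw [show j + 1 + 1 = j + 2 by ring]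
      omega
    | succ i hi ih =>
      intro hib
      obtain ⟨h1, h2⟩ := ih (by omega)
      have h2 := h2 hib
      refine ⟨by omega, fun h => ?_⟩
      have := hg i (by omega) (by omega)
      rw [show i + 1 + 1 = i + 2 by ring]
      omega
  have noinc : ∀ j, a ≤ j → j < k → g (j+1) ≤ g j := by
    intro j haj hjk
    by_contra hlt
    rw [not_le] at hlt
    have h1 := (step j haj (by omega) hlt k (by omega) hkb)
    rcases Nat.lt_or_ge k b with h | h
    · have h2 := (step k hak h (h1.2 h) b (by omega) le_rfl).1
      have := h1.2 h
      omega
    · have : k = b := by omega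
      subst this; omega
  have : ∀ i, a ≤ i → i ≤ k → g i ≤ g a := by
    intro i hi
    induction i, hi using Nat.le_induction with
    | base => intro _; exact le_rfl
    | succ i hi ih => intro h; exact (noinc i hi (by omega)).trans (ih (by omega))
  have := this k hak le_rfl
  omega

lemma choose_convex (a s : ℕ) : 2 * (a+1).choose (s+1) ≤ a.choose (s+1) + (a+2).choose (s+1) := by
  have h1 := Nat.choose_succ_succ' (a+1) s
  have h2 := Nat.choose_succ_succ' a s
  have h3 : a.choose s ≤ (a+1).choose s := Nat.choose_le_choose s (by omega)
  rw [show a + 2 = a + 1 + 1 by ring]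
  omega

lemma f_max (s n c t k : ℕ) (hs : 2 ≤ s) (hn : c ≤ n) (ht : t + 1 ≤ c) (hk : 2 ≤ k) (hkt : k ≤ t) :
    f0 s n k c ≤ max (f0 s n 2 c) (f0 s n t c) := by
  apply convex_max (fun k => f0 s n k c) 2 t _ k hk hkt
  intro i hi hit
  obtain ⟨s, rfl⟩ : ∃ r, s = r + 2 := ⟨s - 2, by omega⟩
  obtain ⟨a, rfl⟩ : ∃ a, c = a + i + 2 := ⟨c - i - 2, by omega⟩
  obtain ⟨M, rfl⟩ : ∃ M, n = M + (a + i + 2) := ⟨n - (a + i + 2), by omega⟩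
  simp only [f0]
  rw [show a + i + 2 - (i+1) = a + 1 by omega, show a + i + 2 - i = a + 2 by omega,
    show a + i + 2 - (i+2) = a by omega, show M + (a + i + 2) - (a + 1) = M + i + 1 by omega,
    show M + (a + i + 2) - (a + 2) = M + i by omega, show M + (a + i + 2) - a = M + i + 2 by omega,
    show s + 2 - 1 = s + 1 by omega]
  have h1 := choose_convex a (s+1)
  have h2 := choose_convex i s
  have h3 : (i+1).choose (s+1) ≤ (i+2).choose (s+1) := Nat.choose_le_choose _ (by omega)
  rw [show s + 1 + 1 = s + 2 by ring] at h1
  nlinarith [Nat.mul_le_mul_left (M+i) h2]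

section
open Classical
variable {V : Type*} {G : SimpleGraph V}

noncomputable def cl (G : SimpleGraph V) (s : ℕ) (W : Finset V) : ℕ :=
  ((W.powersetCard s).filter (fun T : Finset V => G.IsClique (T : Set V))).card

lemma cl_le (s : ℕ) (W : Finset V) : cl G s W ≤ W.card.choose s := by
  unfold cl
  exact (card_filter_le _ _).trans (by simp)

lemma cl_erase (s k : ℕ) (hs : 1 ≤ s) (W : Finset V) (v : V) (hv : v ∈ W)
    (hk : (W.filter (G.Adj v)).card ≤ k) :
    cl G s W ≤ cl G s (W.erase v) + k.choose (s-1) := by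
  unfold cl
  rw [← card_filter_add_card_filter_not (s := (W.powersetCard s).filter _) (fun T => v ∉ T)]
  apply Nat.add_le_add
  · apply card_le_card
    intro T
    simp only [mem_filter, mem_powersetCard]
    rintro ⟨⟨⟨h1, h2⟩, h3⟩, h4⟩
    exact ⟨⟨subset_erase.2 ⟨h1, h4⟩, h2⟩, h3⟩
  · refine le_trans ?_ (Nat.choose_le_choose (s-1) hk)
    rw [← card_powersetCard]
    apply card_le_card_of_injOn (fun T => T.erase v)
    · intro T
      simp only [mem_filter, mem_powersetCard, coe_filter, Set.mem_ofPred_eq, not_not, mem_coe]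
      rintro ⟨⟨⟨h1, h2⟩, h3⟩, h4⟩
      refine ⟨?_, by rw [card_erase_of_mem h4, h2]⟩
      intro u hu
      rw [mem_erase] at hu
      rw [mem_filter]
      exact ⟨h1 hu.2, h3 h4 hu.2 hu.1.symm⟩
    · intro T hT T' hT' h
      simp only [mem_filter, coe_filter, Set.mem_ofPred_eq, not_not] at hT hT'
      rw [← insert_erase hT.2, ← insert_erase hT'.2]
      simp only at h
      rw [h]

lemma cl_bound (s k r : ℕ) (hs : 1 ≤ s) (U : Finset V)
    (h : ∀ W, U ⊆ W → r < W.card → ∃ v ∈ W, v ∉ U ∧ (W.filter (G.Adj v)).card ≤ k) (d : ℕ) :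
    ∀ W, U ⊆ W → W.card = r + d → cl G s W ≤ r.choose s + d * k.choose (s-1) := by
  induction d with
  | zero => intro W hU hW; simpa [hW] using cl_le (G := G) s W
  | succ d ih =>
    intro W hU hW
    obtain ⟨v, hv, hvU, hk⟩ := h W hU (by omega)
    have h1 := cl_erase s k hs W v hv hk
    have h2 := ih (W.erase v) (subset_erase.2 ⟨hU, hvU⟩) (by rw [card_erase_of_mem hv]; omega)
    rw [add_mul]
    omega
end
end LK
namespace LK
open Finset
section
open Classical
variable {V : Type*} {G : SimpleGraph V}

lemma kopylov_cross {c : ℕ} (hNL : NoLong G c) {v : ℕ → V} {m : ℕ}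
    (hinj : ∀ i ≤ m, ∀ j ≤ m, v i = v j → i = j)
    (hadj : ∀ i < m, G.Adj (v i) (v (i+1))) (hcm : c ≤ m + 1)
    (hex : ∃ d i, 1 ≤ d ∧ i + d ≤ m ∧ G.Adj (v m) (v i) ∧ G.Adj (v 0) (v (i+d))) :
    ((range (m+1)).filter (fun i => G.Adj (v 0) (v i))).card +
      ((range (m+1)).filter (fun i => G.Adj (v m) (v i))).card < c := by
  obtain ⟨i, hd1, hid, hy, hx⟩ := Nat.find_spec hex
  have hmin := fun k => Nat.find_min' hex (m := k)
  generalize Nat.find hex = d at *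
  have hP := (seg hinj hadj 0 i (by omega) (by omega)).symm.join hx
    (seg hinj hadj (i+d) m hid le_rfl) (by
      rw [disjoint_left]
      intro u hu hu'
      obtain ⟨a, ha, rfl⟩ := mem_image.1 hu
      obtain ⟨b, hb, hb'⟩ := mem_image.1 hu'
      rw [mem_Icc] at ha hb
      have := hinj _ (by omega) _ (by omega) hb'
      omega)
  have hcard := hNL _ _ _ hP hy.symm
  rw [← image_union, card_image_of_injOn (by
    intro a ha b hb hab
    simp only [coe_union, coe_Icc, Set.mem_union, Set.mem_Icc] at ha hb
    exact hinj _ (by omega) _ (by omega) hab), card_union_of_disjoint (by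
      rw [disjoint_left]; intro a; simp only [mem_Icc]; omega), Nat.card_Icc, Nat.card_Icc] at hcard
  have hd2 : 2 ≤ d := by omega
  have e1 : ((range (m+1)).filter (fun i => G.Adj (v 0) (v i))).card ≤
      ((range m).filter (fun i => G.Adj (v 0) (v (i+1)))).card := by
    rw [← card_image_of_injective (f := (· + 1)) ((range m).filter (fun i => G.Adj (v 0) (v (i+1))))
      (add_left_injective 1)]
    apply card_le_card
    intro k hk
    rw [mem_filter, mem_range] at hk
    rw [mem_image]
    have : k ≠ 0 := by rintro rfl; exact G.irrefl hk.2
    refine ⟨k - 1, ?_, by omega⟩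
    rw [mem_filter, mem_range, show k - 1 + 1 = k by omega]
    exact ⟨by omega, hk.2⟩
  have e2 : ((range (m+1)).filter (fun i => G.Adj (v m) (v i))).card ≤
      ((range m).filter (fun i => G.Adj (v m) (v i))).card := by
    apply card_le_card
    intro k hk
    rw [mem_filter, mem_range] at hk
    have : k ≠ m := by rintro rfl; exact G.irrefl hk.2
    rw [mem_filter, mem_range]
    exact ⟨by omega, hk.2⟩
  have e3 : ((range m).filter (fun i => G.Adj (v 0) (v (i+1)))).card +
      ((range m).filter (fun i => G.Adj (v m) (v i))).card ≤ ((range m) \ (Ioo i (i+d-1))).card := by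
    rw [← card_union_of_disjoint]
    · apply card_le_card
      intro k hk
      rw [mem_union, mem_filter, mem_filter, mem_range] at hk
      rw [mem_sdiff, mem_range, mem_Ioo]
      refine ⟨by omega, ?_⟩
      rintro ⟨h1, h2⟩
      rcases hk with hk | hk
      · have := hmin (k + 1 - i) ⟨i, by omega, by omega, hy, by
          rw [show i + (k + 1 - i) = k + 1 by omega]; exact hk.2⟩
        omega
      · have := hmin (i + d - k) ⟨k, by omega, by omega, hk.2, by
          rw [show k + (i + d - k) = i + d by omega]; exact hx⟩
        omega
    · rw [disjoint_left]
      intro k hk hk'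
      rw [mem_filter, mem_range] at hk hk'
      have := hmin 1 ⟨k, by omega, by omega, hk'.2, hk.2⟩
      omega
  have e4 : ((range m) \ (Ioo i (i+d-1))).card = m - (i + d - 1 - i - 1) := by
    rw [card_sdiff_of_subset, card_range, Nat.card_Ioo]
    intro k; simp only [mem_Ioo, mem_range]; omega
  omega

lemma kopylov {c : ℕ} (hTC : TC G) (hNL : NoLong G c) {v : ℕ → V} {m : ℕ} (hm : 1 ≤ m)
    (hinj : ∀ i ≤ m, ∀ j ≤ m, v i = v j → i = j)
    (hadj : ∀ i < m, G.Adj (v i) (v (i+1))) (hcm : c ≤ m + 1) :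
    ((range (m+1)).filter (fun i => G.Adj (v 0) (v i))).card +
      ((range (m+1)).filter (fun i => G.Adj (v m) (v i))).card < c := by
  by_cases hex : ∃ d i, 1 ≤ d ∧ i + d ≤ m ∧ G.Adj (v m) (v i) ∧ G.Adj (v 0) (v (i+d))
  · exact kopylov_cross hNL hinj hadj hcm hex
  have hnc : ∀ i ≤ m, ∀ j ≤ m, G.Adj (v m) (v i) → G.Adj (v 0) (v j) → j ≤ i := by
    intro i hi j hj h1 h2
    by_contra hlt
    exact hex ⟨j - i, i, by omega, by omega, h1, by rwa [show i + (j - i) = j by omega]⟩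
  clear hex
  set Nx := (range (m+1)).filter (fun i => G.Adj (v 0) (v i)) with hNx
  set Ny := (range (m+1)).filter (fun i => G.Adj (v m) (v i)) with hNy
  have hx1 : 1 ∈ Nx := by
    rw [hNx, mem_filter, mem_range]; exact ⟨by omega, hadj 0 (by omega)⟩
  have hy1 : m - 1 ∈ Ny := by
    rw [hNy, mem_filter, mem_range]
    have := hadj (m-1) (by omega)
    rw [show m - 1 + 1 = m by omega] at this
    exact ⟨by omega, this.symm⟩
  obtain ⟨p, hp, hpmax⟩ := Nx.exists_max_image id ⟨_, hx1⟩
  obtain ⟨q, hq, hqmin⟩ := Ny.exists_min_image id ⟨_, hy1⟩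
  simp only [id] at hpmax hqmin
  have hp1 := hpmax _ hx1
  have hq1 := hqmin _ hy1
  have hp' := hp
  have hq' := hq
  rw [hNx, mem_filter, mem_range] at hp'
  rw [hNy, mem_filter, mem_range] at hq'
  have hpq := hnc q (by omega) p (by omega) hq'.2 hp'.2
  obtain ⟨a, b, h1, h2, S1, S2, hap, hqb, hbm, hh, P1, P2, hd, A1, A2, B1, B2⟩ :=
    two_paths hTC hinj hadj p hp1 q hpq (by omega)
  obtain ⟨TA, hTA, PA, hxA, hNA⟩ := arc hinj hadj a p hap (by omega) hp'.2
  obtain ⟨TB, hTB, PB, hyB, hNB⟩ := arc (G := G) (v := fun k => v (m - k)) (m := m)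
    (fun i hi j hj h => by have := hinj _ (by omega) _ (by omega) h; omega)
    (fun i hi => by
      have := hadj (m - (i+1)) (by omega)
      rw [show m - (i+1) + 1 = m - i by omega] at this
      exact this.symm) (m - b) (m - q) (by omega) (by omega) (by
        simp only [Nat.sub_zero]; rw [show m - (m - q) = q by omega]; exact hq'.2)
  simp only [Nat.sub_zero, show m - (m - q) = q by omega, show m - (m - b) = b by omega] at PB hyB hNB
  have hTA' : ∀ u ∈ TA, ∃ i ≤ p, v i = u := by
    intro u hu
    obtain ⟨i, hi, rfl⟩ := mem_image.1 (hTA hu)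
    exact ⟨i, (mem_Icc.1 hi).2, rfl⟩
  have hTB' : ∀ u ∈ TB, ∃ i ≤ m, q ≤ i ∧ v i = u := by
    intro u hu
    obtain ⟨i, hi, rfl⟩ := mem_image.1 (hTB hu)
    rw [mem_Icc] at hi
    exact ⟨m - i, by omega, by omega, rfl⟩
  have hNB' : ∀ j ∈ Ny, v j ∈ TB := by
    intro j hj
    have h1 := hqmin j hj
    rw [hNy, mem_filter, mem_range] at hj
    have := hNB (m - j) (by omega)
    rw [show m - (m - j) = j by omega] at this
    exact this hj.2
  have hNA' : ∀ j ∈ Nx, v j ∈ TA := by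
    intro j hj
    have h1 := hpmax j hj
    rw [hNx, mem_filter, mem_range] at hj
    exact hNA j h1 hj.2
  have PA' : Pth G h2 h1 TA := by
    rcases hh with ⟨rfl, rfl⟩ | ⟨rfl, rfl⟩
    · exact PA
    · exact PA.symm
  have g1 := PA'.glue P1 (by
    intro u hu hu'
    obtain ⟨i, hi, rfl⟩ := hTA' u hu
    exact A1 i hi hu')
  have g2 := g1.glue PB.symm (by
    intro u hu hu'
    obtain ⟨j, hj, hqj, rfl⟩ := hTB' u hu'
    rcases mem_union.1 hu with hu | hu
    · obtain ⟨i, hi, hij⟩ := hTA' _ hu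
      have := hinj _ (by omega) _ hj hij
      rw [show j = q by omega]
    · rw [B1 j hj hqj hu])
  have hne : h2 ≠ v b := by
    rcases hh with ⟨rfl, rfl⟩ | ⟨rfl, rfl⟩ <;>
    · intro h
      have := hinj _ (by omega) _ (by omega) h
      omega
  obtain ⟨d, hd1, Pd⟩ := P2.uncons hne
  have g3 := g2.glue Pd.symm (by
    intro u hu hu'
    rw [mem_erase] at hu'
    rcases mem_union.1 hu with hu | hu
    · rcases mem_union.1 hu with hu | hu
      · obtain ⟨i, hi, rfl⟩ := hTA' _ hu
        exact absurd (A2 i hi hu'.2) hu'.1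
      · exact absurd hu'.2 (disjoint_left.1 hd hu)
    · obtain ⟨j, hj, hqj, rfl⟩ := hTB' u hu
      rw [B2 j hj hqj hu'.2])
  refine lt_of_le_of_lt ?_ (hNL _ _ _ g3 hd1)
  have c1 : (insert 0 (Nx.erase p)).card = Nx.card := by
    rw [card_insert_of_notMem, card_erase_of_mem hp]
    · have := card_pos.2 ⟨_, hp⟩; omega
    · intro h
      have := mem_of_mem_erase h
      rw [hNx, mem_filter] at this
      exact G.irrefl this.2
  have c2 : Disjoint (insert 0 (Nx.erase p)) Ny := by
    rw [disjoint_left]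
    intro k hk hk'
    have := hqmin k hk'
    rcases mem_insert.1 hk with rfl | hk
    · omega
    · rw [mem_erase] at hk
      have := hpmax k hk.2
      omega
  rw [← c1, ← card_union_of_disjoint c2]
  apply card_le_card_of_injOn v
  · intro k hk
    simp only [coe_union, Set.mem_union, mem_coe] at hk ⊢
    rcases hk with hk | hk
    · rcases mem_insert.1 hk with rfl | hk
      · exact Or.inl (Or.inl (Or.inl hxA))
      · exact Or.inl (Or.inl (Or.inl (hNA' _ (mem_of_mem_erase hk))))
    · exact Or.inl (Or.inr (hNB' _ hk))
  · have hle : ∀ k ∈ insert 0 (Nx.erase p) ∪ Ny, k ≤ m := by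
      intro k hk
      rcases mem_union.1 hk with hk | hk
      · rcases mem_insert.1 hk with rfl | hk
        · omega
        · have := mem_of_mem_erase hk
          rw [hNx, mem_filter, mem_range] at this
          omega
      · rw [hNy, mem_filter, mem_range] at hk
        omega
    intro i hi j hj hij
    exact hinj _ (hle i hi) _ (hle j hj) hij

/-- path version -/
lemma kopylov_pth {c : ℕ} (hTC : TC G) (hNL : NoLong G c) {x y : V} (hxy : x ≠ y) {S : Finset V}
    (hP : Pth G x y S) (hcS : c ≤ S.card) :
    (S.filter (G.Adj x)).card + (S.filter (G.Adj y)).card < c := by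
  obtain ⟨v, m, h1, rfl, rfl, h4, hinj, hadj⟩ := hP.param
  have hm : 1 ≤ m := by
    rcases Nat.eq_zero_or_pos m with rfl | h
    · exact absurd rfl hxy
    · exact h
  have := kopylov hTC hNL hm hinj hadj (by omega)
  refine lt_of_le_of_lt (Nat.add_le_add ?_ ?_) this
  all_goals
    rw [h4, filter_image]
    exact card_image_le

lemma pair_adj {c : ℕ} [Fintype V] (hTC : TC G) (hNL : NoLong G c)
    (hmax : ∀ x y, x ≠ y → ¬ G.Adj x y → ∃ S, Pth G x y S ∧ c ≤ S.card)
    (A B : Finset V) (α β : ℕ) (hA : ∀ a ∈ A, α ≤ (A.filter (G.Adj a)).card)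
    (hB : ∀ a ∈ B, β ≤ (B.filter (G.Adj a)).card) (hc : c ≤ α + β) :
    ∀ a ∈ A, ∀ b ∈ B, a ≠ b → G.Adj a b := by
  by_contra hcon
  push Not at hcon
  obtain ⟨a0, ha0, b0, hb0, hab0, hadj0⟩ := hcon
  obtain ⟨S0, hS0, hc0⟩ := hmax a0 b0 hab0 hadj0
  obtain ⟨S, hS, hSmax⟩ := exists_max_image
    ((univ : Finset (Finset V)).filter (fun S => ∃ a ∈ A, ∃ b ∈ B, a ≠ b ∧ ¬ G.Adj a b ∧ Pth G a b S))
    card ⟨S0, by simp only [mem_filter, mem_univ, true_and]; exact ⟨a0, ha0, b0, hb0, hab0, hadj0, hS0⟩⟩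
  simp only [mem_filter, mem_univ, true_and] at hS hSmax
  obtain ⟨a, ha, b, hb, hab, hnadj, hP⟩ := hS
  have hcS : c ≤ S.card := hc0.trans (hSmax S0 ⟨a0, ha0, b0, hb0, hab0, hadj0, hS0⟩)
  have hk := kopylov_pth hTC hNL hab hP hcS
  have hA' : (A.filter (G.Adj a)).card ≤ (S.filter (G.Adj a)).card := by
    apply card_le_card
    intro x hx
    rw [mem_filter] at hx ⊢
    refine ⟨?_, hx.2⟩
    by_contra hxS
    have hP' := Pth.cons hx.2.symm hP hxS
    have hcard := card_insert_of_notMem hxS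
    by_cases hxb : G.Adj x b
    · have := hNL _ _ _ hP' hxb
      omega
    · have := hSmax _ ⟨x, hx.1, b, hb, fun h => hxS (h ▸ hP.right), hxb, hP'⟩
      omega
  have hB' : (B.filter (G.Adj b)).card ≤ (S.filter (G.Adj b)).card := by
    apply card_le_card
    intro x hx
    rw [mem_filter] at hx ⊢
    refine ⟨?_, hx.2⟩
    by_contra hxS
    have hP' := (Pth.cons hx.2.symm hP.symm hxS).symm
    have hcard := card_insert_of_notMem hxS
    by_cases hxb : G.Adj a x
    · have := hNL _ _ _ hP' hxb
      omega
    · have := hSmax _ ⟨a, ha, x, hx.1, fun h => hxS (h ▸ hP.left), hxb, hP'⟩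
      omega
  have := hA a ha
  have := hB b hb
  omega

/-- cliques are small -/
lemma clique_small {c : ℕ} [Fintype V] (hc : 5 ≤ c) (hn : c ≤ Fintype.card V) (hTC : TC G)
    (hNL : NoLong G c) (H : Finset V)
    (hcl : ∀ x ∈ H, ∀ y ∈ H, x ≠ y → G.Adj x y) : H.card + 2 ≤ c := by
  by_contra hcon
  by_cases hHc : c ≤ H.card
  · obtain ⟨a, ha, b, hb, hab⟩ := one_lt_card.1 (show 1 < H.card by omega)
    have := hNL _ _ _ (clique_pth _ H a b le_rfl hcl ha hb hab) (hcl a ha b hb hab)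
    omega
  obtain ⟨u, hu, b, hb, hub⟩ := one_lt_card.1 (show 1 < H.card by omega)
  have : ∃ y, y ∉ H := by
    by_contra h
    push Not at h
    rw [eq_univ_of_forall h, card_univ] at hHc
    omega
  obtain ⟨y, hy⟩ := this
  have hne : ∀ x ∈ H, y ≠ x := fun x hx h => hy (h ▸ hx)
  obtain ⟨z, hz, t, ht, S, hS, hP, hY, -⟩ := hTC.hit u (H.erase u) {y} (a := b) (b := y)
    (mem_erase.2 ⟨hub.symm, hb⟩) (by simp) hub.symm (hne u hu)
  obtain rfl : t = y := by simpa using ht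
  rw [mem_erase] at hz
  obtain ⟨w, hzw, Pw⟩ := hP.uncons (hne z hz.2).symm
  have hw : w ∉ H := by
    intro hw
    have hwS := Pw.left
    rw [mem_erase] at hwS
    exact hwS.1 (hY w hwS.2 (mem_erase.2 ⟨fun h => hS (h ▸ hwS.2), hw⟩))
  obtain ⟨z', hz', t', ht', S', hS', hP', hY', -⟩ := hTC.hit z (H.erase z) {w} (a := u) (b := w)
    (mem_erase.2 ⟨hz.1.symm, hu⟩) (by simp) hz.1.symm (fun h => hw (h ▸ hz.2))
  obtain rfl : t' = w := by simpa using ht'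
  rw [mem_erase] at hz'
  have hg := (clique_pth _ H z z' le_rfl hcl hz.2 hz'.2 hz'.1.symm).glue hP' (by
    intro x hx hx'
    exact hY' x hx' (mem_erase.2 ⟨fun h => hS' (h ▸ hx'), hx⟩))
  have h1 := hNL _ _ _ hg hzw
  have h2 : (insert t' H).card ≤ (H ∪ S').card := by
    apply card_le_card
    intro x hx
    rcases mem_insert.1 hx with rfl | hx
    · exact mem_union_right _ hP'.right
    · exact mem_union_left _ hx
  rw [card_insert_of_notMem hw] at h2
  omega
end
end LK
namespace LK
open Finset
section
open Classical
variable {V : Type*} {G : SimpleGraph V}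

lemma main [Fintype V] (c s : ℕ)
    (hc : 5 ≤ c) (hn : c ≤ Fintype.card V) (hs : 2 ≤ s) (hTC : TC G) (hNL : NoLong G c)
    (hmax : ∀ x y, x ≠ y → ¬ G.Adj x y → ∃ S, Pth G x y S ∧ c ≤ S.card) :
    cl G s univ ≤ max (f0 s (Fintype.card V) 2 c) (f0 s (Fintype.card V) ((c - 1) / 2) c) := by
  obtain ⟨t, ht⟩ : ∃ t, t = (c - 1) / 2 := ⟨_, rfl⟩
  rw [← ht]
  by_cases hD : ∃ W : Finset V, W.Nonempty ∧ ∀ a ∈ W, t + 1 ≤ (W.filter (G.Adj a)).card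
  swap
  · push Not at hD
    refine le_trans ?_ (le_max_right _ _)
    refine cl_bound s t (c - t) (by omega) ∅ ?_ (Fintype.card V - (c - t)) univ (by simp)
      (by rw [card_univ]; omega)
    intro W _ hW
    obtain ⟨v, hv, h⟩ := hD W (card_pos.1 (by omega))
    exact ⟨v, hv, by simp, by omega⟩
  · have hD' : ((univ : Finset (Finset V)).filter (fun W => W.Nonempty ∧
        ∀ a ∈ W, t + 1 ≤ (W.filter (G.Adj a)).card)).Nonempty := by
      obtain ⟨W, hW⟩ := hD
      exact ⟨W, by simpa using hW⟩
    obtain ⟨H, hH, hHmax⟩ := exists_max_image _ card hD'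
    simp only [mem_filter, mem_univ, true_and] at hH hHmax
    obtain ⟨⟨h0, hh0⟩, hHd⟩ := hH
    have hcl := pair_adj hTC hNL hmax H H (t+1) (t+1) hHd hHd (by omega)
    have hfil : ∀ K : Finset V, (∀ a ∈ K, ∀ b ∈ K, a ≠ b → G.Adj a b) → ∀ a ∈ K,
        (K.filter (G.Adj a)).card = K.card - 1 := by
      intro K hK a ha
      rw [← card_erase_of_mem ha]
      congr 1
      ext b
      rw [mem_filter, mem_erase]
      exact ⟨fun h => ⟨h.2.ne.symm, h.1⟩, fun h => ⟨h.2, hK a ha b h.2 h.1.symm⟩⟩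
    have hr1 := clique_small hc hn hTC hNL H hcl
    have hr2 : t + 2 ≤ H.card := by
      have := hHd h0 hh0
      rw [hfil H hcl h0 hh0] at this
      omega
    refine le_trans ?_ (f_max s (Fintype.card V) c t (c - H.card) hs hn (by omega) (by omega) (by omega))
    unfold f0
    rw [show c - (c - H.card) = H.card by omega]
    refine cl_bound s (c - H.card) H.card (by omega) H ?_ (Fintype.card V - H.card) univ (subset_univ _)
      (by rw [card_univ]; omega)
    intro W hHW hW
    by_cases hWd : ∀ a ∈ W, c - H.card + 1 ≤ (W.filter (G.Adj a)).card
    · exfalso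
      have hadj := pair_adj hTC hNL hmax H W (H.card - 1) (c - H.card + 1)
        (fun a ha => (hfil H hcl a ha).ge) hWd (by omega)
      obtain ⟨y, hyW, hyH⟩ : ∃ y ∈ W, y ∉ H := by
        by_contra h
        push Not at h
        have := card_le_card (show W ⊆ H from h)
        omega
      have hcl' : ∀ a ∈ insert y H, ∀ b ∈ insert y H, a ≠ b → G.Adj a b := by
        intro a ha b hb hab
        rcases mem_insert.1 ha with ha1 | ha1 <;> rcases mem_insert.1 hb with hb1 | hb1
        · exact absurd (ha1.trans hb1.symm) hab
        · exact (hadj b hb1 a (ha1 ▸ hyW) hab.symm).symm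
        · exact hadj a ha1 b (hb1 ▸ hyW) hab
        · exact hcl a ha1 b hb1 hab
      have hcard := card_insert_of_notMem hyH
      have := hHmax (insert y H) ⟨by simp, fun a ha => by
        rw [hfil _ hcl' a ha]; omega⟩
      omega
    · push Not at hWd
      obtain ⟨v, hv, hvk⟩ := hWd
      refine ⟨v, hv, fun hvH => ?_, by omega⟩
      have h1 := hHd v hvH
      have h2 : (H.filter (G.Adj v)).card ≤ (W.filter (G.Adj v)).card :=
        card_le_card (filter_subset_filter _ hHW)
      omega

end
end LK

/-- Luo's theorem: a 2-connected graph on `n` vertices with circumference less than `c`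
(where `n ≥ c ≥ 5`, `s ≥ 2`) has at most `max{f_s(n,2,c), f_s(n,⌊(c-1)/2⌋,c)}`
copies of `K_s`. -/
theorem luo_kopylov {V : Type*} [Fintype V] (G : SimpleGraph V) (c s : ℕ)
    (hc : 5 ≤ c) (hn : c ≤ Fintype.card V) (hs : 2 ≤ s) (h2conn : TwoConnected G)
    (hcirc : ∀ (v : V) (w : G.Walk v v), w.IsCycle → w.length < c) :
    cliqueCount G s ≤
      max (f s (Fintype.card V) 2 c) (f s (Fintype.card V) ((c - 1) / 2) c) := by
  classical
  have hTC : LK.TC G := LK.TC_of h2conn.2.2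
  have hNL : LK.NoLong G c := by
    intro a b S hP hab
    by_contra h
    obtain ⟨v, w, h1, h2⟩ := LK.cycle_of_pth hP hab (by omega)
    have := hcirc v w h1
    omega
  obtain ⟨G', hle, hG'⟩ := Set.Finite.exists_le_maximal
    (s := {K : SimpleGraph V | LK.NoLong K c}) (Set.toFinite _) hNL
  have hNL' : LK.NoLong G' c := hG'.1
  have hmain := LK.main (G := G') c s hc hn hs (hTC.mono hle) hNL' (by
    intro x y hxy hadj
    apply LK.long_of_add_edge (by omega) hNL' hxy
    intro h
    have := hG'.2 h le_sup_left (SimpleGraph.sup_adj .. |>.2 (Or.inr (by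
      rw [SimpleGraph.edge_adj]; exact ⟨Or.inl ⟨rfl, rfl⟩, hxy⟩)) : (G' ⊔ SimpleGraph.edge x y).Adj x y)
    exact hadj this)
  refine le_trans ?_ hmain
  unfold cliqueCount LK.cl
  rw [← Set.ncard_coe_finset]
  apply Set.ncard_le_ncard
  · intro T hT
    have hT' : G.IsNClique s T := hT
    simp only [Finset.coe_filter, Finset.mem_powersetCard, Finset.subset_univ, true_and]
    exact ⟨hT'.card_eq, hT'.isClique.mono hle⟩
  · exact Finset.finite_toSet _
end

section
/- Let n ≥ c ≥ 5, s ≥ 2, and k ≥ 2 be integers. If G is a 2-connected simple graph on n vertices with minimum degree δ(G) ≥ k and with circumference (length of a longest cycle) less than c, then the number of copies of K_s in G satisfies N_s(G) ≤ max{ f_s(n,k,c), f_s(n,⌊(c-1)/2⌋,c) }. -/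
section Aux
open scoped Classical

/-- `HP G A u w`: there is a path in `G` from `u` to `w` with vertex set `A`. -/
inductive HP {V : Type*} (G : SimpleGraph V) : Finset V → V → V → Prop
  | single (u : V) : HP G {u} u u
  | cons {A : Finset V} {u v w : V} (h : G.Adj u v) (p : HP G A v w) (hu : u ∉ A) :
      HP G (insert u A) u w

namespace HP
variable {V : Type*} {G : SimpleGraph V}

theorem left_mem {A : Finset V} {u w : V} (h : HP G A u w) : u ∈ A := by
  cases h <;> simp

theorem right_mem {A : Finset V} {u w : V} (h : HP G A u w) : w ∈ A := by
  induction h <;> simp [*]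

theorem trans_edge {A B : Finset V} {u v v' w : V} (h : HP G A u v) (h' : HP G B v' w)
    (e : G.Adj v v') (d : Disjoint A B) : HP G (A ∪ B) u w := by
  induction h with
  | single u => exact HP.cons e h' (by simpa using d)
  | cons h p hu ih =>
    rw [Finset.insert_union]
    rw [Finset.disjoint_insert_left] at d
    exact HP.cons h (ih e d.2) (by simp [hu, d.1])

theorem trans {A B : Finset V} {u v w : V} (h : HP G A u v) (h' : HP G B v w)
    (d : ∀ z ∈ A, z ∈ B → z = v) : HP G (A ∪ B) u w := by
  induction h with
  | single u =>
    have := h'.left_mem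
    rwa [Finset.union_eq_right.2 (by simpa using this)]
  | cons h p hu ih =>
    rw [Finset.insert_union]
    refine HP.cons h (ih h' fun z hz hz' => d z (by simp [hz]) hz') ?_
    rw [Finset.mem_union]
    rintro (h1 | h1)
    · exact hu h1
    · have := d _ (Finset.mem_insert_self _ _) h1
      subst this
      exact hu p.right_mem

theorem symm {A : Finset V} {u w : V} (h : HP G A u w) : HP G A w u := by
  induction h with
  | single u => exact HP.single u
  | @cons A u v w h p hu ih =>
    have := trans_edge ih (HP.single u) h.symm (by simpa using hu)
    rwa [Finset.union_comm, ← Finset.insert_eq] at this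

theorem split {A : Finset V} {u w z : V} (h : HP G A u w) (hz : z ∈ A) :
    ∃ A1 ⊆ A, HP G A1 u z ∧ (z ≠ w → w ∉ A1) := by
  induction h with
  | single u =>
    simp at hz; subst hz
    exact ⟨{z}, by simp, HP.single z, by simp⟩
  | @cons A u v w h p hu ih =>
    by_cases e : z = u
    · subst e
      exact ⟨{z}, by simp, HP.single z, by simp; tauto⟩
    · have hz' : z ∈ A := by simpa [e] using hz
      obtain ⟨A1, h1, h2, h3⟩ := ih hz'
      refine ⟨insert u A1, Finset.insert_subset_insert _ h1, HP.cons h h2 fun h => hu (h1 h), ?_⟩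
      intro hne hw
      rcases Finset.mem_insert.1 hw with h4 | h4
      · subst h4; exact hu p.right_mem
      · exact h3 hne h4

theorem exists_walk {A : Finset V} {u w : V} (h : HP G A u w) :
    ∃ p : G.Walk u w, p.IsPath ∧ p.length + 1 = A.card ∧ ∀ z, z ∈ p.support ↔ z ∈ A := by
  induction h with
  | single u => exact ⟨.nil, by simp, by simp, by simp⟩
  | @cons A u v w h p hu ih =>
    obtain ⟨q, h1, h2, h3⟩ := ih
    refine ⟨.cons h q, ?_, ?_, ?_⟩
    · rw [SimpleGraph.Walk.cons_isPath_iff]; exact ⟨h1, by rwa [h3]⟩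
    · rw [Finset.card_insert_of_notMem hu]; simp [h2]
    · intro z; simp [h3]

theorem of_walk {u w : V} (p : G.Walk u w) (hp : p.IsPath) : HP G p.support.toFinset u w := by
  induction p with
  | nil => simpa using HP.single _
  | cons h q ih =>
    rw [SimpleGraph.Walk.cons_isPath_iff] at hp
    have := HP.cons h (ih hp.1) (by simpa using hp.2)
    simpa using this

theorem index {A : Finset V} {x y : V} (h : HP G A x y) :
    ∃ (v : ℕ → V) (m : ℕ), v 0 = x ∧ v m = y ∧ (∀ i < m, G.Adj (v i) (v (i+1))) ∧
      (∀ i ≤ m, ∀ j ≤ m, v i = v j → i = j) ∧ A = (Finset.range (m+1)).image v := by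
  induction h with
  | single u => exact ⟨fun _ => u, 0, rfl, rfl, by simp, by simp, by simp⟩
  | @cons A u v w h p hu ih =>
    obtain ⟨f, m, h0, hm, ha, hi, hA⟩ := ih
    refine ⟨fun i => Nat.casesOn i u f, m+1, rfl, hm, ?_, ?_, ?_⟩
    · rintro (_ | i) hi
      · simpa [h0] using h
      · exact ha i (by omega)
    · have key : ∀ i ≤ m, u ≠ f i := by
        rintro i hi rfl
        exact hu (by rw [hA]; exact Finset.mem_image_of_mem _ (by simp; omega))
      rintro (_ | i) h1 (_ | j) h2 h3
      · rfl
      · exact absurd h3 (key j (by omega))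
      · exact absurd h3.symm (key i (by omega))
      · rw [hi i (by omega) j (by omega) h3]
    · rw [hA]; ext z
      simp only [Finset.mem_insert, Finset.mem_image, Finset.mem_range]
      constructor
      · rintro (rfl | ⟨i, hi, rfl⟩)
        · exact ⟨0, by omega, rfl⟩
        · exact ⟨i+1, by omega, rfl⟩
      · rintro ⟨(_ | i), hi, rfl⟩
        · exact Or.inl rfl
        · exact Or.inr ⟨i, by omega, rfl⟩

theorem seg {v : ℕ → V} {m : ℕ} (ha : ∀ i < m, G.Adj (v i) (v (i+1)))
    (hi : ∀ i ≤ m, ∀ j ≤ m, v i = v j → i = j) (i j : ℕ) (hij : i ≤ j) (hj : j ≤ m) :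
    HP G ((Finset.Icc i j).image v) (v i) (v j) := by
  induction hij using Nat.decreasingInduction with
  | self => simpa using HP.single (G := G) (v j)
  | of_succ k hk ih =>
    have := HP.cons (ha k (by omega)) ih (by
      simp only [Finset.mem_image, Finset.mem_Icc, not_exists, not_and]
      intro l hl h
      have := hi l (by omega) k (by omega) h
      omega)
    rwa [← Finset.image_insert, Finset.insert_Icc_add_one_left_eq_Icc (by omega)] at this

/-- splitting along an added edge -/
theorem add_edge {x y : V} {A : Finset V} {u w : V} (h : HP (G ⊔ SimpleGraph.edge x y) A u w) :
    HP G A u w ∨ ∃ A1 A2, Disjoint A1 A2 ∧ A1 ∪ A2 = A ∧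
      ((HP G A1 u x ∧ HP G A2 y w) ∨ (HP G A1 u y ∧ HP G A2 x w)) := by
  induction h with
  | single u => exact Or.inl (HP.single u)
  | @cons A u v w h p hu ih =>
    rcases ih with ih | ⟨A1, A2, hd, hU, h3⟩
    · by_cases e : G.Adj u v
      · exact Or.inl (HP.cons e ih hu)
      · right
        have : (u = x ∧ v = y) ∨ (u = y ∧ v = x) := by
          rw [SimpleGraph.sup_adj, SimpleGraph.edge_adj] at h
          tauto
        refine ⟨{u}, A, by simpa using hu, by rw [Finset.insert_eq], ?_⟩
        rcases this with ⟨rfl, rfl⟩ | ⟨rfl, rfl⟩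
        · exact Or.inl ⟨HP.single _, ih⟩
        · exact Or.inr ⟨HP.single _, ih⟩
    · right
      by_cases e : G.Adj u v
      · subst hU
        rw [Finset.mem_union, not_or] at hu
        refine ⟨insert u A1, A2, by simp [hu, hd], by rw [Finset.insert_union], ?_⟩
        rcases h3 with ⟨h4, h5⟩ | ⟨h4, h5⟩
        · exact Or.inl ⟨HP.cons e h4 hu.1, h5⟩
        · exact Or.inr ⟨HP.cons e h4 hu.1, h5⟩
      · exfalso
        have : u ∈ A := by
          subst hU
          rw [SimpleGraph.sup_adj, SimpleGraph.edge_adj] at h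
          rcases h with h | ⟨⟨rfl, rfl⟩ | ⟨rfl, rfl⟩, _⟩
          · exact absurd h e
          · rcases h3 with ⟨h4, h5⟩ | ⟨h4, h5⟩
            · simp [h4.right_mem]
            · simp [h5.left_mem]
          · rcases h3 with ⟨h4, h5⟩ | ⟨h4, h5⟩
            · simp [h5.left_mem]
            · simp [h4.right_mem]
        exact hu this

end HP

/-- no cycle of length at least `c`, in terms of `HP` -/
def NC {V : Type*} (G : SimpleGraph V) (c : ℕ) : Prop :=
  ∀ A u w, HP G A u w → G.Adj w u → A.card < c

theorem NC_of {V : Type*} {G : SimpleGraph V} {c : ℕ} (hc : 3 ≤ c)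
    (hcirc : ∀ (v : V) (w : G.Walk v v), w.IsCycle → w.length < c) : NC G c := by
  intro A u w h e
  by_contra hA
  cases h with
  | single u => exact G.loopless.irrefl _ e
  | @cons A _ v _ h p hu =>
    obtain ⟨q, h1, h2, h3⟩ := p.exists_walk
    rw [Finset.card_insert_of_notMem hu] at hA
    have hcy : (SimpleGraph.Walk.cons e (SimpleGraph.Walk.cons h q)).IsCycle := by
      rw [SimpleGraph.Walk.cons_isCycle_iff]
      refine ⟨by rw [SimpleGraph.Walk.cons_isPath_iff]; exact ⟨h1, by rwa [h3]⟩, ?_⟩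
      rw [SimpleGraph.Walk.edges_cons, List.mem_cons]
      rintro (h4 | h4)
      · have : w = v := by
          rw [Sym2.eq_iff] at h4
          rcases h4 with ⟨rfl, rfl⟩ | ⟨h5, _⟩
          · rfl
          · exact h5
        subst this
        have := SimpleGraph.Walk.length_eq_zero_iff.2 (SimpleGraph.Walk.isPath_iff_nil.1 h1)
        omega
      · exact hu ((h3 _).1 (q.snd_mem_support_of_mem_edges h4))
    have := hcirc _ _ hcy
    simp at this
    omega

theorem conn {V : Type*} {G : SimpleGraph V}
    (h2 : ∀ v : V, (G.induce ({v}ᶜ : Set V)).Connected) (z : V) (A B : Finset V)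
    (hzA : z ∉ A) (hzB : z ∉ B) (hA : A.Nonempty) (hB : B.Nonempty) :
    ∃ u ∈ A, ∃ w ∈ B, ∃ R, HP G R u w ∧ z ∉ R ∧ (∀ i ∈ R, i ∈ A → i = u) ∧
      (∀ i ∈ R, i ∈ B → i = w) := by
  have key : ∀ (n : ℕ) (R : Finset V) (u w : V), R.card = n → u ∈ A → w ∈ B → HP G R u w →
      z ∉ R → ∃ u ∈ A, ∃ w ∈ B, ∃ R, HP G R u w ∧ z ∉ R ∧ (∀ i ∈ R, i ∈ A → i = u) ∧
      (∀ i ∈ R, i ∈ B → i = w) := by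
    intro n
    induction n using Nat.strong_induction_on with
    | _ n ih =>
      intro R u w hn hu hw hR hz
      by_cases c1 : ∃ i ∈ R, i ∈ A ∧ i ≠ u
      · obtain ⟨i, hi, hiA, hne⟩ := c1
        obtain ⟨R1, hs, hp, hnot⟩ := hR.symm.split hi
        have hlt : R1.card < R.card := Finset.card_lt_card
          ⟨hs, fun h => hnot hne (h hR.left_mem)⟩
        exact ih _ (hn ▸ hlt) R1 i w rfl hiA hw hp.symm fun h => hz (hs h)
      by_cases c2 : ∃ i ∈ R, i ∈ B ∧ i ≠ w
      · obtain ⟨i, hi, hiA, hne⟩ := c2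
        obtain ⟨R1, hs, hp, hnot⟩ := hR.split hi
        have hlt : R1.card < R.card := Finset.card_lt_card
          ⟨hs, fun h => hnot hne (h hR.right_mem)⟩
        exact ih _ (hn ▸ hlt) R1 u i rfl hu hiA hp fun h => hz (hs h)
      push Not at c1 c2
      exact ⟨u, hu, w, hw, R, hR, hz, c1, c2⟩
  obtain ⟨u, hu⟩ := hA
  obtain ⟨w, hw⟩ := hB
  have hu' : u ∈ ({z}ᶜ : Set V) := by simp; rintro rfl; exact hzA hu
  have hw' : w ∈ ({z}ᶜ : Set V) := by simp; rintro rfl; exact hzB hw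
  obtain ⟨q⟩ := (h2 z).preconnected ⟨u, hu'⟩ ⟨w, hw'⟩
  let q' : G.Walk u w := q.map (SimpleGraph.Embedding.induce _).toHom
  have hq' : z ∉ q'.support := by
    intro h
    have e : q'.support = q.support.map _ := SimpleGraph.Walk.support_map (SimpleGraph.Embedding.induce _).toHom q
    rw [e, List.mem_map] at h
    obtain ⟨⟨y, hy⟩, _, h3⟩ := h
    exact hy h3
  refine key _ _ u w rfl hu hw (HP.of_walk q'.bypass q'.bypass_isPath) ?_
  rw [List.mem_toFinset]
  exact fun h => hq' (q'.support_bypass_subset_support h)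

def DPaths {V : Type*} (G : SimpleGraph V) (v : ℕ → V) (a m j : ℕ) (S T : Finset V)
    (α β e1 e2 : ℕ) : Prop :=
  Disjoint S T ∧ HP G S (v α) (v e1) ∧ HP G T (v β) (v e2) ∧
  (∀ i ≤ a, v i ∈ S → i = α) ∧ (∀ i ≤ a, v i ∈ T → i = β) ∧
  (∀ i, j ≤ i → i ≤ m → v i ∈ S → i = e1) ∧ (∀ i, j ≤ i → i ≤ m → v i ∈ T → i = e2) ∧
  ((α = a ∧ β < a) ∨ (β = a ∧ α < a)) ∧
  ((e1 = j ∧ j < e2 ∧ e2 ≤ m) ∨ (e2 = j ∧ j < e1 ∧ e1 ≤ m))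

theorem DPaths.symm {V : Type*} {G : SimpleGraph V} {v : ℕ → V} {a m j : ℕ} {S T : Finset V}
    {α β e1 e2 : ℕ} (h : DPaths G v a m j S T α β e1 e2) : DPaths G v a m j T S β α e2 e1 := by
  obtain ⟨h1, h2, h3, h4, h5, h6, h7, h8, h9⟩ := h
  exact ⟨h1.symm, h3, h2, h5, h4, h7, h6, h8.symm, h9.symm⟩

theorem DPaths.step {V : Type*} {G : SimpleGraph V}
    (hG : ∀ v : V, (G.induce ({v}ᶜ : Set V)).Connected)
    {v : ℕ → V} {a m j : ℕ} {S T : Finset V} {α β e1 e2 : ℕ}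
    (ha : ∀ i < m, G.Adj (v i) (v (i+1)))
    (hi : ∀ i ≤ m, ∀ j ≤ m, v i = v j → i = j)
    (haj : a ≤ j) (hjm : j + 1 < m)
    (h : DPaths G v a m j S T α β e1 e2) :
    ∃ S T α β e1 e2, DPaths G v a m (j+1) S T α β e1 e2 := by
  wlog hw : e1 = j ∧ j < e2 ∧ e2 ≤ m generalizing S T α β e1 e2
  · refine this h.symm ?_
    obtain ⟨h1, h2, h3, h4, h5, h6, h7, h8, h9⟩ := h
    tauto
  obtain ⟨h1, h2, h3, h4, h5, h6, h7, h8, h9⟩ := h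
  obtain ⟨rfl, hlt, hle⟩ := hw
  rename' e1 => j
  have hnS : v (j+1) ∉ S := fun hh => by
    have := h6 _ (by omega) (by omega) hh; omega
  have hext : HP G (S ∪ {v (j+1)}) (v α) (v (j+1)) :=
    h2.trans_edge (HP.single _) (ha j (by omega)) (by simpa using hnS)
  have hx1 : ∀ i ≤ a, v i ∈ S ∪ {v (j+1)} → i = α := by
    intro i hia hmem
    rw [Finset.mem_union, Finset.mem_singleton] at hmem
    rcases hmem with hmem | hmem
    · exact h4 i hia hmem
    · have := hi _ (by omega) _ (by omega) hmem; omega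
  have hx2 : ∀ i, j + 1 ≤ i → i ≤ m → v i ∈ S ∪ {v (j+1)} → i = j + 1 := by
    intro i hia him hmem
    rw [Finset.mem_union, Finset.mem_singleton] at hmem
    rcases hmem with hmem | hmem
    · have := h6 i (by omega) him hmem; omega
    · exact hi _ (by omega) _ (by omega) hmem
  by_cases hq : e2 = j + 1
  swap
  · refine ⟨S ∪ {v (j+1)}, T, α, β, j+1, e2, ?_, hext, h3, hx1, h5, hx2, ?_, h8, Or.inl ?_⟩
    · rw [Finset.disjoint_union_left]
      refine ⟨h1, ?_⟩
      rw [Finset.disjoint_singleton_left]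
      intro hh
      have := h7 _ (by omega) (by omega) hh; omega
    · intro i hi1; exact h7 i (by omega)
    · omega
  subst hq
  obtain ⟨u, hu, w, hw, R, hR, hzR, hRA, hRB⟩ := conn hG (v (j+1))
    ((S ∪ T ∪ (Finset.Icc 0 a).image v).erase (v (j+1))) ((Finset.Icc (j+2) m).image v)
    (by simp) (by
      intro hh
      simp only [Finset.mem_image, Finset.mem_Icc] at hh
      obtain ⟨i, hi1, hi2⟩ := hh
      have := hi _ (by omega) _ (by omega) hi2; omega)
    ⟨v α, by
      rw [Finset.mem_erase]
      refine ⟨fun hh => ?_, by simp [h2.left_mem]⟩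
      have := hi _ (by omega) _ (by omega) hh; omega⟩
    ⟨v m, by simp only [Finset.mem_image, Finset.mem_Icc]; exact ⟨m, by omega, rfl⟩⟩
  simp only [Finset.mem_image, Finset.mem_Icc] at hw
  obtain ⟨q, hq, rfl⟩ := hw
  rw [Finset.mem_erase, Finset.mem_union, Finset.mem_union] at hu
  obtain ⟨hune, hu⟩ := hu
  -- facts on R
  have R1 : ∀ i, j + 1 ≤ i → i ≤ m → v i ∈ R → i = q := by
    intro i hi1 hi2 hm
    by_cases e : i = j + 1
    · subst e; exact absurd hm hzR
    · have := hRB _ hm (by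
        simp only [Finset.mem_image, Finset.mem_Icc]; exact ⟨i, by omega, rfl⟩)
      exact hi _ (by omega) _ (by omega) this
  have R2 : ∀ z ∈ S, z ∈ R → z = u := by
    intro z hz hzR'
    refine hRA z hzR' ?_
    rw [Finset.mem_erase]
    exact ⟨by rintro rfl; exact hzR hzR', by simp [hz]⟩
  have R3 : ∀ z ∈ T, z ∈ R → z = u := by
    intro z hz hzR'
    refine hRA z hzR' ?_
    rw [Finset.mem_erase]
    exact ⟨by rintro rfl; exact hzR hzR', by simp [hz]⟩
  have R4 : ∀ i ≤ a, v i ∈ R → v i = u := by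
    intro i hia hzR'
    refine hRA _ hzR' ?_
    rw [Finset.mem_erase]
    refine ⟨by intro e; rw [e] at hzR'; exact hzR hzR', ?_⟩
    rw [Finset.mem_union]; right
    exact Finset.mem_image_of_mem _ (by simp [hia])
  by_cases huS : u ∈ S
  · have huT : u ∉ T := Finset.disjoint_left.1 h1 huS
    obtain ⟨S1, hs, hp, -⟩ := h2.split huS
    refine ⟨S1 ∪ R, T, α, β, q, j+1, ?_, hp.trans hR fun z hz => R2 z (hs hz), h3, ?_, h5, ?_,
      fun i hi1 => h7 i (by omega), h8, Or.inr (by omega)⟩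
    · rw [Finset.disjoint_union_left]
      refine ⟨Finset.disjoint_of_subset_left hs h1, ?_⟩
      rw [Finset.disjoint_left]
      intro z hz hzT
      exact huT (R3 z hzT hz ▸ hzT)
    · intro i hia hm
      rcases Finset.mem_union.1 hm with hm | hm
      · exact h4 i hia (hs hm)
      · exact h4 i hia (R4 i hia hm ▸ huS)
    · intro i hi1 hi2 hm
      rcases Finset.mem_union.1 hm with hm | hm
      · have := h6 i (by omega) hi2 (hs hm); omega
      · exact R1 i hi1 hi2 hm
  by_cases huT : u ∈ T
  · obtain ⟨T1, hs, hp, hnot⟩ := h3.split huT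
    have hnot := hnot hune
    refine ⟨S ∪ {v (j+1)}, T1 ∪ R, α, β, j+1, q, ?_, hext,
      hp.trans hR fun z hz => R3 z (hs hz), hx1, ?_, hx2, ?_, h8, Or.inl (by omega)⟩
    · rw [Finset.disjoint_union_left, Finset.disjoint_union_right, Finset.disjoint_singleton_left]
      refine ⟨⟨Finset.disjoint_of_subset_right hs h1, ?_⟩, ?_⟩
      · rw [Finset.disjoint_left]
        intro z hz hzR'
        exact huS (R2 z hz hzR' ▸ hz)
      · simp [hnot, hzR]
    · intro i hia hm
      rcases Finset.mem_union.1 hm with hm | hm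
      · exact h5 i hia (hs hm)
      · exact h5 i hia (R4 i hia hm ▸ huT)
    · intro i hi1 hi2 hm
      rcases Finset.mem_union.1 hm with hm | hm
      · have := h7 i (by omega) hi2 (hs hm)
        subst this; exact absurd hm hnot
      · exact R1 i hi1 hi2 hm
  have hu' : u ∈ (Finset.Icc 0 a).image v := by tauto
  simp only [Finset.mem_image, Finset.mem_Icc] at hu'
  obtain ⟨p, hp, rfl⟩ := hu'
  have hpα : p ≠ α := by rintro rfl; exact huS h2.left_mem
  have hpβ : p ≠ β := by rintro rfl; exact huT h3.left_mem
  have dS : Disjoint S R := by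
    rw [Finset.disjoint_left]
    intro z hz hzR'
    exact huS (R2 z hz hzR' ▸ hz)
  have dT : Disjoint T R := by
    rw [Finset.disjoint_left]
    intro z hz hzR'
    exact huT (R3 z hz hzR' ▸ hz)
  have R5 : ∀ i ≤ a, v i ∈ R → i = p := fun i hia hm =>
    hi _ (by omega) _ (by omega) (R4 i hia hm)
  rcases h8 with h8 | h8
  · refine ⟨S ∪ {v (j+1)}, R, α, p, j+1, q, ?_, hext, hR, hx1, R5, hx2, R1, Or.inl (by omega),
      Or.inl (by omega)⟩
    rw [Finset.disjoint_union_left, Finset.disjoint_singleton_left]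
    exact ⟨dS, hzR⟩
  · exact ⟨R, T, p, β, q, j+1, dT.symm, hR, h3, R5, h5, R1, fun i hi1 => h7 i (by omega),
      Or.inr (by omega), Or.inr (by omega)⟩

theorem DPaths.exists {V : Type*} {G : SimpleGraph V}
    (hG : ∀ v : V, (G.induce ({v}ᶜ : Set V)).Connected)
    {v : ℕ → V} {a m : ℕ}
    (ha : ∀ i < m, G.Adj (v i) (v (i+1)))
    (hi : ∀ i ≤ m, ∀ j ≤ m, v i = v j → i = j)
    (ha0 : 0 < a) (b : ℕ) (hab : a ≤ b) (hbm : b < m) :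
    ∃ S T α β e1 e2, DPaths G v a m b S T α β e1 e2 := by
  induction b, hab using Nat.le_induction with
  | base =>
    obtain ⟨u, hu, w, hw, R, hR, hzR, hRA, hRB⟩ := conn hG (v a)
      ((Finset.Icc 0 (a-1)).image v) ((Finset.Icc (a+1) m).image v)
      (by
        intro hh
        simp only [Finset.mem_image, Finset.mem_Icc] at hh
        obtain ⟨i, hi1, hi2⟩ := hh
        have := hi _ (by omega) _ (by omega) hi2; omega) (by
        intro hh
        simp only [Finset.mem_image, Finset.mem_Icc] at hh
        obtain ⟨i, hi1, hi2⟩ := hh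
        have := hi _ (by omega) _ (by omega) hi2; omega)
      ⟨v 0, Finset.mem_image_of_mem _ (by simp)⟩
      ⟨v m, Finset.mem_image_of_mem _ (by simp; omega)⟩
    simp only [Finset.mem_image, Finset.mem_Icc] at hw hu
    obtain ⟨q, hq, rfl⟩ := hw
    obtain ⟨p, hp, rfl⟩ := hu
    refine ⟨{v a}, R, a, p, a, q, by simpa using hzR, HP.single _, hR, ?_, ?_, ?_, ?_,
      Or.inl (by omega), Or.inl (by omega)⟩
    · intro i hia hm
      exact hi _ (by omega) _ (by omega) (Finset.mem_singleton.1 hm)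
    · intro i hia hm
      have : i ≠ a := by rintro rfl; exact hzR hm
      exact hi _ (by omega) _ (by omega)
        (hRA _ hm (Finset.mem_image_of_mem _ (by simp; omega)))
    · intro i hia hia' hm
      exact hi _ (by omega) _ (by omega) (Finset.mem_singleton.1 hm)
    · intro i hia hia' hm
      have : i ≠ a := by rintro rfl; exact hzR hm
      exact hi _ (by omega) _ (by omega)
        (hRB _ hm (Finset.mem_image_of_mem _ (by simp; omega)))
  | succ j haj ih =>
    obtain ⟨S, T, α, β, e1, e2, h⟩ := ih (by omega)
    exact h.step hG ha hi haj hbm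

theorem kop_index {V : Type*} {G : SimpleGraph V} {c : ℕ}
    (hG : ∀ v : V, (G.induce ({v}ᶜ : Set V)).Connected) (hNC : NC G c)
    {v : ℕ → V} {m : ℕ} (ha : ∀ i < m, G.Adj (v i) (v (i+1)))
    (hi : ∀ i ≤ m, ∀ j ≤ m, v i = v j → i = j) (hm : c ≤ m + 1) (hm1 : 1 ≤ m)
    (Dx Dy : Finset ℕ) (hDx : ∀ i, i ∈ Dx ↔ i ≤ m ∧ G.Adj (v 0) (v i))
    (hDy : ∀ i, i ∈ Dy ↔ i ≤ m ∧ G.Adj (v m) (v i)) (hd : c ≤ Dx.card + Dy.card) : False := by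
  have hinj : ∀ s : Finset ℕ, (∀ i ∈ s, i ≤ m) → (s.image v).card = s.card := fun s hs =>
    Finset.card_image_of_injOn fun i h1 j h2 h => hi i (hs i h1) j (hs j h2) h
  have h0x : 0 ∉ Dx := by rw [hDx]; simp
  have hmy : m ∉ Dy := by rw [hDy]; simp
  have cross : ∀ i ∈ Dx, ∀ j ∈ Dy, j < i → j + 1 + (m - i + 1) < c := by
    intro i hix j hjy hji
    rw [hDx] at hix
    rw [hDy] at hjy
    have P1 := HP.seg ha hi 0 j (by omega) (by omega)
    have P2 := (HP.seg ha hi i m (by omega) (by omega)).symm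
    have hdis : Disjoint ((Finset.Icc 0 j).image v) ((Finset.Icc i m).image v) := by
      rw [Finset.disjoint_left]
      intro z h1 h2
      simp only [Finset.mem_image, Finset.mem_Icc] at h1 h2
      obtain ⟨p, hp, rfl⟩ := h1
      obtain ⟨q, hq, e⟩ := h2
      have := hi _ (by omega) _ (by omega) e
      omega
    have P3 := P1.trans_edge P2 hjy.2.symm hdis
    have := hNC _ _ _ P3 hix.2.symm
    rw [Finset.card_union_of_disjoint hdis, hinj _ (by simp; omega), hinj _ (by simp)] at this
    simp at this
    omega
  by_cases hcr : ∃ d, ∃ i ∈ Dx, ∃ j ∈ Dy, j < i ∧ i - j = d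
  · obtain ⟨i, hix, j, hjy, hji, hd'⟩ := Nat.find_spec hcr
    have hmin : ∀ i' ∈ Dx, ∀ j' ∈ Dy, j' < i' → i - j ≤ i' - j' := by
      intro i' h1 j' h2 h3
      rw [hd']
      exact Nat.find_min' hcr ⟨i', h1, j', h2, h3, rfl⟩
    have hlt := cross i hix j hjy hji
    have hDx' := fun i => (hDx i).1
    have hDy' := fun i => (hDy i).1
    have hdis : Disjoint Dx (Dy.image (· + 1)) := by
      rw [Finset.disjoint_left]
      intro z h1 h2
      obtain ⟨k, hk, rfl⟩ := Finset.mem_image.1 h2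
      have := cross _ h1 k hk (by simp)
      have := hDx' _ h1
      simp at *
      omega
    have hsub : Dx ∪ Dy.image (· + 1) ⊆ Finset.Icc 1 (j+1) ∪ Finset.Icc i m := by
      intro z hz
      rw [Finset.mem_union, Finset.mem_Icc, Finset.mem_Icc]
      rcases Finset.mem_union.1 hz with h1 | h1
      · have h2 := hDx' _ h1
        have h3 : z ≠ 0 := by rintro rfl; exact h0x h1
        have h4 := hmin z h1 j hjy
        omega
      · obtain ⟨k, hk, rfl⟩ := Finset.mem_image.1 h1
        have h2 := hDy' _ hk
        have h3 : k ≠ m := by rintro rfl; exact hmy hk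
        have h4 := hmin i hix k hk
        omega
    have h5 := Finset.card_le_card hsub
    rw [Finset.card_union_of_disjoint hdis,
      Finset.card_image_of_injective _ (add_left_injective 1)] at h5
    have h6 := Finset.card_union_le (Finset.Icc 1 (j+1)) (Finset.Icc i m)
    simp at h6
    have := hDx' _ hix
    omega
  have hcr' : ∀ i ∈ Dx, ∀ j ∈ Dy, i ≤ j := by
    intro i h1 j h2
    by_contra h
    exact hcr ⟨_, i, h1, j, h2, by omega, rfl⟩
  have h1x : 1 ∈ Dx := (hDx 1).2 ⟨hm1, ha 0 (by omega)⟩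
  have hm1y : m - 1 ∈ Dy := by
    refine (hDy _).2 ⟨by omega, ?_⟩
    have := (ha (m-1) (by omega)).symm
    rwa [Nat.sub_add_cancel hm1] at this
  obtain ⟨a, hax, hamax⟩ := Dx.exists_max_image id ⟨_, h1x⟩
  obtain ⟨b, hby, hbmin⟩ := Dy.exists_min_image id ⟨_, hm1y⟩
  simp only [id] at hamax hbmin
  have hab := hcr' a hax b hby
  have ha1 := hamax 1 h1x
  have hbm := hbmin _ hm1y
  obtain ⟨S, T, α, β, e1, e2, hI⟩ := DPaths.exists hG ha hi (a := a) (by omega) b hab (by omega)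
  obtain ⟨S, T, p, e1, e2, hp, hI⟩ : ∃ S T p e1 e2, p < a ∧ DPaths G v a m b S T a p e1 e2 := by
    have h8 := hI.2.2.2.2.2.2.2.1
    rcases h8 with ⟨rfl, h8⟩ | ⟨rfl, h8⟩
    · exact ⟨_, _, _, _, _, h8, hI⟩
    · exact ⟨_, _, _, _, _, h8, hI.symm⟩
  obtain ⟨h1, h2, h3, h4, h5, h6, h7, -, h9⟩ := hI
  -- X part
  obtain ⟨p', hp', hpmin⟩ := (Dx.filter (p < ·)).exists_min_image id
    ⟨a, Finset.mem_filter.2 ⟨hax, hp⟩⟩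
  rw [Finset.mem_filter] at hp'
  have hp'a := hamax _ hp'.1
  have X1 := (HP.seg ha hi 0 p (by omega) (by omega)).symm
  have X2 := HP.seg ha hi p' a (by omega) (by omega)
  have X3 := X1.trans_edge X2 ((hDx _).1 hp'.1).2 (by
    rw [Finset.disjoint_left]
    intro z h1 h2
    simp only [Finset.mem_image, Finset.mem_Icc] at h1 h2
    obtain ⟨i, hi1, rfl⟩ := h1
    obtain ⟨q, hq, e⟩ := h2
    have := hi _ (by omega) _ (by omega) e
    omega)
  set X := (Finset.Icc 0 p).image v ∪ (Finset.Icc p' a).image v with hX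
  have XI : ∀ z ∈ X, ∃ i ≤ a, v i = z := by
    intro z hz
    simp only [hX, Finset.mem_union, Finset.mem_image, Finset.mem_Icc] at hz
    rcases hz with ⟨i, hi1, rfl⟩ | ⟨i, hi1, rfl⟩
    · exact ⟨i, by omega, rfl⟩
    · exact ⟨i, by omega, rfl⟩
  have Z1 := h3.symm.trans X3 (by
    intro z hz hzX
    obtain ⟨i, hia, rfl⟩ := XI z hzX
    rw [h5 i hia hz])
  have Z2 := Z1.trans h2 (by
    intro z hz hzS
    rcases Finset.mem_union.1 hz with hz | hz
    · exact absurd hz (Finset.disjoint_left.1 h1 hzS)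
    · obtain ⟨i, hia, rfl⟩ := XI z hz
      rw [h4 i hia hzS])
  have ZI : ∀ i, b ≤ i → i ≤ m → v i ∈ T ∪ X ∪ S → i = e1 ∨ i = e2 ∨ i = b := by
    intro i hb him hz
    rcases Finset.mem_union.1 hz with hz | hz
    · rcases Finset.mem_union.1 hz with hz | hz
      · exact Or.inr (Or.inl (h7 i hb him hz))
      · obtain ⟨k, hk, e⟩ := XI _ hz
        have := hi _ (by omega) _ (by omega) e
        omega
    · exact Or.inl (h6 i hb him hz)
  obtain ⟨q, hbq, hqm, Z, hZ, hZI, hXZ⟩ : ∃ q, b < q ∧ q ≤ m ∧ ∃ Z, HP G Z (v q) (v b) ∧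
      (∀ i, b ≤ i → i ≤ m → v i ∈ Z → i = b ∨ i = q) ∧ X ⊆ Z := by
    have hs : X ⊆ T ∪ X ∪ S := fun z hz => by simp [hz]
    rcases h9 with ⟨rfl, h9, h9'⟩ | ⟨rfl, h9, h9'⟩
    · refine ⟨e2, h9, h9', _, Z2, ?_, hs⟩
      intro i hi1 hi2 hz
      have := ZI i hi1 hi2 hz; omega
    · refine ⟨e1, h9, h9', _, Z2.symm, ?_, hs⟩
      intro i hi1 hi2 hz
      have := ZI i hi1 hi2 hz; omega
  obtain ⟨q', hq', hqmax⟩ := (Dy.filter (· < q)).exists_max_image id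
    ⟨b, Finset.mem_filter.2 ⟨hby, hbq⟩⟩
  rw [Finset.mem_filter] at hq'
  have hbq' := hbmin _ hq'.1
  have Y1 := (HP.seg ha hi q m (by omega) (by omega)).symm
  have Y2 := HP.seg ha hi b q' (by omega) (by omega)
  have C1 := Y1.trans hZ (by
    intro z hz hzZ
    simp only [Finset.mem_image, Finset.mem_Icc] at hz
    obtain ⟨i, hi1, rfl⟩ := hz
    have := hZI i (by omega) (by omega) hzZ
    congr 1; omega)
  have C2 := C1.trans Y2 (by
    intro z hz hz'
    simp only [Finset.mem_union, Finset.mem_image, Finset.mem_Icc] at hz hz'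
    obtain ⟨i, hi1, rfl⟩ := hz'
    rcases hz with ⟨k, hk, e⟩ | hz
    · have := hi _ (by omega) _ (by omega) e; omega
    · have := hZI i (by omega) (by omega) hz
      congr 1; omega)
  have hfin := hNC _ _ _ C2 ((hDy _).1 hq'.1).2.symm
  have hEsub : (insert 0 (Dx.erase a) ∪ Dy).image v ⊆
      (Finset.Icc q m).image v ∪ Z ∪ (Finset.Icc b q').image v := by
    intro z hz
    obtain ⟨i, hiE, rfl⟩ := Finset.mem_image.1 hz
    rw [Finset.mem_union, Finset.mem_insert, Finset.mem_erase] at hiE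
    have hcase : (i ≤ p ∨ (p' ≤ i ∧ i ≤ a)) ∨ (q ≤ i ∧ i ≤ m) ∨ (b ≤ i ∧ i ≤ q') := by
      rcases hiE with (h | h) | h
      · omega
      · have := hamax i h.2
        by_cases hip : p < i
        · have := hpmin i (Finset.mem_filter.2 ⟨h.2, hip⟩)
          simp only [id] at this
          omega
        · omega
      · have := hbmin i h
        have := ((hDy _).1 h).1
        by_cases hip : i < q
        · have := hqmax i (Finset.mem_filter.2 ⟨h, hip⟩)
          simp only [id] at this
          omega
        · omega
    rw [Finset.mem_union, Finset.mem_union]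
    rcases hcase with h | h | h
    · left; right; apply hXZ
      rw [hX, Finset.mem_union]
      rcases h with h | h
      · exact Or.inl (Finset.mem_image_of_mem _ (by simp [h]))
      · exact Or.inr (Finset.mem_image_of_mem _ (by simp [h]))
    · exact Or.inl (Or.inl (Finset.mem_image_of_mem _ (by simp [h])))
    · exact Or.inr (Finset.mem_image_of_mem _ (by simp [h]))
  have hcard := Finset.card_le_card hEsub
  rw [hinj _ (by
    intro i hiE
    rw [Finset.mem_union, Finset.mem_insert, Finset.mem_erase] at hiE
    rcases hiE with (h | h) | h
    · omega
    · exact ((hDx _).1 h.2).1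
    · exact ((hDy _).1 h).1), Finset.card_union_of_disjoint (by
      rw [Finset.disjoint_left]
      intro i hiE hiy
      have := hbmin i hiy
      rw [Finset.mem_insert, Finset.mem_erase] at hiE
      rcases hiE with h | h
      · omega
      · have := hamax i h.2
        omega), Finset.card_insert_of_notMem (by simp [h0x]), Finset.card_erase_of_mem hax] at hcard
  have : 0 < Dx.card := Finset.card_pos.2 ⟨_, hax⟩
  omega

theorem kopylov {V : Type*} {G : SimpleGraph V} {c : ℕ}
    (hG : ∀ v : V, (G.induce ({v}ᶜ : Set V)).Connected) (hNC : NC G c)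
    {S : Finset V} {x y : V} (h : HP G S x y) (hxy : x ≠ y) (hS : c ≤ S.card)
    (hd : c ≤ (S.filter (G.Adj x)).card + (S.filter (G.Adj y)).card) : False := by
  obtain ⟨v, m, rfl, rfl, ha, hi, rfl⟩ := h.index
  have hinj : ∀ s : Finset ℕ, (∀ i ∈ s, i ≤ m) → (s.image v).card = s.card := fun s hs =>
    Finset.card_image_of_injOn fun i h1 j h2 h => hi i (hs i h1) j (hs j h2) h
  have hr : ∀ i ∈ Finset.range (m+1), i ≤ m := fun i hi => by
    have := Finset.mem_range.1 hi; omega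
  rw [hinj _ hr] at hS
  rw [Finset.filter_image, Finset.filter_image,
    hinj _ (fun i hi => hr i (Finset.mem_filter.1 hi).1),
    hinj _ (fun i hi => hr i (Finset.mem_filter.1 hi).1)] at hd
  refine kop_index hG hNC ha hi (by simpa using hS) ?_ _ _ ?_ ?_ hd
  · by_contra h
    have : m = 0 := by omega
    subst this; exact hxy rfl
  · intro i; simp
  · intro i; simp

theorem pair_lemma {V : Type*} [Fintype V] {G : SimpleGraph V} {c : ℕ}
    (hG : ∀ v : V, (G.induce ({v}ᶜ : Set V)).Connected) (hNC : NC G c)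
    (hmax : ∀ x y, x ≠ y → ¬ G.Adj x y → ∃ S, HP G S x y ∧ c ≤ S.card)
    (D1 D2 : Finset V) (d1 d2 : ℕ) (h1 : ∀ x ∈ D1, d1 ≤ (D1.filter (G.Adj x)).card)
    (h2 : ∀ x ∈ D2, d2 ≤ (D2.filter (G.Adj x)).card) (hd : c ≤ d1 + d2)
    (x y : V) (hx : x ∈ D1) (hy : y ∈ D2) (hxy : x ≠ y) : G.Adj x y := by
  by_contra hnadj
  let P : ℕ → Prop := fun n => ∃ x ∈ D1, ∃ y ∈ D2, x ≠ y ∧ ¬ G.Adj x y ∧ ∃ S, HP G S x y ∧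
    c ≤ S.card ∧ S.card = n
  have hbd : ∀ n, P n → n ≤ Fintype.card V := by
    rintro n ⟨_, _, _, _, _, _, S, _, _, rfl⟩
    exact Finset.card_le_univ _
  obtain ⟨S0, hS0, hc0⟩ := hmax x y hxy hnadj
  have hP0 : P S0.card := ⟨x, hx, y, hy, hxy, hnadj, S0, hS0, hc0, rfl⟩
  have hPm := Nat.findGreatest_spec (hbd _ hP0) hP0
  obtain ⟨x, hx, y, hy, hxy, hnadj, S, hS, hcS, hSm⟩ := hPm
  have hgr : ∀ n, P n → n ≤ S.card := fun n hn => by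
    rw [hSm]; exact Nat.le_findGreatest (hbd _ hn) hn
  have k1 : D1.filter (G.Adj x) ⊆ S.filter (G.Adj x) := by
    intro z hz
    rw [Finset.mem_filter] at hz ⊢
    refine ⟨?_, hz.2⟩
    by_contra hzS
    have hp := HP.cons hz.2.symm hS hzS
    have hcard := Finset.card_insert_of_notMem hzS
    by_cases e : G.Adj z y
    · have := hNC _ _ _ hp e.symm
      omega
    · have := hgr _ ⟨z, hz.1, y, hy, by rintro rfl; exact hzS hS.right_mem, e, _, hp, by omega, rfl⟩
      omega
  have k2 : D2.filter (G.Adj y) ⊆ S.filter (G.Adj y) := by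
    intro z hz
    rw [Finset.mem_filter] at hz ⊢
    refine ⟨?_, hz.2⟩
    by_contra hzS
    have hp := HP.cons hz.2.symm hS.symm hzS
    have hcard := Finset.card_insert_of_notMem hzS
    by_cases e : G.Adj z x
    · have := hNC _ _ _ hp e.symm
      omega
    · have := hgr _ ⟨x, hx, z, hz.1, by rintro rfl; exact hzS hS.left_mem, fun h => e h.symm, _,
        hp.symm, by omega, rfl⟩
      omega
  have := Finset.card_le_card k1
  have := Finset.card_le_card k2
  have := h1 x hx
  have := h2 y hy
  exact kopylov hG hNC hS hxy hcS (by omega)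

theorem HP.eq_single {V : Type*} {G : SimpleGraph V} {A : Finset V} {u : V} (h : HP G A u u) :
    A = {u} := by
  cases h with
  | single => rfl
  | cons h p hu => exact absurd p.right_mem hu

theorem exists_max {V : Type*} [Fintype V] {G : SimpleGraph V} {c : ℕ} (hc : 3 ≤ c)
    (hNC : NC G c) : ∃ G' ≥ G, NC G' c ∧
      ∀ x y, x ≠ y → ¬ G'.Adj x y → ∃ S, HP G' S x y ∧ c ≤ S.card := by
  obtain ⟨G', hle, hM⟩ := (Set.toFinite {G' : SimpleGraph V | NC G' c}).exists_le_maximal hNC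
  have hN' : NC G' c := hM.prop
  refine ⟨G', hle, hN', ?_⟩
  intro x y hxy hna
  have hnot : ¬ NC (G' ⊔ SimpleGraph.edge x y) c := by
    intro h
    have := hM.le_of_ge h le_sup_left
    apply hna
    apply this
    rw [SimpleGraph.sup_adj, SimpleGraph.edge_adj]
    right; exact ⟨Or.inl ⟨rfl, rfl⟩, hxy⟩
  unfold NC at hnot
  push Not at hnot
  obtain ⟨A, u, w, hA, hadj, hcA⟩ := hnot
  have hadj' : G'.Adj w u ∨ (w = x ∧ u = y) ∨ (w = y ∧ u = x) := by
    rw [SimpleGraph.sup_adj, SimpleGraph.edge_adj] at hadj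
    tauto
  rcases hA.add_edge with hB | ⟨A1, A2, hd, rfl, h3⟩
  · rcases hadj' with h | ⟨rfl, rfl⟩ | ⟨rfl, rfl⟩
    · have := hN' _ _ _ hB h; omega
    · exact ⟨A, hB.symm, hcA⟩
    · exact ⟨A, hB, hcA⟩
  · rcases hadj' with h | hh
    · rcases h3 with ⟨h4, h5⟩ | ⟨h4, h5⟩
      · exact ⟨_, h4.symm.trans_edge h5.symm h.symm hd, hcA⟩
      · exact ⟨_, (h4.symm.trans_edge h5.symm h.symm hd).symm, hcA⟩
    · exfalso
      have hcard := Finset.card_union_le A1 A2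
      have key : ∀ p q, HP G' A1 p p → HP G' A2 q q → False := by
        intro p q h1 h2
        rw [h1.eq_single, h2.eq_single] at hcard hcA
        simp only [Finset.card_singleton] at hcard
        omega
      rcases h3 with ⟨h4, h5⟩ | ⟨h4, h5⟩ <;> rcases hh with ⟨rfl, rfl⟩ | ⟨rfl, rfl⟩
      · exact Finset.disjoint_left.1 hd h4.left_mem h5.left_mem
      · exact key _ _ h4 h5
      · exact key _ _ h4 h5
      · exact Finset.disjoint_left.1 hd h4.left_mem h5.left_mem

theorem clique_ham {V : Type*} {G : SimpleGraph V} (A : Finset V) :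
    ∀ u ∉ A, (∀ x ∈ insert u A, ∀ y ∈ insert u A, x ≠ y → G.Adj x y) →
      ∃ w, HP G (insert u A) u w := by
  induction A using Finset.induction_on with
  | empty => intro u _ _; exact ⟨u, HP.single u⟩
  | insert v A hv ih =>
    intro u hu h
    obtain ⟨w, hw⟩ := ih v hv fun x hx y hy => h x (by simp [Finset.mem_insert.1 hx])
      y (by simp [Finset.mem_insert.1 hy])
    exact ⟨w, HP.cons (h u (by simp) v (by simp) (by rintro rfl; simp at hu)) hw hu⟩

theorem clique_small {V : Type*} {G : SimpleGraph V} {c : ℕ} (hc : 3 ≤ c) (hNC : NC G c)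
    (A : Finset V) (h : ∀ x ∈ A, ∀ y ∈ A, x ≠ y → G.Adj x y) : A.card < c := by
  rcases A.eq_empty_or_nonempty with rfl | ⟨u, hu⟩
  · simp; omega
  · obtain ⟨w, hw⟩ := clique_ham (G := G) (A.erase u) u (by simp) (by
      rw [Finset.insert_erase hu]; exact h)
    rw [Finset.insert_erase hu] at hw
    by_cases e : w = u
    · subst e
      rw [hw.eq_single]; simp; omega
    · exact hNC _ _ _ hw (h _ hw.right_mem _ hu e)

/-- number of `s`-cliques inside `W` -/
noncomputable def cliqIn {V : Type*} (G : SimpleGraph V) (s : ℕ) (W : Finset V) : ℕ :=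
  ((W.powersetCard s).filter (fun t : Finset V => G.IsClique (t : Set V))).card

theorem cliqIn_le {V : Type*} (G : SimpleGraph V) (s : ℕ) (W : Finset V) :
    cliqIn G s W ≤ W.card.choose s := by
  rw [← Finset.card_powersetCard]; unfold cliqIn; exact Finset.card_filter_le _ _

theorem cliqIn_erase {V : Type*} (G : SimpleGraph V) (s : ℕ) (hs : 1 ≤ s) (W : Finset V) (x : V)
    (d : ℕ) (hx : (W.filter (G.Adj x)).card ≤ d) :
    cliqIn G s W ≤ cliqIn G s (W.erase x) + d.choose (s-1) := by
  have hsub : (W.powersetCard s).filter (fun t : Finset V => G.IsClique (t : Set V)) ⊆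
      (((W.erase x).powersetCard s).filter (fun t : Finset V => G.IsClique (t : Set V))) ∪
      ((W.filter (G.Adj x)).powersetCard (s-1)).image (insert x) := by
    intro t ht
    rw [Finset.mem_filter, Finset.mem_powersetCard] at ht
    obtain ⟨⟨h1, h2⟩, h3⟩ := ht
    rw [Finset.mem_union]
    by_cases hxt : x ∈ t
    · right
      rw [Finset.mem_image]
      refine ⟨t.erase x, ?_, Finset.insert_erase hxt⟩
      rw [Finset.mem_powersetCard]
      refine ⟨?_, by rw [Finset.card_erase_of_mem hxt, h2]⟩
      intro y hy
      rw [Finset.mem_erase] at hy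
      rw [Finset.mem_filter]
      exact ⟨h1 hy.2, h3 hxt hy.2 hy.1.symm⟩
    · left
      rw [Finset.mem_filter, Finset.mem_powersetCard]
      refine ⟨⟨?_, h2⟩, h3⟩
      intro y hy
      rw [Finset.mem_erase]
      exact ⟨by rintro rfl; exact hxt hy, h1 hy⟩
  have h1 := Finset.card_le_card hsub
  have h2 := Finset.card_union_le (((W.erase x).powersetCard s).filter
    (fun t : Finset V => G.IsClique (t : Set V))) (((W.filter (G.Adj x)).powersetCard (s-1)).image (insert x))
  have h3 : (((W.filter (G.Adj x)).powersetCard (s-1)).image (insert x)).card ≤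
      d.choose (s-1) := by
    refine Finset.card_image_le.trans ?_
    rw [Finset.card_powersetCard]
    exact Nat.choose_le_choose _ hx
  unfold cliqIn
  omega

theorem cliqIn_bound {V : Type*} (G : SimpleGraph V) (s : ℕ) (hs : 1 ≤ s) (D : Finset V) (r t : ℕ)
    (h : ∀ W, D ⊆ W → r < W.card → ∃ x ∈ W, x ∉ D ∧ (W.filter (G.Adj x)).card ≤ t) :
    ∀ (e : ℕ) (W : Finset V), D ⊆ W → W.card = r + e →
      cliqIn G s W ≤ r.choose s + e * t.choose (s-1) := by
  intro e
  induction e with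
  | zero =>
    intro W _ hW
    have := cliqIn_le G s W
    rw [hW] at this
    simpa using this
  | succ e ih =>
    intro W hD hW
    obtain ⟨x, hxW, hxD, hx⟩ := h W hD (by omega)
    have h1 := cliqIn_erase G s hs W x t hx
    have h2 := ih (W.erase x) (fun y hy => Finset.mem_erase.2
      ⟨by rintro rfl; exact hxD hy, hD hy⟩) (by rw [Finset.card_erase_of_mem hxW]; omega)
    have : (e+1) * t.choose (s-1) = e * t.choose (s-1) + t.choose (s-1) := by ring
    omega

theorem cliqueCount_le {V : Type*} [Fintype V] {G G' : SimpleGraph V} (h : G ≤ G') (s : ℕ) :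
    cliqueCount G s ≤ cliqIn G' s Finset.univ := by
  unfold cliqueCount cliqIn
  rw [← Set.ncard_coe_finset]
  refine Set.ncard_le_ncard ?_ (Set.toFinite _)
  intro t ht
  rw [Set.mem_ofPred_eq, SimpleGraph.isNClique_iff] at ht
  rw [Finset.mem_coe, Finset.mem_filter, Finset.mem_powersetCard]
  exact ⟨⟨Finset.subset_univ _, ht.2⟩, ht.1.mono h⟩

theorem convex_max (h : ℕ → ℕ) (k t a : ℕ)
    (hc : ∀ i, k ≤ i → i + 2 ≤ t → h (i+1) + h (i+1) ≤ h i + h (i+2)) (hk : k ≤ a) (ht : a ≤ t) :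
    h a ≤ max (h k) (h t) := by
  rcases ht.eq_or_lt with rfl | hlt
  · exact le_max_right _ _
  by_cases hup : h a ≤ h (a+1)
  · have key : ∀ j, a ≤ j → j + 1 ≤ t → h a ≤ h j ∧ h j ≤ h (j+1) := by
      intro j hj
      induction j, hj using Nat.le_induction with
      | base => intro _; exact ⟨le_rfl, hup⟩
      | succ j hj ih =>
        intro hjt
        have h1 := ih (by omega)
        have h2 := hc j (by omega) (by omega)
        have e1 : j + 1 + 1 = j + 2 := rfl
        rw [e1]
        constructor <;> omega
    have := key (t-1) (by omega) (by omega)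
    rw [Nat.sub_add_cancel (by omega)] at this
    exact le_max_of_le_right (this.1.trans this.2)
  · have key : ∀ d, d ≤ a - k → h a ≤ h (a-d) ∧ h (a-d+1) ≤ h (a-d) := by
      intro d
      induction d with
      | zero => intro _; simp; omega
      | succ d ih =>
        intro hd
        have h1 := ih (by omega)
        have h2 := hc (a-(d+1)) (by omega) (by omega)
        have e1 : a - (d+1) + 1 = a - d := by omega
        have e2 : a - (d+1) + 2 = a - d + 1 := by omega
        rw [e1, e2] at h2
        rw [e1]
        constructor <;> omega
    have := (key (a-k) le_rfl).1
    rw [Nat.sub_sub_self hk] at this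
    exact le_max_of_le_left this

theorem choose_convex (d σ : ℕ) (hσ : 1 ≤ σ) :
    (d+1).choose σ + (d+1).choose σ ≤ d.choose σ + (d+2).choose σ := by
  obtain ⟨τ, rfl⟩ : ∃ τ, σ = τ + 1 := ⟨σ - 1, by omega⟩
  have h1 : (d+2).choose (τ+1) = (d+1).choose τ + (d+1).choose (τ+1) := Nat.choose_succ_succ _ _
  have h2 : (d+1).choose (τ+1) = d.choose τ + d.choose (τ+1) := Nat.choose_succ_succ _ _
  have h3 : d.choose τ ≤ (d+1).choose τ := Nat.choose_le_choose _ (by omega)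
  omega

theorem f_convex (s n c i : ℕ) (hs : 2 ≤ s) (hi : i + 2 ≤ c) (hn : c ≤ n) :
    f s n (i+1) c + f s n (i+1) c ≤ f s n i c + f s n (i+2) c := by
  unfold f
  obtain ⟨d, rfl⟩ : ∃ d, c = i + 2 + d := ⟨c - (i+2), by omega⟩
  obtain ⟨N, rfl⟩ : ∃ N, n = i + 2 + d + N := ⟨n - (i+2+d), by omega⟩
  have e0 : i + 2 + d - i = d + 2 := by omega
  have e1 : i + 2 + d - (i+1) = d + 1 := by omega
  have e2 : i + 2 + d - (i+2) = d := by omega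
  have g0 : i + 2 + d + N - (d+2) = N + i := by omega
  have g1 : i + 2 + d + N - (d+1) = N + i + 1 := by omega
  have g2 : i + 2 + d + N - d = N + i + 2 := by omega
  rw [e0, e1, e2, g0, g1, g2]
  have h1 := choose_convex d s (by omega)
  have h2 := Nat.mul_le_mul_left (N+i) (choose_convex i (s-1) (by omega))
  have h3 : (i+1).choose (s-1) ≤ (i+2).choose (s-1) := Nat.choose_le_choose _ (by omega)
  nlinarith

theorem main_aux {V : Type*} [Fintype V] (G : SimpleGraph V) (c s k : ℕ)
    (hc : 5 ≤ c) (hn : c ≤ Fintype.card V) (hs : 2 ≤ s) (hk : 2 ≤ k)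
    (hG : ∀ v : V, (G.induce ({v}ᶜ : Set V)).Connected) (hNC : NC G c)
    (hmax : ∀ x y, x ≠ y → ¬ G.Adj x y → ∃ S, HP G S x y ∧ c ≤ S.card)
    (hdeg : ∀ v : V, k ≤ (Finset.univ.filter (G.Adj v)).card) :
    cliqIn G s Finset.univ ≤
      max (f s (Fintype.card V) k c) (f s (Fintype.card V) ((c - 1) / 2) c) := by
  set t := (c - 1) / 2 with ht
  by_cases hH : ∃ W : Finset V, W.Nonempty ∧ ∀ x ∈ W, t + 1 ≤ (W.filter (G.Adj x)).card
  swap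
  · push Not at hH
    have := cliqIn_bound G s (by omega) ∅ (c - t) t (by
      intro W _ hW
      obtain ⟨x, hx, hx'⟩ := hH W (Finset.card_pos.1 (by omega))
      exact ⟨x, hx, by simp, by omega⟩) (Fintype.card V - (c - t)) Finset.univ (by simp)
      (by rw [Finset.card_univ]; omega)
    exact le_max_of_le_right this
  obtain ⟨W0, hW0⟩ := hH
  obtain ⟨H, hH, hHmax⟩ := ((Finset.univ : Finset (Finset V)).filter (fun W => W.Nonempty ∧
    ∀ x ∈ W, t + 1 ≤ (W.filter (G.Adj x)).card)).exists_max_image Finset.card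
    ⟨W0, by simpa using hW0⟩
  rw [Finset.mem_filter] at hH
  obtain ⟨-, hHne, hHdeg⟩ := hH
  have hcl : ∀ x ∈ H, ∀ y ∈ H, x ≠ y → G.Adj x y := fun x hx y hy hxy =>
    pair_lemma hG hNC hmax H H (t+1) (t+1) hHdeg hHdeg (by omega) x y hx hy hxy
  have hfil : ∀ x ∈ H, H.filter (G.Adj x) = H.erase x := by
    intro x hx
    ext y
    rw [Finset.mem_filter, Finset.mem_erase]
    constructor
    · rintro ⟨h1, h2⟩; exact ⟨h2.ne', h1⟩
    · rintro ⟨h1, h2⟩; exact ⟨h2, hcl x hx y h2 h1.symm⟩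
  have hdegH : ∀ x ∈ H, H.card - 1 ≤ (H.filter (G.Adj x)).card := by
    intro x hx
    rw [hfil x hx, Finset.card_erase_of_mem hx]
  have hr : t + 2 ≤ H.card := by
    obtain ⟨x, hx⟩ := hHne
    have h1 := hHdeg x hx
    rw [hfil x hx, Finset.card_erase_of_mem hx] at h1
    omega
  have hout : ∀ x ∉ H, ¬ ∀ y ∈ H, G.Adj x y := by
    intro x hx hall
    have := hHmax (insert x H) (by
      rw [Finset.mem_filter]
      refine ⟨Finset.mem_univ _, ⟨x, by simp⟩, ?_⟩
      intro y hy
      rcases Finset.mem_insert.1 hy with rfl | hy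
      · have : H ⊆ (insert y H).filter (G.Adj y) := by
          intro z hz
          rw [Finset.mem_filter]
          exact ⟨by simp [hz], hall z hz⟩
        have := Finset.card_le_card this
        omega
      · exact (hHdeg y hy).trans (Finset.card_le_card
          (Finset.filter_subset_filter _ (Finset.subset_insert _ _))))
    rw [Finset.card_insert_of_notMem hx] at this
    omega
  have hkr : k + H.card ≤ c := by
    by_contra hcon
    have hall : ∀ x, x ∈ H := by
      intro x
      by_contra hx
      refine hout x hx fun y hy => ?_
      exact pair_lemma hG hNC hmax Finset.univ H k (H.card - 1) (fun x _ => hdeg x) hdegH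
        (by omega) x y (by simp) hy (by rintro rfl; exact hx hy)
    have h1 := clique_small (by omega) hNC H hcl
    have h2 : H = Finset.univ := by ext x; simp [hall x]
    rw [h2, Finset.card_univ] at h1
    omega
  have hb := cliqIn_bound G s (by omega) H H.card (c - H.card) (by
      intro W hD hW
      by_contra hcon
      push Not at hcon
      obtain ⟨x, hxW, hxH⟩ : ∃ x ∈ W, x ∉ H := by
        by_contra h
        push Not at h
        have := Finset.card_le_card (show W ⊆ H from h)
        omega
      refine hout x hxH fun y hy => ?_
      refine pair_lemma hG hNC hmax W H (c - H.card + 1) (H.card - 1) ?_ hdegH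
        (by omega) x y hxW hy (by rintro rfl; exact hxH hy)
      intro z hz
      by_cases hzH : z ∈ H
      · have h1 := hHdeg z hzH
        have h2 := Finset.card_le_card (Finset.filter_subset_filter (G.Adj z) hD)
        omega
      · have := hcon z hz hzH
        omega) (Fintype.card V - H.card) Finset.univ (by simp)
      (by rw [Finset.card_univ]; omega)
  have he : H.card.choose s + (Fintype.card V - H.card) * (c - H.card).choose (s-1) =
      f s (Fintype.card V) (c - H.card) c := by
    unfold f
    rw [Nat.sub_sub_self (by omega)]
  rw [he] at hb
  refine hb.trans (convex_max (fun i => f s (Fintype.card V) i c) k t (c - H.card) ?_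
    (by omega) (by omega))
  intro i _ hi
  exact f_convex s _ c i hs (by omega) hn

end Aux

/-- Extension of Luo's theorem: a 2-connected graph on `n` vertices with minimum degree
at least `k` and circumference less than `c` (where `n ≥ c ≥ 5`, `s ≥ 2`, `k ≥ 2`) has
at most `max{f_s(n,k,c), f_s(n,⌊(c-1)/2⌋,c)}` copies of `K_s`. -/
theorem luo_kopylov_minDegree {V : Type*} [Fintype V] (G : SimpleGraph V) (c s k : ℕ)
    (hc : 5 ≤ c) (hn : c ≤ Fintype.card V) (hs : 2 ≤ s) (hk : 2 ≤ k)
    (h2conn : TwoConnected G)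
    (hdeg : ∀ v : V, k ≤ Nat.card (G.neighborSet v))
    (hcirc : ∀ (v : V) (w : G.Walk v v), w.IsCycle → w.length < c) :
    cliqueCount G s ≤
      max (f s (Fintype.card V) k c) (f s (Fintype.card V) ((c - 1) / 2) c) := by
  classical
  obtain ⟨G', hle, hNC, hmax⟩ := exists_max (by omega) (NC_of (G := G) (by omega) hcirc)
  refine (cliqueCount_le hle s).trans (main_aux G' c s k hc hn hs hk ?_ hNC hmax ?_)
  · intro v
    exact (h2conn.2.2 v).mono (SimpleGraph.comap_monotone _ hle)
  · intro v
    refine (hdeg v).trans ?_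
    rw [Nat.card_coe_set_eq, ← Set.ncard_coe_finset]
    refine Set.ncard_le_ncard ?_ (Set.toFinite _)
    intro y hy
    rw [SimpleGraph.mem_neighborSet] at hy
    simpa using hle hy
end

section
/- Let G be a 2-connected simple graph on n vertices containing a path P with m edges whose endpoints are x and y. For a vertex v, let d_P(v) = |N(v) ∩ V(P)| be the number of neighbors of v on P. Then G contains a cycle of length at least min{ m+1, d_P(x) + d_P(y) }. -/
namespace Kop
open SimpleGraph

variable {V : Type*} {G : SimpleGraph V}

/-- there is a path from u to v with vertex set S -/
def Pth (G : SimpleGraph V) (S : Set V) (u v : V) : Prop :=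
  ∃ w : G.Walk u v, w.IsPath ∧ ∀ z, z ∈ w.support ↔ z ∈ S

lemma Pth.single (u : V) : Pth G {u} u u := ⟨Walk.nil, by simp, by simp⟩

lemma Pth.right_mem {S : Set V} {u v : V} (h : Pth G S u v) : v ∈ S := by
  obtain ⟨w, hw, hs⟩ := h
  exact (hs v).1 w.end_mem_support

lemma Pth.left_mem {S : Set V} {u v : V} (h : Pth G S u v) : u ∈ S := by
  obtain ⟨w, hw, hs⟩ := h
  exact (hs u).1 w.start_mem_support

lemma Pth.symm {S : Set V} {u v : V} (h : Pth G S u v) : Pth G S v u := by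
  obtain ⟨w, hw, hs⟩ := h
  exact ⟨w.reverse, hw.reverse, by simpa using hs⟩

/-- glue with an edge -/
lemma Pth.edge {S T : Set V} {u v a b : V} (h : Pth G S u v) (e : G.Adj v a) (h' : Pth G T a b)
    (hd : ∀ z, z ∈ S → z ∈ T → False) : Pth G (S ∪ T) u b := by
  obtain ⟨w, hw, hs⟩ := h
  obtain ⟨w', hw', hs'⟩ := h'
  refine ⟨w.append (Walk.cons e w'), ?_, ?_⟩
  · rw [Walk.isPath_def, Walk.support_append, Walk.support_cons, List.tail_cons, List.nodup_append]
    refine ⟨hw.support_nodup, hw'.support_nodup, ?_⟩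
    rintro z hz z' hz' rfl
    exact hd z ((hs z).1 hz) ((hs' z).1 hz')
  · intro z
    rw [Walk.support_append, Walk.support_cons, List.tail_cons, List.mem_append, hs, hs', Set.mem_union]

/-- glue at a vertex -/
lemma Pth.glue {S T : Set V} {u v b : V} (h : Pth G S u v) (h' : Pth G T v b)
    (hd : ∀ z, z ∈ S → z ∈ T → z = v) : Pth G (S ∪ T) u b := by
  obtain ⟨w, hw, hs⟩ := h
  obtain ⟨w', hw', hs'⟩ := h'
  refine ⟨w.append w', ?_, ?_⟩
  · rw [Walk.isPath_def, Walk.support_append, List.nodup_append]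
    have hn := hw'.support_nodup
    rw [← Walk.cons_tail_support, List.nodup_cons] at hn
    refine ⟨hw.support_nodup, hn.2, ?_⟩
    rintro z hz z' hz' rfl
    have := hd z ((hs z).1 hz) ((hs' z).1 (List.mem_of_mem_tail hz'))
    subst this
    exact hn.1 hz'
  · intro z
    rw [Walk.mem_support_append_iff, hs, hs', Set.mem_union]

lemma Pth.prefix {S : Set V} {u v w : V} (h : Pth G S u v) (hw : w ∈ S) :
    ∃ S', S' ⊆ S ∧ Pth G S' u w := by
  classical
  obtain ⟨q, hq, hs⟩ := h
  have hw' := (hs w).2 hw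
  refine ⟨{z | z ∈ (q.takeUntil w hw').support}, ?_, q.takeUntil w hw', hq.takeUntil hw', by simp⟩
  intro z hz
  exact (hs z).1 (q.support_takeUntil_subset_support hw' hz)

lemma Pth.seg {f : ℕ → V} {m : ℕ} (hinj : ∀ i j, i ≤ m → j ≤ m → f i = f j → i = j)
    (hadj : ∀ i, i < m → G.Adj (f i) (f (i + 1))) (i j : ℕ) (hij : i ≤ j) (hj : j ≤ m) :
    Pth G (f '' Set.Icc i j) (f i) (f j) := by
  induction j, hij using Nat.le_induction with
  | base => simpa using Pth.single (G := G) (f i)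
  | succ j hij ih =>
    have h1 := (ih (by omega)).edge (hadj j (by omega)) (Pth.single (f (j + 1))) (by
      rintro z ⟨k, ⟨hk1, hk2⟩, rfl⟩ hz
      have := hinj k (j + 1) (by omega) hj hz
      omega)
    convert h1 using 1
    ext z
    simp only [Set.mem_image, Set.mem_Icc, Set.mem_union, Set.mem_singleton_iff]
    constructor
    · rintro ⟨k, ⟨hk1, hk2⟩, rfl⟩
      rcases Nat.lt_or_ge j k with h | h
      · right; congr 1; omega
      · left; exact ⟨k, ⟨hk1, h⟩, rfl⟩
    · rintro (⟨k, ⟨hk1, hk2⟩, rfl⟩ | rfl)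
      · exact ⟨k, ⟨hk1, by omega⟩, rfl⟩
      · exact ⟨j + 1, ⟨by omega, le_rfl⟩, rfl⟩

lemma Pth.close {S : Set V} {u v : V} (h : Pth G S u v) (e : G.Adj v u) (F : Finset V)
    (hF : ↑F ⊆ S) (h3 : 3 ≤ F.card) :
    ∃ (v : V) (c : G.Walk v v), c.IsCycle ∧ F.card ≤ c.length := by
  classical
  obtain ⟨w, hw, hs⟩ := h
  have hl : F.card ≤ w.length + 1 := by
    rw [← Walk.length_support]
    refine le_trans (Finset.card_le_card (t := w.support.toFinset) ?_) (List.toFinset_card_le _)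
    intro z hz
    rw [List.mem_toFinset, hs]
    exact hF hz
  refine ⟨v, Walk.cons e w, ?_, by simpa using hl⟩
  rw [Walk.cons_isCycle_iff]
  refine ⟨hw, fun hh => ?_⟩
  rw [Sym2.eq_swap] at hh
  have := hw.length_eq_one_of_mem_edges hh
  omega

lemma exists_cycle [Fintype V] (h : TwoConnected G) :
    ∃ (v : V) (c : G.Walk v v), c.IsCycle ∧ 3 ≤ c.length := by
  classical
  obtain ⟨h3, hc, hd⟩ := h
  have : Nontrivial V := Fintype.one_lt_card_iff_nontrivial.1 (by omega)
  obtain ⟨v⟩ := hc.nonempty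
  obtain ⟨a, ha⟩ := hc.preconnected.exists_adj_of_nontrivial v
  obtain ⟨t, ht⟩ : ∃ t, t ∉ ({v, a} : Finset V) := by
    by_contra! hh
    have : (Finset.univ : Finset V) ⊆ {v, a} := fun t _ => hh t
    have := Finset.card_le_card this
    have := Finset.card_le_two (a := v) (b := a)
    rw [Finset.card_univ] at *
    omega
  simp only [Finset.mem_insert, Finset.mem_singleton, not_or] at ht
  have hva : v ≠ a := ha.ne
  have : Nontrivial (({a}ᶜ : Set V)) := ⟨⟨v, hva⟩, ⟨t, ht.2⟩, by
    intro hh; exact ht.1 (congrArg Subtype.val hh).symm⟩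
  obtain ⟨⟨b, hb⟩, hvb⟩ := (hd a).preconnected.exists_adj_of_nontrivial ⟨v, hva⟩
  replace hvb : G.Adj v b := hvb
  replace hb : b ≠ a := hb
  obtain ⟨q, hq⟩ := ((hd v).preconnected.exists_isPath ⟨a, hva.symm⟩ ⟨b, hvb.ne.symm⟩)
  let q' := q.map (Embedding.induce ({v}ᶜ : Set V)).toHom
  have hP : Pth G {z | z ∈ q'.support} a b := ⟨q', by
    exact Walk.map_isPath_of_injective (f := (Embedding.induce (G := G) ({v}ᶜ : Set V)).toHom) (fun _ _ h => Subtype.ext h) hq, by simp⟩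
  have hP2 := hP.edge hvb.symm (Pth.single v) (by
    rintro z hz rfl
    simp only [Set.mem_ofPred_eq, q', Walk.support_map, List.mem_map] at hz
    obtain ⟨⟨y, hy⟩, _, h2⟩ := hz
    exact hy h2)
  have hcard : ({a, b, v} : Finset V).card = 3 := Finset.card_eq_three.2
    ⟨a, b, v, hb.symm, hva.symm, hvb.ne.symm, rfl⟩
  have := hP2.close ha {a, b, v} (by
    intro z hz
    simp only [Finset.coe_insert, Finset.coe_singleton, Set.mem_insert_iff, Set.mem_singleton_iff] at hz
    rcases hz with rfl | rfl | rfl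
    · exact Or.inl hP.left_mem
    · exact Or.inl hP.right_mem
    · exact Or.inr rfl) (by omega)
  rwa [hcard] at this


/-- vertices reachable from `f 0, ..., f (c-1)` by leaving the path `f`. -/
inductive Rch (G : SimpleGraph V) (f : ℕ → V) (m c : ℕ) : V → Prop
  | base (a : ℕ) (h : a < c) : Rch G f m c (f a)
  | step (z w : V) (hz : Rch G f m c z) (e : G.Adj z w) (hw : ∀ k, k ≤ m → w ≠ f k) : Rch G f m c w

lemma Rch.mono {f : ℕ → V} {m c c' : ℕ} (h : c ≤ c') {z : V} (hz : Rch G f m c z) :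
    Rch G f m c' z := by
  induction hz with
  | base a ha => exact .base a (by omega)
  | step z w _ e hw ih => exact .step z w ih e hw

lemma Rch.idx {f : ℕ → V} {m c : ℕ} (hinj : ∀ i j, i ≤ m → j ≤ m → f i = f j → i = j) (hc : c ≤ m)
    {z : V} (hz : Rch G f m c z) (k : ℕ) (hk : k ≤ m) (he : z = f k) : k < c := by
  cases hz with
  | base a ha => rw [← hinj a k (by omega) hk he]; exact ha
  | step z w _ e hw => exact absurd he (hw k hk)

lemma Rch.path {f : ℕ → V} {m c : ℕ} (hc : c ≤ m) {z : V} (hz : Rch G f m c z) :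
    ∃ a Q, a < c ∧ Pth G Q (f a) z ∧ (∀ q ∈ Q, Rch G f m c q) ∧
      (∀ q ∈ Q, ∀ k, k ≤ m → q = f k → q = f a) ∧
      ∀ c', c' ≤ m → (∃ q ∈ Q, Rch G f m c' q) → Rch G f m c' z := by
  induction hz with
  | base a ha =>
    refine ⟨a, {f a}, ha, Pth.single _, ?_, ?_, ?_⟩
    · rintro q rfl; exact .base a ha
    · rintro q rfl _ _ _; rfl
    · rintro c' _ ⟨q, rfl, hq⟩; exact hq
  | step z w hz e hw ih =>
    obtain ⟨a, Q, ha, hP, h1, h2, h3⟩ := ih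
    by_cases hwQ : w ∈ Q
    · obtain ⟨Q', hs, hP'⟩ := hP.prefix hwQ
      refine ⟨a, Q', ha, hP', fun q hq => h1 q (hs hq), fun q hq => h2 q (hs hq), ?_⟩
      rintro c' hc' ⟨q, hq, hr⟩
      exact .step z w (h3 c' hc' ⟨q, hs hq, hr⟩) e hw
    · refine ⟨a, Q ∪ {w}, ha, hP.edge e (Pth.single w) ?_, ?_, ?_, ?_⟩
      · rintro z hz rfl; exact hwQ hz
      · rintro q (hq | rfl)
        · exact h1 q hq
        · exact .step z q hz e hw
      · rintro q (hq | rfl) k hk he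
        · exact h2 q hq k hk he
        · exact absurd he (hw k hk)
      · rintro c' hc' ⟨q, (hq | rfl), hr⟩
        · exact .step z w (h3 c' hc' ⟨q, hq, hr⟩) e hw
        · exact hr

lemma exit [Fintype V] (h : TwoConnected G) {f : ℕ → V} {m c : ℕ}
    (hinj : ∀ i j, i ≤ m → j ≤ m → f i = f j → i = j) (h0 : 0 < c) (hc : c < m) :
    ∃ b, c < b ∧ b ≤ m ∧ ∃ z, Rch G f m c z ∧ G.Adj z (f b) := by
  have h0c : f 0 ≠ f c := fun hh => by have := hinj 0 c (by omega) (by omega) hh; omega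
  have hmc : f m ≠ f c := fun hh => by have := hinj m c (by omega) (by omega) hh; omega
  obtain ⟨q⟩ := (h.2.2 (f c)).preconnected ⟨f 0, h0c⟩ ⟨f m, hmc⟩
  obtain ⟨d, _, hd1, hd2⟩ := q.exists_boundary_dart {z | Rch G f m c z.1} (.base 0 h0) (fun hh => by
    have := Rch.idx hinj hc.le hh m le_rfl rfl
    omega)
  obtain ⟨⟨⟨u, hu⟩, ⟨w, hw⟩⟩, hadj⟩ := d
  replace hadj : G.Adj u w := hadj
  replace hd1 : Rch G f m c u := hd1
  replace hd2 : ¬ Rch G f m c w := hd2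
  replace hw : w ≠ f c := hw
  by_cases hP : ∀ k, k ≤ m → w ≠ f k
  · exact absurd (.step u w hd1 hadj hP) hd2
  · push Not at hP
    obtain ⟨k, hk, rfl⟩ := hP
    refine ⟨k, ?_, hk, u, hd1, hadj⟩
    rcases Nat.lt_trichotomy k c with h | h | h
    · exact absurd (.base k h) hd2
    · subst h; exact absurd rfl hw
    · exact h

lemma ear [Fintype V] (h : TwoConnected G) {f : ℕ → V} {m c : ℕ}
    (hinj : ∀ i j, i ≤ m → j ≤ m → f i = f j → i = j) (h0 : 0 < c) (hc : c < m) :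
    ∃ b, c < b ∧ b ≤ m ∧ (∀ k, b < k → k ≤ m → ∀ z, Rch G f m c z → ¬ G.Adj z (f k)) ∧
    ∃ a Q z, a < c ∧ Pth G Q (f a) z ∧ G.Adj z (f b) ∧ (∀ q ∈ Q, Rch G f m c q) ∧
      (∀ q ∈ Q, ∀ k, k ≤ m → q = f k → q = f a) ∧
      ∀ c', c' ≤ m → (∃ q ∈ Q, Rch G f m c' q) → Rch G f m c' z := by
  classical
  have hex := exit h hinj h0 hc
  let P : ℕ → Prop := fun b => c < b ∧ b ≤ m ∧ ∃ z, Rch G f m c z ∧ G.Adj z (f b)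
  obtain ⟨b0, hb0⟩ := hex
  have hspec : P (Nat.findGreatest P m) := Nat.findGreatest_spec (P := P) hb0.2.1 hb0
  set b := Nat.findGreatest P m with hb
  obtain ⟨h1, h2, z, hz, hzb⟩ := hspec
  obtain ⟨a, Q, ha, hP, h3, h4, h5⟩ := hz.path hc.le
  refine ⟨b, h1, h2, ?_, a, Q, z, ha, hP, hzb, h3, h4, h5⟩
  intro k hbk hk z' hz' hadj
  exact Nat.findGreatest_is_greatest (P := P) hbk hk ⟨by omega, hk, z', hz', hadj⟩

/-- the invariant -/
structure State (G : SimpleGraph V) (f : ℕ → V) (m c b : ℕ) (R : Set V) : Prop where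
  lt : c < b
  le : b ≤ m
  path : Pth G R (f b) (f c)
  sub : ∀ z ∈ R, z = f b ∨ z = f c ∨ Rch G f m c z
  mx : ∀ k, b < k → k ≤ m → ∀ z, Rch G f m c z → ¬ G.Adj z (f k)

lemma State.ext [Fintype V] (h : TwoConnected G) {f : ℕ → V} {m c b : ℕ} {R : Set V}
    (hinj : ∀ i j, i ≤ m → j ≤ m → f i = f j → i = j)
    (hadj : ∀ i, i < m → G.Adj (f i) (f (i + 1)))
    (hS : State G f m c b R) (hb : b < m) :
    ∃ b' R', b < b' ∧ R ⊆ R' ∧ State G f m b b' R' := by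
  obtain ⟨hcb, -, hR, hsub, hmx⟩ := hS
  obtain ⟨b', hb1, hb2, hmx', a, Q, z, ha, hQ, hzb, hq1, hq2, hq3⟩ := ear h hinj (c := b) (by omega) hb
  have hQc : ∀ q ∈ Q, ¬ Rch G f m c q := fun q hq hr =>
    hmx b' hb1 hb2 z (hq3 c (by omega) ⟨q, hq, hr⟩) hzb
  have hca : c ≤ a := by
    by_contra hh
    exact hQc _ hQ.left_mem (.base a (by omega))
  have p1 := hR.glue (Pth.seg hinj hadj c a hca (by omega)) (by
    rintro _ hz ⟨k, ⟨hk1, hk2⟩, rfl⟩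
    rcases hsub _ hz with h | h | h
    · have := hinj k b (by omega) (by omega) h; omega
    · exact h
    · have := h.idx hinj (by omega) k (by omega) rfl; omega)
  have p2 := p1.glue hQ (by
    rintro y (hz | ⟨k, ⟨hk1, hk2⟩, rfl⟩) hy
    · rcases hsub _ hz with h | h | h
      · exact hq2 y hy b (by omega) h
      · exact hq2 y hy c (by omega) h
      · exact absurd h (hQc _ hy)
    · exact hq2 _ hy k (by omega) rfl)
  have p3 := p2.edge hzb (Pth.single (f b')) (by
    rintro y ((hz | ⟨k, ⟨hk1, hk2⟩, rfl⟩) | hy) hyb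
    · rcases hsub _ hz with h | h | h
      · have := hinj b b' (by omega) (by omega) (h.symm.trans hyb); omega
      · have := hinj c b' (by omega) (by omega) (h.symm.trans hyb); omega
      · have := h.idx hinj (by omega) b' (by omega) hyb; omega
    · have := hinj k b' (by omega) (by omega) hyb; omega
    · have := (hq1 _ hy).idx hinj (by omega) b' (by omega) hyb; omega)
  refine ⟨b', _, hb1, ?_, hb1, hb2, p3.symm, ?_, hmx'⟩
  · intro y hy; exact Or.inl (Or.inl (Or.inl hy))
  · rintro y (((hz | ⟨k, ⟨hk1, hk2⟩, rfl⟩) | hy) | hyb)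
    · rcases hsub _ hz with h | h | h
      · exact Or.inr (Or.inl h)
      · rw [h]; exact Or.inr (Or.inr (.base c hcb))
      · exact Or.inr (Or.inr (h.mono hcb.le))
    · exact Or.inr (Or.inr (.base k (by omega)))
    · exact Or.inr (Or.inr (hq1 _ hy))
    · exact Or.inl hyb

lemma State.init [Fintype V] (h : TwoConnected G) {f : ℕ → V} {m s : ℕ}
    (hinj : ∀ i j, i ≤ m → j ≤ m → f i = f j → i = j)
    (hadj : ∀ i, i < m → G.Adj (f i) (f (i + 1))) (h0 : 0 < s) (hs : s < m)
    (hx : G.Adj (f 0) (f s)) (hmax : ∀ k, k ≤ m → G.Adj (f 0) (f k) → k ≤ s) :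
    ∃ b R, State G f m s b R ∧ f 0 ∈ R ∧ ∀ k, k ≤ m → G.Adj (f 0) (f k) → f k ∈ R := by
  classical
  obtain ⟨b, hb1, hb2, hmx, a, Q, z, ha, hQ, hzb, hq1, hq2, hq3⟩ := ear h hinj h0 hs
  have hex : ∃ r, a < r ∧ G.Adj (f 0) (f r) := ⟨s, ha, hx⟩
  obtain ⟨r, ⟨hr1, hr2⟩, hr3⟩ : ∃ r, (a < r ∧ G.Adj (f 0) (f r)) ∧
      ∀ k, k < r → ¬ (a < k ∧ G.Adj (f 0) (f k)) :=
    ⟨Nat.find hex, Nat.find_spec hex, fun k hk => Nat.find_min hex hk⟩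
  have hrs : r ≤ s := by
    by_contra hh
    exact hr3 s (by omega) ⟨ha, hx⟩
  have p1 := (Pth.seg hinj hadj r s hrs hs.le).symm.edge hr2.symm
    (Pth.seg hinj hadj 0 a (by omega) (by omega)) (by
    rintro _ ⟨k, ⟨hk1, hk2⟩, rfl⟩ ⟨l, ⟨hl1, hl2⟩, hl⟩
    have := hinj l k (by omega) (by omega) hl; omega)
  have p2 := p1.glue hQ (by
    rintro _ (⟨k, ⟨hk1, hk2⟩, rfl⟩ | ⟨k, ⟨hk1, hk2⟩, rfl⟩) hy
    · exact hq2 _ hy k (by omega) rfl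
    · exact hq2 _ hy k (by omega) rfl)
  have p3 := p2.edge hzb (Pth.single (f b)) (by
    rintro _ ((⟨k, ⟨hk1, hk2⟩, rfl⟩ | ⟨k, ⟨hk1, hk2⟩, rfl⟩) | hy) hyb
    · have := hinj k b (by omega) (by omega) hyb; omega
    · have := hinj k b (by omega) (by omega) hyb; omega
    · have := (hq1 _ hy).idx hinj (by omega) b (by omega) hyb; omega)
  refine ⟨b, _, ⟨hb1, hb2, p3.symm, ?_, hmx⟩, ?_, ?_⟩
  · rintro _ (((⟨k, ⟨hk1, hk2⟩, rfl⟩ | ⟨k, ⟨hk1, hk2⟩, rfl⟩) | hy) | hyb)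
    · rcases Nat.lt_or_ge k s with h | h
      · exact Or.inr (Or.inr (.base k h))
      · right; left; congr 1; omega
    · exact Or.inr (Or.inr (.base k (by omega)))
    · exact Or.inr (Or.inr (hq1 _ ‹_›))
    · exact Or.inl ‹_›
  · exact Or.inl (Or.inl (Or.inr ⟨0, ⟨le_rfl, by omega⟩, rfl⟩))
  · intro k hk hka
    have := hmax k hk hka
    rcases Nat.lt_or_ge a k with h | h
    · refine Or.inl (Or.inl (Or.inl ⟨k, ⟨?_, this⟩, rfl⟩))
      by_contra hh
      exact hr3 k (by omega) ⟨h, hka⟩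
    · exact Or.inl (Or.inl (Or.inr ⟨k, ⟨by omega, h⟩, rfl⟩))

lemma State.reach [Fintype V] (h : TwoConnected G) {f : ℕ → V} {m t : ℕ}
    (hinj : ∀ i j, i ≤ m → j ≤ m → f i = f j → i = j)
    (hadj : ∀ i, i < m → G.Adj (f i) (f (i + 1))) (ht : t < m) (n : ℕ) :
    ∀ (c b : ℕ) (R : Set V), m - b ≤ n → c ≤ t → State G f m c b R →
    ∃ c' b' R', c' ≤ t ∧ t < b' ∧ R ⊆ R' ∧ State G f m c' b' R' := by
  induction n with
  | zero =>
    intro c b R hn hc hS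
    exact ⟨c, b, R, hc, by omega, le_rfl, hS⟩
  | succ n ih =>
    intro c b R hn hc hS
    rcases Nat.lt_or_ge t b with hb | hb
    · exact ⟨c, b, R, hc, hb, le_rfl, hS⟩
    · obtain ⟨b', R', h1, h2, h3⟩ := hS.ext h hinj hadj (by omega)
      obtain ⟨c2, b2, R2, h4, h5, h6, h7⟩ := ih b b' R' (by omega) hb h3
      exact ⟨c2, b2, R2, h4, h5, h2.trans h6, h7⟩

lemma uncrossed [Fintype V] (h : TwoConnected G) {f : ℕ → V} {m : ℕ}
    (hinj : ∀ i j, i ≤ m → j ≤ m → f i = f j → i = j)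
    (hadj : ∀ i, i < m → G.Adj (f i) (f (i + 1))) (hm : 3 ≤ m)
    (A B : Finset ℕ) (hA : ∀ k, k ∈ A ↔ k ≤ m ∧ G.Adj (f 0) (f k))
    (hB : ∀ k, k ∈ B ↔ k ≤ m ∧ G.Adj (f m) (f k))
    (hno : ∀ i ∈ B, ∀ j ∈ A, j ≤ i) :
    ∃ (v : V) (c : G.Walk v v), c.IsCycle ∧ A.card + B.card ≤ c.length := by
  classical
  have h1A : 1 ∈ A := (hA 1).2 ⟨by omega, hadj 0 (by omega)⟩
  have hmB : m - 1 ∈ B := (hB _).2 ⟨by omega, by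
    have := hadj (m - 1) (by omega)
    rw [Nat.sub_add_cancel (by omega)] at this
    exact this.symm⟩
  have h0A : 0 ∉ A := fun hh => ((hA 0).1 hh).2.ne rfl
  have h0B : 0 ∉ B := fun hh => by have := hno 0 hh 1 h1A; omega
  have hmB' : m ∉ B := fun hh => ((hB m).1 hh).2.ne rfl
  have hmA : m ∉ A := fun hh => by have := hno _ hmB m hh; omega
  obtain ⟨s, hsA, hs⟩ : ∃ s ∈ A, ∀ k ∈ A, k ≤ s :=
    ⟨A.max' ⟨1, h1A⟩, A.max'_mem _, fun k hk => A.le_max' k hk⟩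
  obtain ⟨t, htB, ht⟩ : ∃ t ∈ B, ∀ k ∈ B, t ≤ k :=
    ⟨B.min' ⟨_, hmB⟩, B.min'_mem _, fun k hk => B.min'_le k hk⟩
  have hst := hno t htB s hsA
  have htm : t < m := by have := ht _ hmB; omega
  obtain ⟨b0, R0, hS0, h0R, hxR⟩ := State.init h hinj hadj (s := s) (hs 1 h1A) (by omega)
    ((hA s).1 hsA).2 (fun k hk hka => hs k ((hA k).2 ⟨hk, hka⟩))
  obtain ⟨c, b, R, hct, htb, hRR, hS⟩ := State.reach h hinj hadj htm m s b0 R0 (by omega) hst hS0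
  obtain ⟨-, hbm, hR, hsub, -⟩ := hS
  -- last neighbour of y before b
  have hne : (B.filter (· < b)).Nonempty := ⟨t, by simp [htB, htb]⟩
  obtain ⟨r, hrB, hrb, hr⟩ : ∃ r ∈ B, r < b ∧ ∀ k ∈ B, k < b → k ≤ r := by
    refine ⟨_, (Finset.mem_filter.1 (Finset.max'_mem _ hne)).1,
      (Finset.mem_filter.1 (Finset.max'_mem _ hne)).2, fun k hk hkb => Finset.le_max' _ _ ?_⟩
    simp [hk, hkb]
  have htr := ht r hrB
  have p1 := hR.glue (Pth.seg hinj hadj c r (by omega) (by omega)) (by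
    rintro _ hz ⟨k, ⟨hk1, hk2⟩, rfl⟩
    rcases hsub _ hz with h | h | h
    · have := hinj k b (by omega) (by omega) h; omega
    · exact h
    · have := h.idx hinj (by omega) k (by omega) rfl; omega)
  -- the counted set
  let I : Finset ℕ := insert 0 (insert m (A ∪ B))
  have hI : A.card + B.card + 1 ≤ I.card := by
    have e1 : I.card = (A ∪ B).card + 2 := by
      rw [Finset.card_insert_of_notMem, Finset.card_insert_of_notMem]
      · simp [hmA, hmB']
      · simp [h0A, h0B]; omega
    have e2 := Finset.card_union_add_card_inter A B
    have e3 : (A ∩ B).card ≤ 1 := by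
      rw [Finset.card_le_one]
      intro i hi j hj
      rw [Finset.mem_inter] at hi hj
      have := hno i hi.2 j hj.1
      have := hno j hj.2 i hi.1
      omega
    omega
  have hIm : ∀ k ∈ I, k ≤ m := by
    intro k hk
    simp only [I, Finset.mem_insert, Finset.mem_union, hA, hB] at hk
    omega
  have hF : (I.image f).card = I.card :=
    Finset.card_image_of_injOn (fun i hi j hj hij => hinj i j (hIm i hi) (hIm j hj) hij)
  have hA1 : 1 ≤ A.card := Finset.card_pos.2 ⟨1, h1A⟩
  have hB1 : 1 ≤ B.card := Finset.card_pos.2 ⟨_, hmB⟩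
  have hry := ((hB r).1 hrB).2.symm
  have hfb := hR.left_mem
  have key : ∀ k ∈ I, f k ∈ R ∪ f '' Set.Icc c r ∨ b < k ∧ k ≤ m := by
    intro k hk
    have hkm := hIm k hk
    simp only [I, Finset.mem_insert, Finset.mem_union] at hk
    rcases Nat.lt_trichotomy k b with hlt | heq | hgt
    · rcases hk with rfl | rfl | hk | hk
      · exact Or.inl (Or.inl (hRR h0R))
      · omega
      · exact Or.inl (Or.inl (hRR (hxR k hkm ((hA k).1 hk).2)))
      · have := ht k hk
        exact Or.inl (Or.inr ⟨k, ⟨by omega, hr k hk hlt⟩, rfl⟩)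
    · subst heq
      exact Or.inl (Or.inl hfb)
    · exact Or.inr ⟨hgt, hkm⟩
  suffices hsuf : ∃ (v : V) (c : G.Walk v v), c.IsCycle ∧ (I.image f).card ≤ c.length by
    obtain ⟨v, w, hw, hl⟩ := hsuf
    exact ⟨v, w, hw, by omega⟩
  rcases Nat.lt_or_ge b m with hb | hb
  · have p2 := p1.edge hry (Pth.seg hinj hadj (b + 1) m (by omega) le_rfl).symm (by
      rintro _ (hz | ⟨k, ⟨hk1, hk2⟩, rfl⟩) ⟨l, ⟨hl1, hl2⟩, hl⟩
      · rcases hsub _ hz with h | h | h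
        · have := hinj l b (by omega) (by omega) (hl.trans h); omega
        · have := hinj l c (by omega) (by omega) (hl.trans h); omega
        · have := h.idx hinj (by omega) l (by omega) hl.symm; omega
      · have := hinj l k (by omega) (by omega) hl; omega)
    refine p2.close (hadj b hb).symm (I.image f) ?_ (by omega)
    intro y hy
    rw [Finset.mem_coe, Finset.mem_image] at hy
    obtain ⟨k, hk, rfl⟩ := hy
    rcases key k hk with h | h
    · exact Or.inl h
    · exact Or.inr ⟨k, ⟨h.1, h.2⟩, rfl⟩
  · have hbm' : b = m := by omega
    subst hbm'
    refine p1.close hry (I.image f) ?_ (by omega)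
    intro y hy
    rw [Finset.mem_coe, Finset.mem_image] at hy
    obtain ⟨k, hk, rfl⟩ := hy
    rcases key k hk with h | h
    · exact h
    · omega

lemma crossed {f : ℕ → V} {m : ℕ}
    (hinj : ∀ i j, i ≤ m → j ≤ m → f i = f j → i = j)
    (hadj : ∀ i, i < m → G.Adj (f i) (f (i + 1))) (hm : 3 ≤ m)
    (A B : Finset ℕ) (hA : ∀ k, k ∈ A ↔ k ≤ m ∧ G.Adj (f 0) (f k))
    (hB : ∀ k, k ∈ B ↔ k ≤ m ∧ G.Adj (f m) (f k))
    (hcr : ∃ i ∈ B, ∃ j ∈ A, i < j) :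
    ∃ (v : V) (c : G.Walk v v), c.IsCycle ∧ min (m + 1) (A.card + B.card) ≤ c.length := by
  classical
  have h1A : 1 ∈ A := (hA 1).2 ⟨by omega, hadj 0 (by omega)⟩
  have h0A : 0 ∉ A := fun hh => ((hA 0).1 hh).2.ne rfl
  have hmB' : m ∉ B := fun hh => ((hB m).1 hh).2.ne rfl
  have hex : ∃ d, ∃ i ∈ B, i + d + 1 ∈ A := by
    obtain ⟨i, hi, j, hj, hij⟩ := hcr
    exact ⟨j - i - 1, i, hi, by convert hj using 1; omega⟩
  obtain ⟨d, ⟨i, hi, hj⟩, hmin⟩ : ∃ d, (∃ i ∈ B, i + d + 1 ∈ A) ∧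
      ∀ e, e < d → ¬ ∃ i ∈ B, i + e + 1 ∈ A :=
    ⟨Nat.find hex, Nat.find_spec hex, fun k hk => Nat.find_min hex hk⟩
  have hjm := ((hA _).1 hj).1
  have p1 := (Pth.seg hinj hadj 0 i (by omega) (by omega)).symm.edge ((hA _).1 hj).2
    (Pth.seg hinj hadj (i + d + 1) m (by omega) le_rfl) (by
    rintro _ ⟨k, ⟨hk1, hk2⟩, rfl⟩ ⟨l, ⟨hl1, hl2⟩, hl⟩
    have := hinj l k (by omega) (by omega) hl; omega)
  let I : Finset ℕ := Finset.Icc 0 i ∪ Finset.Icc (i + d + 1) m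
  have hI : I.card = m + 1 - d := by
    rw [Finset.card_union_of_disjoint, Nat.card_Icc, Nat.card_Icc]
    · omega
    · rw [Finset.disjoint_left]
      intro a ha hb
      rw [Finset.mem_Icc] at ha hb
      omega
  have hIm : ∀ k ∈ I, k ≤ m := by
    intro k hk
    simp only [I, Finset.mem_union, Finset.mem_Icc] at hk
    omega
  have hF : (I.image f).card = I.card :=
    Finset.card_image_of_injOn (fun i hi j hj hij => hinj i j (hIm i hi) (hIm j hj) hij)
  have hcnt : min (m + 1) (A.card + B.card) ≤ I.card := by
    rcases Nat.eq_zero_or_pos d with hd | hd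
    · omega
    · have hdis : Disjoint (A.image (· - 1)) B := by
        rw [Finset.disjoint_left]
        intro k hk hkB
        rw [Finset.mem_image] at hk
        obtain ⟨l, hl, rfl⟩ := hk
        have : l ≠ 0 := fun hh => h0A (hh ▸ hl)
        exact hmin 0 hd ⟨l - 1, hkB, by convert hl using 1; omega⟩
      have hc1 : (A.image (· - 1)).card = A.card := by
        refine Finset.card_image_of_injOn ?_
        intro a ha b hb hab
        have : a ≠ 0 := fun hh => h0A (hh ▸ ha)
        have : b ≠ 0 := fun hh => h0A (hh ▸ hb)
        simp only at hab
        omega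
      have hsub : A.image (· - 1) ∪ B ⊆ Finset.Icc 0 i ∪ Finset.Icc (i + d) (m - 1) := by
        intro k hk
        rw [Finset.mem_union, Finset.mem_Icc, Finset.mem_Icc]
        rw [Finset.mem_union, Finset.mem_image] at hk
        by_contra hcon
        rcases hk with ⟨l, hl, rfl⟩ | hk
        · have h0 : l ≠ 0 := fun hh => h0A (hh ▸ hl)
          have := ((hA _).1 hl).1
          refine hmin (l - i - 1) (by omega) ⟨i, hi, by convert hl using 1; omega⟩
        · have h0 : k ≠ m := fun hh => hmB' (hh ▸ hk)
          have := ((hB _).1 hk).1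
          refine hmin (i + d - k) (by omega) ⟨k, hk, by convert hj using 1; omega⟩
      have := Finset.card_le_card hsub
      rw [Finset.card_union_of_disjoint hdis, hc1] at this
      have h2 := Finset.card_union_le (Finset.Icc 0 i) (Finset.Icc (i + d) (m - 1))
      rw [Nat.card_Icc, Nat.card_Icc] at h2
      omega
  have h3 : 3 ≤ I.card := by
    rcases Nat.eq_zero_or_pos i with h | h
    · have : d = 0 := by
        by_contra hd
        exact hmin 0 (by omega) ⟨i, hi, by subst h; simpa using h1A⟩
      omega
    · omega
  obtain ⟨v, w, hw, hl⟩ := p1.close ((hB _).1 hi).2 (I.image f) (by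
    intro y hy
    rw [Finset.mem_coe, Finset.mem_image] at hy
    obtain ⟨k, hk, rfl⟩ := hy
    simp only [I, Finset.mem_union, Finset.mem_Icc] at hk
    rcases hk with h | h
    · exact Or.inl ⟨k, h, rfl⟩
    · exact Or.inr ⟨k, h, rfl⟩) (by omega)
  exact ⟨v, w, hw, by omega⟩

end Kop

theorem kopylov_lemma {V : Type*} [Fintype V] (G : SimpleGraph V) (h2conn : TwoConnected G)
    (x y : V) (p : G.Walk x y) (hp : p.IsPath) (m : ℕ) (hm : p.length = m) :
    ∃ (v : V) (c : G.Walk v v), c.IsCycle ∧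
      min (m + 1)
        ((G.neighborSet x ∩ {w | w ∈ p.support}).ncard +
          (G.neighborSet y ∩ {w | w ∈ p.support}).ncard) ≤ c.length := by
  classical
  rcases Nat.lt_or_ge m 3 with h3 | h3
  · obtain ⟨v, c, hc, hl⟩ := Kop.exists_cycle h2conn
    exact ⟨v, c, hc, by omega⟩
  have hinj : ∀ i j, i ≤ m → j ≤ m → p.getVert i = p.getVert j → i = j := fun i j hi hj h =>
    hp.getVert_injOn (show i ≤ p.length by omega) (show j ≤ p.length by omega) h
  have hadj : ∀ i, i < m → G.Adj (p.getVert i) (p.getVert (i + 1)) := fun i hi =>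
    p.adj_getVert_succ (by omega)
  have h0 : p.getVert 0 = x := p.getVert_zero
  have hmy : p.getVert m = y := by rw [← hm]; exact p.getVert_length
  have card : ∀ u, (G.neighborSet u ∩ {w | w ∈ p.support}).ncard =
      ((Finset.range (m + 1)).filter (fun k => G.Adj u (p.getVert k))).card := by
    intro u
    rw [← Finset.card_image_of_injOn (f := p.getVert), ← Set.ncard_coe_finset]
    · congr 1
      ext z
      simp only [Set.mem_inter_iff, SimpleGraph.mem_neighborSet, Set.mem_ofPred_eq,
        SimpleGraph.Walk.mem_support_iff_exists_getVert, Finset.coe_image, Set.mem_image,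
        Finset.coe_filter, Finset.mem_range]
      constructor
      · rintro ⟨h, k, rfl, hk⟩
        exact ⟨k, ⟨by omega, h⟩, rfl⟩
      · rintro ⟨k, ⟨hk, h⟩, rfl⟩
        exact ⟨h, k, rfl, by omega⟩
    · intro i hi j hj hij
      simp only [Finset.coe_filter, Finset.mem_range, Set.mem_ofPred_eq] at hi hj
      exact hinj i j (by omega) (by omega) hij
  rw [card x, card y]
  have mem : ∀ u k, k ∈ (Finset.range (m + 1)).filter (fun k => G.Adj u (p.getVert k)) ↔
      k ≤ m ∧ G.Adj u (p.getVert k) := by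
    intro u k
    rw [Finset.mem_filter, Finset.mem_range, Nat.lt_succ_iff]
  have memx : ∀ k, k ∈ (Finset.range (m + 1)).filter (fun k => G.Adj x (p.getVert k)) ↔
      k ≤ m ∧ G.Adj (p.getVert 0) (p.getVert k) := by
    intro k; rw [h0]; exact mem x k
  have memy : ∀ k, k ∈ (Finset.range (m + 1)).filter (fun k => G.Adj y (p.getVert k)) ↔
      k ≤ m ∧ G.Adj (p.getVert m) (p.getVert k) := by
    intro k; rw [hmy]; exact mem y k
  by_cases hcr : ∃ i ∈ (Finset.range (m + 1)).filter (fun k => G.Adj y (p.getVert k)),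
      ∃ j ∈ (Finset.range (m + 1)).filter (fun k => G.Adj x (p.getVert k)), i < j
  · exact Kop.crossed hinj hadj h3 _ _ memx memy hcr
  · push Not at hcr
    obtain ⟨v, c, hc, hl⟩ := Kop.uncrossed h2conn hinj hadj h3 _ _ memx memy hcr
    exact ⟨v, c, hc, le_trans (min_le_right _ _) hl⟩
end

section
/- Let n ≥ l ≥ 4, s ≥ 2, and k ≥ 1 be integers. If G is a connected simple graph on n vertices with minimum degree δ(G) ≥ k that contains no path with l vertices, then the number of copies of K_s in G satisfies N_s(G) ≤ max{ f_s(n,k,l-1), f_s(n,⌊l/2⌋-1,l-1) }. -/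
/-- function-style path with `m` edges -/
def KPathOn {W : Type*} (G : SimpleGraph W) (m : ℕ) (p : ℕ → W) : Prop :=
  (∀ i, i < m → G.Adj (p i) (p (i+1))) ∧ ∀ i, i ≤ m → ∀ j, j ≤ m → p i = p j → i = j

def KCone {V : Type*} (G : SimpleGraph V) : SimpleGraph (Option V) where
  Adj a b := match a, b with
    | some x, some y => G.Adj x y
    | none, some _ => True
    | some _, none => True
    | none, none => False
  symm := ⟨by
    intro a b h
    cases a <;> cases b <;> simp_all [G.adj_comm]⟩
  loopless := ⟨by
    intro a h
    cases a <;> simp_all⟩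

theorem KPathOn.toWalk {W : Type*} {G : SimpleGraph W} (m : ℕ) : ∀ (p : ℕ → W), KPathOn G m p →
    ∃ (q : G.Walk (p 0) (p m)), q.IsPath ∧ q.length = m := by
  have key : ∀ (m : ℕ) (p : ℕ → W), (∀ i, i < m → G.Adj (p i) (p (i+1))) →
      ∃ (q : G.Walk (p 0) (p m)), q.support = (List.range (m+1)).map p := by
    intro m
    induction m with
    | zero => intro p _; exact ⟨SimpleGraph.Walk.nil, by simp⟩
    | succ m ih =>
      intro p hp
      obtain ⟨q, hq⟩ := ih (fun i => p (i+1)) (fun i hi => hp (i+1) (by omega))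
      refine ⟨SimpleGraph.Walk.cons (hp 0 (by omega)) q, ?_⟩
      rw [SimpleGraph.Walk.support_cons, hq, List.range_succ_eq_map (n := m+1)]
      simp [Function.comp_def]
  intro p hp
  obtain ⟨q, hq⟩ := key m p hp.1
  refine ⟨q, ?_, ?_⟩
  · rw [SimpleGraph.Walk.isPath_def, hq]
    apply List.Nodup.map_on _ List.nodup_range
    intro i hi j hj h
    simp at hi hj
    exact hp.2 i (by omega) j (by omega) h
  · have := congrArg List.length hq
    simp at this
    exact this

theorem KPathOn.ofWalk {W : Type*} {G : SimpleGraph W} {u v : W} (q : G.Walk u v) (hq : q.IsPath) :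
    KPathOn G q.length q.getVert := by
  refine ⟨fun i hi => q.adj_getVert_succ hi, fun i hi j hj h => ?_⟩
  exact hq.getVert_injOn (by simpa using hi) (by simpa using hj) h

theorem KPathOn.mono {W : Type*} {G : SimpleGraph W} {m m' : ℕ} {p : ℕ → W} (h : KPathOn G m p)
    (hm : m' ≤ m) : KPathOn G m' p :=
  ⟨fun i hi => h.1 i (by omega), fun i hi j hj => h.2 i (by omega) j (by omega)⟩

theorem KPathOn.rev {W : Type*} {G : SimpleGraph W} {m : ℕ} {p : ℕ → W} (h : KPathOn G m p) :
    KPathOn G m (fun i => p (m - i)) := by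
  refine ⟨fun i hi => ?_, fun i hi j hj e => ?_⟩
  · have := (h.1 (m - (i+1)) (by omega)).symm
    rwa [show m - (i+1) + 1 = m - i by omega] at this
  · have := h.2 _ (by omega) _ (by omega) e
    omega

/-- concatenation by an edge -/
theorem KPathOn.append {W : Type*} {G : SimpleGraph W} {m n : ℕ} {p q : ℕ → W} (h : KPathOn G m p)
    (h' : KPathOn G n q) (ha : G.Adj (p m) (q 0))
    (hd : ∀ i, i ≤ m → ∀ j, j ≤ n → p i ≠ q j) :
    KPathOn G (m + 1 + n) (fun i => if i ≤ m then p i else q (i - (m+1))) := by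
  refine ⟨fun i hi => ?_, fun i hi j hj e => ?_⟩
  · rcases lt_trichotomy i m with h1 | h1 | h1
    · simp only [h1.le, show i + 1 ≤ m by omega, if_true]
      exact h.1 i h1
    · subst h1
      simpa using ha
    · simp only [show ¬ i ≤ m by omega, show ¬ i + 1 ≤ m by omega, if_false]
      have := h'.1 (i - (m+1)) (by omega)
      rwa [show i - (m+1) + 1 = i + 1 - (m+1) by omega] at this
  · dsimp only at e
    split_ifs at e with h1 h2 h2
    · exact h.2 i h1 j h2 e
    · exact absurd e (hd i h1 _ (by omega))
    · exact absurd e.symm (hd j h2 _ (by omega))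
    · have := h'.2 _ (by omega) _ (by omega) e
      omega

/-- concatenation at a common vertex -/
theorem KPathOn.glue {W : Type*} {G : SimpleGraph W} {m n : ℕ} {p q : ℕ → W} (h : KPathOn G m p)
    (h' : KPathOn G n q) (ha : p m = q 0)
    (hd : ∀ i, i ≤ m → ∀ j, j ≤ n → p i = q j → j = 0) :
    KPathOn G (m + n) (fun i => if i ≤ m then p i else q (i - m)) := by
  rcases Nat.eq_zero_or_pos n with rfl | hn
  · refine ⟨fun i hi => ?_, fun i hi j hj e => ?_⟩
    · simp only [show i ≤ m by omega, show i + 1 ≤ m by omega, if_true]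
      exact h.1 i hi
    · simp only [show i ≤ m by omega, show j ≤ m by omega, if_true] at e
      exact h.2 i hi j hj e
  · have hq : KPathOn G (n-1) (fun i => q (i+1)) :=
      ⟨fun i hi => h'.1 (i+1) (by omega), fun i hi j hj e => by
        have := h'.2 _ (by omega) _ (by omega) e
        omega⟩
    have := h.append hq (by rw [ha]; exact h'.1 0 hn) (fun i hi j hj e => by
      have := hd i hi (j+1) (by omega) e
      omega)
    rw [show m + 1 + (n-1) = m + n by omega] at this
    convert this using 4
    omega

theorem KPathOn.drop {W : Type*} {G : SimpleGraph W} {m : ℕ} {p : ℕ → W} (h : KPathOn G m p)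
    (a : ℕ) : KPathOn G (m - a) (fun i => p (i + a)) := by
  rcases le_or_gt a m with ha | ha
  · refine ⟨fun i hi => ?_, fun i hi j hj e => ?_⟩
    · have := h.1 (i + a) (by omega)
      rwa [show i + a + 1 = i + 1 + a by omega] at this
    · have := h.2 _ (by omega) _ (by omega) e
      omega
  · refine ⟨fun i hi => by omega, fun i hi j hj e => by omega⟩

theorem kcross {W : Type*} [DecidableEq W] {G : SimpleGraph W} {m : ℕ} {p : ℕ → W}
    (h : KPathOn G m p) (I J : Finset ℕ)
    (hI : ∀ i ∈ I, i ≤ m ∧ G.Adj (p 0) (p i)) (hJ : ∀ i ∈ J, i ≤ m ∧ G.Adj (p m) (p i))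
    (hc : ∃ i ∈ I, ∃ j ∈ J, j < i) :
    ∃ M c, KPathOn G M c ∧ G.Adj (c M) (c 0) ∧ (m ≤ M ∨ I.card + J.card ≤ M + 1) := by
  classical
  have hex : ∃ d, ∃ i ∈ I, ∃ j ∈ J, j < i ∧ i - j = d := by
    obtain ⟨i, hi, j, hj, hij⟩ := hc
    exact ⟨_, i, hi, j, hj, hij, rfl⟩
  obtain ⟨i, hi, j, hj, hij, hd⟩ := Nat.find_spec hex
  have hmin : ∀ i' ∈ I, ∀ j' ∈ J, j' < i' → i - j ≤ i' - j' := by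
    intro i' hi' j' hj' hlt
    rw [hd]
    exact Nat.find_min' hex ⟨i', hi', j', hj', hlt, rfl⟩
  have him := (hI i hi).1
  have hcyc := ((h.mono (m' := j) (by omega)).rev).append (h.drop i)
    (by simpa using (hI i hi).2) (fun a ha b hb e => by
      have := h.2 _ (by omega) _ (by omega) e
      omega)
  refine ⟨_, _, hcyc, ?_, ?_⟩
  · simp only [show ¬ (j + 1 + (m - i) ≤ j) by omega, if_false, Nat.zero_le, if_true]
    rw [show j + 1 + (m - i) - (j + 1) + i = m by omega]
    simpa using (hJ j hj).2
  · by_cases h1 : i = j + 1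
    · left; omega
    right
    have hI0 : ∀ a ∈ I, a ≠ 0 := fun a ha e => by
      subst e; exact G.loopless.irrefl _ (hI _ ha).2
    have hJm : ∀ a ∈ J, a ≠ m := fun a ha e => by
      subst e; exact G.loopless.irrefl _ (hJ _ ha).2
    have hdis : Disjoint I (J.image (· + 1)) := by
      rw [Finset.disjoint_left]
      intro a ha hb
      obtain ⟨b, hb', rfl⟩ := Finset.mem_image.1 hb
      have := hmin (b+1) ha b hb' (by omega)
      omega
    have hsub : I ∪ J.image (· + 1) ⊆ Finset.Icc 1 (j+1) ∪ Finset.Icc i m := by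
      intro a ha
      simp only [Finset.mem_union, Finset.mem_image, Finset.mem_Icc] at ha ⊢
      rcases ha with ha | ⟨b, hb, rfl⟩
      · have := hI0 a ha
        have := (hI a ha).1
        by_contra hcon
        have := hmin a ha j hj (by omega)
        omega
      · have := hJm b hb
        have := (hJ b hb).1
        by_contra hcon
        have := hmin i hi b hb (by omega)
        omega
    have := Finset.card_le_card hsub
    rw [Finset.card_union_of_disjoint hdis, Finset.card_image_of_injective _ (add_left_injective 1)] at this
    have h3 := Finset.card_union_le (Finset.Icc 1 (j+1)) (Finset.Icc i m)
    simp only [Nat.card_Icc] at h3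
    omega

theorem KPathOn.strip {V : Type*} {G : SimpleGraph V} (x0 : V) {m : ℕ} {c : ℕ → Option V}
    (h : KPathOn (KCone G) m c) (hn : ∀ i, i ≤ m → c i ≠ none) :
    KPathOn G m (fun i => (c i).getD x0) := by
  have hs : ∀ i, i ≤ m → c i = some ((c i).getD x0) := by
    intro i hi
    have := hn i hi
    cases hh : c i <;> simp_all
  refine ⟨fun i hi => ?_, fun i hi j hj e => ?_⟩
  · have := h.1 i hi
    rw [hs i (by omega), hs (i+1) (by omega)] at this
    exact this
  · apply h.2 i hi j hj
    rw [hs i hi, hs j hj]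
    exact congrArg some e

theorem kconeCyc {V : Type*} {G : SimpleGraph V} (x0 : V) {M : ℕ} {c : ℕ → Option V}
    (h : KPathOn (KCone G) M c) (hc : (KCone G).Adj (c M) (c 0)) :
    ∃ q, KPathOn G (M - 1) q := by
  by_cases hn : ∃ e, e ≤ M ∧ c e = none
  · obtain ⟨e, he, hce⟩ := hn
    have hM : 0 < M := by
      rcases Nat.eq_zero_or_pos M with rfl | h0
      · exact absurd hc ((KCone G).loopless.irrefl _)
      · exact h0
    rcases Nat.eq_zero_or_pos e with rfl | he0
    · refine ⟨_, (h.drop 1).strip x0 ?_⟩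
      intro i hi e
      have := h.2 _ (by omega) _ (by omega) (e.trans hce.symm)
      omega
    rcases Nat.lt_or_ge e M with heM | heM
    · have h2 := (h.drop (e+1)).append (h.mono (m' := e - 1) (by omega))
        (by rw [show M - (e+1) + (e+1) = M by omega]; exact hc)
        (fun i hi j hj e => by
          have := h.2 _ (by omega) _ (by omega) e
          omega)
      rw [show M - (e+1) + 1 + (e-1) = M - 1 by omega] at h2
      refine ⟨_, h2.strip x0 ?_⟩
      intro i hi e'
      split_ifs at e' with h3
      · have := h.2 _ (by omega) _ (by omega) (e'.trans hce.symm)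
        omega
      · have := h.2 _ (by omega) _ (by omega) (e'.trans hce.symm)
        omega
    · refine ⟨_, (h.mono (m' := M - 1) (by omega)).strip x0 ?_⟩
      intro i hi e'
      have := h.2 _ (by omega) _ (by omega) (e'.trans hce.symm)
      omega
  · push Not at hn
    exact ⟨_, (h.strip x0 hn).mono (by omega)⟩

theorem khalf {V : Type*} {G : SimpleGraph V} {a : ℕ} {X : ℕ → V} (h : KPathOn G a X)
    (I : Finset ℕ) (hI : ∀ i ∈ I, 1 ≤ i ∧ i ≤ a ∧ G.Adj (X 0) (X i)) (i0 : ℕ) (hi0 : i0 ≤ a) :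
    ∃ b Z, KPathOn G b Z ∧ I.card ≤ b ∧ Z 0 = X i0 ∧ ∀ t, t ≤ b → ∃ u, u ≤ a ∧ Z t = X u := by
  classical
  by_cases hT : (I.filter (fun i => i0 < i)).Nonempty
  · obtain ⟨m0, hm0, hmin⟩ := Finset.exists_min_image _ id hT
    simp only [Finset.mem_filter, id] at hm0 hmin
    have hm := hI m0 hm0.1
    have hp := ((h.mono hi0).rev).append (h.drop m0) (by simpa using hm.2.2) (fun a ha b hb e => by
      have := h.2 _ (by omega) _ (by omega) e
      omega)
    refine ⟨_, _, hp, ?_, by simp, ?_⟩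
    · have hsub : I ⊆ Finset.Icc 1 i0 ∪ Finset.Icc m0 a := by
        intro i hi
        simp only [Finset.mem_union, Finset.mem_Icc]
        have := hI i hi
        by_contra hcon
        have := hmin i ⟨hi, by omega⟩
        omega
      have := Finset.card_le_card hsub
      have h3 := Finset.card_union_le (Finset.Icc 1 i0) (Finset.Icc m0 a)
      simp only [Nat.card_Icc] at h3
      omega
    · intro t ht
      split_ifs with h1
      · exact ⟨_, by omega, rfl⟩
      · exact ⟨_, by omega, rfl⟩
  · refine ⟨i0, _, (h.mono hi0).rev, ?_, by simp, fun t ht => ⟨i0 - t, by omega, rfl⟩⟩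
    have hsub : I ⊆ Finset.Icc 1 i0 := by
      intro i hi
      simp only [Finset.mem_Icc]
      refine ⟨(hI i hi).1, ?_⟩
      by_contra hcon
      exact hT ⟨i, by simp [hi]; omega⟩
    have := Finset.card_le_card hsub
    simpa using this

theorem kconnect {V : Type*} {G : SimpleGraph V} (hG : G.Connected) (A B : Set V)
    (hA : A.Nonempty) (hB : B.Nonempty) (hAB : Disjoint A B) :
    ∃ d q, 1 ≤ d ∧ KPathOn G d q ∧ q 0 ∈ A ∧ q d ∈ B ∧ (∀ i, i ≤ d → q i ∈ A → i = 0) ∧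
      (∀ i, i ≤ d → q i ∈ B → i = d) := by
  classical
  have hex : ∃ d, ∃ q : ℕ → V, (∀ i, i < d → G.Adj (q i) (q (i+1))) ∧ q 0 ∈ A ∧ q d ∈ B := by
    obtain ⟨a, ha⟩ := hA
    obtain ⟨b, hb⟩ := hB
    obtain ⟨w⟩ := hG.preconnected a b
    exact ⟨w.length, w.getVert, fun i hi => w.adj_getVert_succ hi, by simpa using ha, by simpa using hb⟩
  obtain ⟨q, hadj, h0, hd⟩ := Nat.find_spec hex
  have hmin : ∀ d', d' < Nat.find hex → ¬ ∃ q : ℕ → V, (∀ i, i < d' → G.Adj (q i) (q (i+1))) ∧ q 0 ∈ A ∧ q d' ∈ B :=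
    fun d' h => Nat.find_min hex h
  generalize Nat.find hex = d at *
  have hd1 : 1 ≤ d := by
    rcases Nat.eq_zero_or_pos d with rfl | h
    · exact absurd hd (Set.disjoint_left.1 hAB h0)
    · exact h
  have hinj : ∀ i j, i < j → j ≤ d → q i ≠ q j := by
    intro i j hij hj e
    apply hmin (d - (j - i)) (by omega)
    refine ⟨fun t => if t ≤ i then q t else q (t + (j - i)), ?_, by simpa using h0, ?_⟩
    · intro t ht
      rcases lt_trichotomy t i with h1 | h1 | h1
      · simp only [h1.le, show t + 1 ≤ i by omega, if_true]
        exact hadj t (by omega)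
      · subst h1
        simp only [le_refl, if_true, show ¬ t + 1 ≤ t by omega, if_false, e]
        rw [show t + 1 + (j - t) = j + 1 by omega]
        exact hadj j (by omega)
      · simp only [show ¬ t ≤ i by omega, show ¬ t + 1 ≤ i by omega, if_false]
        rw [show t + 1 + (j - i) = t + (j - i) + 1 by omega]
        exact hadj _ (by omega)
    · dsimp only
      split_ifs with h1
      · rw [show d - (j - i) = i by omega, e, show j = d by omega]
        exact hd
      · rw [show d - (j - i) + (j - i) = d by omega]
        exact hd
  refine ⟨d, q, hd1, ⟨hadj, ?_⟩, h0, hd, ?_, ?_⟩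
  · intro i hi j hj e
    by_contra hne
    rcases lt_or_gt_of_ne hne with h1 | h1
    · exact hinj i j h1 hj e
    · exact hinj j i h1 hi e.symm
  · intro i hi hiA
    by_contra hne
    apply hmin (d - i) (by omega)
    refine ⟨fun t => q (t + i), fun t ht => ?_, by simpa using hiA, ?_⟩
    · have := hadj (t + i) (by omega)
      rwa [show t + i + 1 = t + 1 + i by omega] at this
    · dsimp only
      rw [show d - i + i = d by omega]; exact hd
  · intro i hi hiB
    by_contra hne
    exact hmin i (by omega) ⟨q, fun t ht => hadj t (by omega), h0, hiB⟩

/-- The Kopylov-type lemma. -/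
theorem kkop {V : Type*} {G : SimpleGraph V} (hG : G.Connected) (l : ℕ) (hl : 4 ≤ l)
    (hno : ∀ q, ¬ KPathOn G (l - 1) q) {m : ℕ} (hm : l ≤ m) {p : ℕ → Option V}
    (h : KPathOn (KCone G) m p) (e : ℕ) (he : 0 < e) (hem : e < m) (hpe : p e = none)
    (I J : Finset ℕ)
    (hI : ∀ i ∈ I, i ≤ m ∧ (KCone G).Adj (p 0) (p i))
    (hJ : ∀ i ∈ J, i ≤ m ∧ (KCone G).Adj (p m) (p i)) (heI : e ∈ I) (heJ : e ∈ J) :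
    I.card + J.card ≤ l := by
  classical
  obtain ⟨x0⟩ := hG.nonempty
  by_cases hc : ∃ i ∈ I, ∃ j ∈ J, j < i
  · obtain ⟨M, c, hM, hcl, hor⟩ := kcross h I J hI hJ hc
    obtain ⟨q, hq⟩ := kconeCyc x0 hM hcl
    by_contra hcon
    exact hno q (hq.mono (by omega))
  · push Not at hc
    have hIe : ∀ i ∈ I, i ≤ e := fun i hi => hc i hi e heJ
    have hJe : ∀ j ∈ J, e ≤ j := fun j hj => hc e heI j hj
    have hnn : ∀ i, i ≤ m → i ≠ e → p i ≠ none := by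
      intro i hi hne h1
      exact hne (h.2 i hi e hem.le (h1.trans hpe.symm))
    have hs : ∀ i, i ≤ m → i ≠ e → p i = some ((p i).getD x0) := by
      intro i hi hne
      have := hnn i hi hne
      cases hh : p i <;> simp_all
    have hX := (h.mono (m' := e - 1) (by omega)).strip x0 (fun i hi => hnn i (by omega) (by omega))
    have hY := ((h.drop (e+1)).rev).strip x0 (fun i hi => hnn _ (by omega) (by omega))
    set X : ℕ → V := fun i => (p i).getD x0 with hXd
    set Y : ℕ → V := fun i => (p (m - (e+1) - i + (e+1))).getD x0 with hYd
    have hYX : ∀ i, i ≤ m - (e+1) → Y i = X (m - i) := by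
      intro i hi
      simp only [hYd, hXd]
      rw [show m - (e+1) - i + (e+1) = m - i by omega]
    have hXinj : ∀ i j, i ≤ m → j ≤ m → i ≠ e → j ≠ e → X i = X j → i = j := by
      intro i j hi hj hie hje hh
      apply h.2 i hi j hj
      rw [hs i hi hie, hs j hj hje]
      exact congrArg some hh
    have hadj : ∀ i j, i ≤ m → j ≤ m → i ≠ e → j ≠ e → (KCone G).Adj (p i) (p j) → G.Adj (X i) (X j) := by
      intro i j hi hj hie hje hh
      rw [hs i hi hie, hs j hj hje] at hh
      exact hh
    obtain ⟨d, q, hd1, hq, hqA, hqB, hA, hB⟩ := kconnect hG {v | ∃ i, i ≤ e - 1 ∧ v = X i}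
      {v | ∃ i, i ≤ m - (e+1) ∧ v = Y i} ⟨X 0, 0, by omega, rfl⟩ ⟨Y 0, 0, by omega, rfl⟩ (by
        rw [Set.disjoint_left]
        rintro v ⟨i, hi, rfl⟩ ⟨j, hj, hh⟩
        rw [hYX j hj] at hh
        have := hXinj _ _ (by omega) (by omega) (by omega) (by omega) hh
        omega)
    obtain ⟨i0, hi0, hqi⟩ := hqA
    obtain ⟨j0, hj0, hqj⟩ := hqB
    obtain ⟨b1, Z1, hZ1, hc1, hz1, hZs1⟩ := khalf hX (I.erase e) (by
      intro i hi
      obtain ⟨hne, hi⟩ := Finset.mem_erase.1 hi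
      have h1 := hIe i hi
      have h2 := hI i hi
      refine ⟨?_, by omega, hadj 0 i (by omega) (by omega) (by omega) (by omega) h2.2⟩
      rcases Nat.eq_zero_or_pos i with rfl | h0
      · exact absurd h2.2 ((KCone G).loopless.irrefl _)
      · exact h0) i0 hi0
    obtain ⟨b2, Z2, hZ2, hc2, hz2, hZs2⟩ := khalf hY ((J.erase e).image (fun j => m - j)) (by
      intro i hi
      obtain ⟨j, hj, rfl⟩ := Finset.mem_image.1 hi
      obtain ⟨hne, hj⟩ := Finset.mem_erase.1 hj
      have h1 := hJe j hj
      have h2 := hJ j hj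
      have h3 : j ≠ m := by
        rintro rfl
        exact absurd h2.2 ((KCone G).loopless.irrefl _)
      refine ⟨by omega, by omega, ?_⟩
      rw [hYX _ (by omega), hYX _ (by omega), show m - (m - j) = j by omega, Nat.sub_zero]
      exact hadj m j (by omega) (by omega) (by omega) (by omega) h2.2) j0 hj0
    rw [Finset.card_image_of_injOn] at hc2
    swap
    · intro i hi j hj hh
      have := (hJ i (Finset.mem_of_mem_erase hi)).1
      have := (hJ j (Finset.mem_of_mem_erase hj)).1
      dsimp only at hh
      omega
    rw [Finset.card_erase_of_mem heI] at hc1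
    rw [Finset.card_erase_of_mem heJ] at hc2
    have hg1 := hZ1.rev.glue hq (by simp [hz1, hqi]) (by
      intro i hi j hj hh
      apply hA j hj
      obtain ⟨u, hu, hu'⟩ := hZs1 (b1 - i) (by omega)
      exact ⟨u, hu, by rw [← hh, hu']⟩)
    have hg2 := hg1.glue hZ2 (by
      simp only [show ¬ b1 + d ≤ b1 by omega, if_false, Nat.add_sub_cancel_left]
      rw [hqj, hz2]) (by
      intro i hi j hj hh
      obtain ⟨u, hu, hu'⟩ := hZs2 j hj
      split_ifs at hh with h1
      · exfalso
        obtain ⟨v, hv, hv'⟩ := hZs1 (b1 - i) (by omega)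
        rw [hv', hu', hYX u hu] at hh
        have := hXinj _ _ (by omega) (by omega) (by omega) (by omega) hh
        omega
      · have := hB (i - b1) (by omega) ⟨u, hu, by rw [hh, hu']⟩
        rw [this, hqj, ← hz2] at hh
        have := hZ2.2 0 (by omega) j hj hh
        omega)
    by_contra hcon
    have := Finset.card_pos.2 ⟨e, heI⟩
    have := Finset.card_pos.2 ⟨e, heJ⟩
    exact hno _ (hg2.mono (by omega))

theorem KPathOn.bound {W : Type*} [Fintype W] {G : SimpleGraph W} {m : ℕ} {p : ℕ → W}
    (h : KPathOn G m p) : m + 1 ≤ Fintype.card W := by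
  have := Fintype.card_le_of_injective (fun i : Fin (m+1) => p i) (by
    intro i j hij
    exact Fin.ext (h.2 i (by omega) j (by omega) hij))
  simpa using this

theorem KPathOn.single {W : Type*} (G : SimpleGraph W) (z : W) : KPathOn G 0 (fun _ => z) :=
  ⟨fun i hi => by omega, fun i hi j hj _ => by omega⟩

open Classical in
theorem kpair {V : Type*} [Fintype V] {G : SimpleGraph V} (hG : G.Connected) (l : ℕ) (hl : 4 ≤ l)
    (hno : ∀ q, ¬ KPathOn G (l - 1) q)
    (hmax : ∀ u v, u ≠ v → ¬ G.Adj u v → ∃ p, KPathOn (KCone G) l p ∧ p 0 = some u ∧ p l = some v)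
    (A B : Finset V) (a b : ℕ)
    (hA : ∀ x ∈ A, a ≤ (A.filter (fun z => G.Adj x z)).card)
    (hB : ∀ x ∈ B, b ≤ (B.filter (fun z => G.Adj x z)).card)
    (hex : ∃ x ∈ A, ∃ y ∈ B, x ≠ y ∧ ¬ G.Adj x y) : a + b + 2 ≤ l := by
  classical
  obtain ⟨x0⟩ := hG.nonempty
  let P : ℕ → Prop := fun m => l ≤ m ∧ ∃ x ∈ A, ∃ y ∈ B, x ≠ y ∧ ¬ G.Adj x y ∧
    ∃ p, KPathOn (KCone G) m p ∧ p 0 = some x ∧ p m = some y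
  have hPl : P l := by
    obtain ⟨x, hx, y, hy, hne, hna⟩ := hex
    exact ⟨le_rfl, x, hx, y, hy, hne, hna, hmax x y hne hna⟩
  have hPb : ∀ m, P m → m ≤ Fintype.card (Option V) := by
    rintro m ⟨_, x, hx, y, hy, hne, hna, p, hp, _⟩
    have := hp.bound
    omega
  obtain ⟨m, hPm, hgr⟩ : ∃ m, P m ∧ ∀ m', P m' → m' ≤ m :=
    ⟨_, Nat.findGreatest_spec (hPb l hPl) hPl, fun m' h => Nat.le_findGreatest (hPb m' h) h⟩
  obtain ⟨hlm, x, hx, y, hy, hne, hna, p, hp, hp0, hpm⟩ := hPm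
  -- common neighbours lie on the path
  have hcommon : ∀ z, (KCone G).Adj z (p 0) → (KCone G).Adj z (p m) → ∃ i, i ≤ m ∧ p i = z := by
    intro z h0 h1
    by_contra hcon
    push Not at hcon
    have hh := hp.append (KPathOn.single (KCone G) z) h1.symm (fun i hi j hj => hcon i hi)
    obtain ⟨q, hq⟩ := kconeCyc x0 hh (by simpa using h0)
    exact hno q (hq.mono (by omega))
  have hw : ∃ i, i ≤ m ∧ p i = none := by
    apply hcommon
    · rw [hp0]; trivial
    · rw [hpm]; trivial
  obtain ⟨e, hem, hpe⟩ := hw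
  have he0 : e ≠ 0 := by rintro rfl; simp [hp0] at hpe
  have hem' : e ≠ m := by rintro rfl; simp [hpm] at hpe
  have hxs : ∀ z ∈ A, G.Adj x z → ∃ i, i ≤ m ∧ p i = some z := by
    intro z hz hxz
    by_contra hcon
    have h0 : (KCone G).Adj (some z) (p 0) := by rw [hp0]; exact hxz.symm
    by_cases hzy : G.Adj z y
    · exact hcon (hcommon (some z) h0 (by rw [hpm]; exact hzy))
    push Not at hcon
    have hh := (KPathOn.single (KCone G) (some z)).append hp h0
      (fun i hi j hj e => hcon j hj e.symm)
    have := hgr (0 + 1 + m) ⟨by omega, z, hz, y, hy, ?_, hzy, _, hh, by simp, ?_⟩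
    · omega
    · rintro rfl; exact hcon m le_rfl hpm
    · simp [hpm]
  have hys : ∀ z ∈ B, G.Adj y z → ∃ i, i ≤ m ∧ p i = some z := by
    intro z hz hxz
    by_contra hcon
    have h0 : (KCone G).Adj (p m) (some z) := by rw [hpm]; exact hxz
    by_cases hzy : G.Adj x z
    · exact hcon (hcommon (some z) (by rw [hp0]; exact hzy.symm) h0.symm)
    push Not at hcon
    have hh := hp.append (KPathOn.single (KCone G) (some z)) h0
      (fun i hi j hj e => hcon i hi e)
    have := hgr (m + 1 + 0) ⟨by omega, x, hx, z, hz, ?_, hzy, _, hh, by simpa using hp0, by simp⟩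
    · omega
    · rintro rfl; exact hcon 0 (by omega) hp0
  have hcount : ∀ (C : Finset V) (v : V) (k : ℕ), k ≤ m → p k = some v →
      (∀ z ∈ C, G.Adj v z → ∃ i, i ≤ m ∧ p i = some z) →
      (C.filter (fun z => G.Adj v z)).card + 1 ≤
        ((Finset.range (m+1)).filter (fun i => (KCone G).Adj (p k) (p i))).card := by
    intro C v k hk hpk hC
    have hsub : insert none ((C.filter (fun z => G.Adj v z)).image some) ⊆
        ((Finset.range (m+1)).filter (fun i => (KCone G).Adj (p k) (p i))).image p := by
      intro z hz
      simp only [Finset.mem_insert, Finset.mem_image, Finset.mem_filter, Finset.mem_range] at hz ⊢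
      rcases hz with rfl | ⟨z, ⟨hz, hvz⟩, rfl⟩
      · exact ⟨e, ⟨by omega, by rw [hpk, hpe]; trivial⟩, hpe⟩
      · obtain ⟨i, hi, hpi⟩ := hC z hz hvz
        exact ⟨i, ⟨by omega, by rw [hpk, hpi]; exact hvz⟩, hpi⟩
    have h1 := Finset.card_le_card hsub
    rw [Finset.card_insert_of_notMem (by simp),
      Finset.card_image_of_injective _ (Option.some_injective V)] at h1
    exact h1.trans Finset.card_image_le
  have h1 := hcount A x 0 (by omega) hp0 hxs
  have h2 := hcount B y m le_rfl hpm hys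
  have h3 := hA x hx
  have h4 := hB y hy
  have h5 := kkop hG l hl hno hlm hp e (by omega) (by omega) hpe
    ((Finset.range (m+1)).filter (fun i => (KCone G).Adj (p 0) (p i)))
    ((Finset.range (m+1)).filter (fun i => (KCone G).Adj (p m) (p i)))
    (by intro i hi; simp only [Finset.mem_filter, Finset.mem_range] at hi; exact ⟨by omega, hi.2⟩)
    (by intro i hi; simp only [Finset.mem_filter, Finset.mem_range] at hi; exact ⟨by omega, hi.2⟩)
    (by simp only [Finset.mem_filter, Finset.mem_range]; exact ⟨by omega, by rw [hp0, hpe]; trivial⟩)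
    (by simp only [Finset.mem_filter, Finset.mem_range]; exact ⟨by omega, by rw [hpm, hpe]; trivial⟩)
  omega

theorem kedge {V : Type*} {G : SimpleGraph V} (l : ℕ) (hl : 4 ≤ l)
    (hno : ∀ q, ¬ KPathOn G (l - 1) q) (u v : V)
    (h : ∃ q, KPathOn (G ⊔ SimpleGraph.edge u v) (l - 1) q) :
    ∃ p, KPathOn (KCone G) l p ∧ p 0 = some u ∧ p l = some v := by
  classical
  obtain ⟨q, hq⟩ := h
  have hadj : ∀ i, i < l - 1 → G.Adj (q i) (q (i+1)) ∨ (q i = u ∧ q (i+1) = v) ∨ (q i = v ∧ q (i+1) = u) := by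
    intro i hi
    have := hq.1 i hi
    rw [SimpleGraph.sup_adj, SimpleGraph.edge_adj] at this
    tauto
  have main : ∀ q : ℕ → V, (∀ i, i ≤ l - 1 → ∀ j, j ≤ l - 1 → q i = q j → i = j) →
      (∀ i, i < l - 1 → G.Adj (q i) (q (i+1)) ∨ (q i = u ∧ q (i+1) = v) ∨ (q i = v ∧ q (i+1) = u)) →
      (∃ i, i < l - 1 ∧ q i = u ∧ q (i+1) = v) →
      ∃ p, KPathOn (KCone G) l p ∧ p 0 = some u ∧ p l = some v := by
    rintro q hinj hadj ⟨i, hi, hu, hv⟩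
    have hadj' : ∀ j, j < l - 1 → j ≠ i → G.Adj (q j) (q (j+1)) := by
      intro j hj hne
      rcases hadj j hj with h | ⟨h, _⟩ | ⟨h, h'⟩
      · exact h
      · exact absurd (hinj _ (by omega) _ (by omega) (h.trans hu.symm)) hne
      · have h1 := hinj _ (by omega) _ (by omega) (h.trans hv.symm)
        have h2 := hinj _ (by omega) _ (by omega) (h'.trans hu.symm)
        omega
    have hs : KPathOn (KCone G) i (fun t => some (q t)) :=
      ⟨fun j hj => hadj' j (by omega) (by omega), fun a ha b hb e =>
        hinj a (by omega) b (by omega) (Option.some_injective _ e)⟩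
    have ht : KPathOn (KCone G) (l - 1 - (i+1)) (fun t => some (q (t + (i+1)))) :=
      ⟨fun j hj => by
        have := hadj' (j + (i+1)) (by omega) (by omega)
        rw [show j + (i+1) + 1 = j + 1 + (i+1) by omega] at this
        exact this, fun a ha b hb e => by
        have := hinj _ (by omega) _ (by omega) (Option.some_injective _ e)
        omega⟩
    have h1 := hs.rev.append (KPathOn.single (KCone G) none) trivial (fun a ha b hb e => by simp at e)
    have h2 := h1.append ht.rev (by simp; trivial) (fun a ha b hb e => by
      split_ifs at e with h3
      · have := hinj _ (by omega) _ (by omega) (Option.some_injective _ e)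
        omega)
    rw [show i + 1 + 0 + 1 + (l - 1 - (i+1)) = l by omega] at h2
    refine ⟨_, h2, by simp [hu], ?_⟩
    simp only [show ¬ l ≤ i + 1 + 0 by omega, if_false]
    rw [show l - 1 - (i + 1) - (l - (i + 1 + 0 + 1)) + (i+1) = i + 1 by omega, hv]
  by_cases hc : ∃ i, i < l - 1 ∧ q i = u ∧ q (i+1) = v
  · exact main q hq.2 hadj hc
  by_cases hc' : ∃ i, i < l - 1 ∧ q i = v ∧ q (i+1) = u
  · refine main _ hq.rev.2 ?_ ?_
    · intro i hi
      have := hadj (l - 1 - (i+1)) (by omega)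
      rw [show l - 1 - (i+1) + 1 = l - 1 - i by omega, G.adj_comm] at this
      tauto
    · obtain ⟨i, hi, h1, h2⟩ := hc'
      refine ⟨l - 1 - (i+1), by omega, ?_, ?_⟩
      · rw [show l - 1 - (l - 1 - (i+1)) = i + 1 by omega, h2]
      · rw [show l - 1 - (l - 1 - (i+1) + 1) = i by omega, h1]
  · exfalso
    refine hno q ⟨fun i hi => ?_, hq.2⟩
    rcases hadj i hi with h | h | h
    · exact h
    · exact absurd ⟨i, hi, h⟩ hc
    · exact absurd ⟨i, hi, h⟩ hc'

/-- number of s-cliques inside a set -/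
noncomputable def kcnt {V : Type*} (G : SimpleGraph V) (s : ℕ) (A : Finset V) : ℕ :=
  open Classical in ((A.powersetCard s).filter (fun t : Finset V => G.IsClique (t : Set V))).card

theorem kcnt_le {V : Type*} (G : SimpleGraph V) (s : ℕ) (A : Finset V) :
    kcnt G s A ≤ A.card.choose s := by
  classical
  unfold kcnt
  rw [← Finset.card_powersetCard]
  exact Finset.card_filter_le _ _

open Classical in
theorem kcnt_erase {V : Type*} (G : SimpleGraph V) (s d : ℕ) (hs : 2 ≤ s) (A : Finset V)
    (v : V) (hv : v ∈ A) (hd : (A.filter (fun z => G.Adj v z)).card ≤ d) :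
    kcnt G s A ≤ kcnt G s (A.erase v) + d.choose (s-1) := by
  unfold kcnt
  have hsub : (A.powersetCard s).filter (fun t : Finset V => G.IsClique (t : Set V)) ⊆
      ((A.erase v).powersetCard s).filter (fun t : Finset V => G.IsClique (t : Set V)) ∪
      ((A.filter (fun z => G.Adj v z)).powersetCard (s-1)).image (fun t : Finset V => insert v t) := by
    intro t ht
    simp only [Finset.mem_filter, Finset.mem_powersetCard, Finset.mem_union, Finset.mem_image] at ht ⊢
    obtain ⟨⟨htA, htc⟩, hcl⟩ := ht
    by_cases hvt : v ∈ t
    · right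
      refine ⟨t.erase v, ⟨?_, by rw [Finset.card_erase_of_mem hvt, htc]⟩, Finset.insert_erase hvt⟩
      intro z hz
      obtain ⟨hne, hz⟩ := Finset.mem_erase.1 hz
      exact Finset.mem_filter.2 ⟨htA hz, hcl hvt hz hne.symm⟩
    · left
      refine ⟨⟨fun z hz => Finset.mem_erase.2 ⟨?_, htA hz⟩, htc⟩, hcl⟩
      rintro rfl; exact hvt hz
  refine (Finset.card_le_card hsub).trans ((Finset.card_union_le _ _).trans ?_)
  gcongr
  refine Finset.card_image_le.trans ?_
  rw [Finset.card_powersetCard]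
  exact Nat.choose_le_choose _ hd

open Classical in
def KCore {V : Type*} (G : SimpleGraph V) (d : ℕ) (A : Finset V) : Prop :=
  ∀ v ∈ A, d ≤ (A.filter (fun z => G.Adj v z)).card

theorem kpeel1 {V : Type*} (G : SimpleGraph V) (s d : ℕ) (hs : 2 ≤ s) (H0 : Finset V)
    (hH0 : KCore G (d+1) H0) (A : Finset V) : H0 ⊆ A →
    ∃ H, H0 ⊆ H ∧ H ⊆ A ∧ KCore G (d+1) H ∧
      kcnt G s A ≤ kcnt G s H + (A.card - H.card) * d.choose (s-1) := by
  classical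
  induction A using Finset.strongInduction with
  | H A ih =>
    intro hA
    by_cases hc : KCore G (d+1) A
    · exact ⟨A, hA, subset_rfl, hc, by omega⟩
    unfold KCore at hc
    push Not at hc
    obtain ⟨v, hv, hdv⟩ := hc
    have hv0 : v ∉ H0 := by
      intro hv0
      have h1 := hH0 v hv0
      have h2 := Finset.card_le_card (Finset.filter_subset_filter (fun z => G.Adj v z) hA)
      have h3 := h1.trans (le_trans (le_of_eq (by congr)) h2)
      have h4 : (A.filter (fun z => G.Adj v z)).card < d + 1 := by convert hdv
      omega
    obtain ⟨H, h1, h2, h3, h4⟩ := ih (A.erase v) (Finset.erase_ssubset hv)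
      (fun z hz => Finset.mem_erase.2 ⟨by rintro rfl; exact hv0 hz, hA hz⟩)
    refine ⟨H, h1, h2.trans (Finset.erase_subset _ _), h3, ?_⟩
    have h5 := kcnt_erase G s d hs A v hv (by
      have h4 : (A.filter (fun z => G.Adj v z)).card < d + 1 := by convert hdv
      convert Nat.lt_succ_iff.1 h4)
    have h6 := Finset.card_le_card h2
    have h7 := Finset.card_erase_add_one hv
    have h8 : A.card - H.card = ((A.erase v).card - H.card) + 1 := by omega
    rw [h8, add_mul]
    have h9 : kcnt G s A ≤ kcnt G s (A.erase v) + d.choose (s-1) := by convert h5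
    omega

theorem kpeel2 {V : Type*} (G : SimpleGraph V) (s d q : ℕ) (hs : 2 ≤ s)
    (hne : ∀ H, KCore G (d+1) H → H = ∅) (hq : 1 ≤ q) (A : Finset V) : q ≤ A.card →
      kcnt G s A ≤ q.choose s + (A.card - q) * d.choose (s-1) := by
  classical
  induction A using Finset.strongInduction with
  | H A ih =>
    intro hA
    rcases hA.eq_or_lt with rfl | hlt
    · have := kcnt_le G s A
      omega
    have hc : ¬ KCore G (d+1) A := by
      intro h
      have := hne A h
      subst this
      simp at hlt
    unfold KCore at hc
    push Not at hc
    obtain ⟨v, hv, hdv⟩ := hc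
    have h7 := Finset.card_erase_add_one hv
    have h4 := ih (A.erase v) (Finset.erase_ssubset hv) (by omega)
    have h5 := kcnt_erase G s d hs A v hv (Nat.lt_succ_iff.1 hdv)
    have h8 : A.card - q = ((A.erase v).card - q) + 1 := by omega
    rw [h8, add_mul]
    have h9 : kcnt G s A ≤ kcnt G s (A.erase v) + d.choose (s-1) := by convert h5
    omega

theorem kconvex (g : ℕ → ℕ) (k t d : ℕ) (hkd : k ≤ d) (hdt : d ≤ t)
    (hg : ∀ x, k ≤ x → x + 2 ≤ t → 2 * g (x+1) ≤ g x + g (x+2)) : g d ≤ max (g k) (g t) := by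
  rw [le_max_iff]
  rcases hkd.eq_or_lt with rfl | hkd'
  · left; exact le_rfl
  by_cases h : g (d-1) ≤ g d
  · right
    have : ∀ j, d + j ≤ t → g (d + j - 1) ≤ g (d + j) ∧ g d ≤ g (d + j) := by
      intro j
      induction j with
      | zero => intro _; exact ⟨h, le_rfl⟩
      | succ j ih =>
        intro hj
        have h1 := ih (by omega)
        have h2 := hg (d + j - 1) (by omega) (by omega)
        rw [show d + j - 1 + 1 = d + j by omega, show d + j - 1 + 2 = d + (j+1) by omega] at h2
        rw [show d + (j+1) - 1 = d + j by omega]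
        omega
    have := (this (t - d) (by omega)).2
    rwa [show d + (t - d) = t by omega] at this
  · left
    have : ∀ j, k + j + 1 ≤ d → g (d - j) ≤ g (d - j - 1) ∧ g d ≤ g (d - j) := by
      intro j
      induction j with
      | zero => intro _; exact ⟨by simpa using (not_le.1 h).le, le_rfl⟩
      | succ j ih =>
        intro hj
        have h1 := ih (by omega)
        have h2 := hg (d - j - 2) (by omega) (by omega)
        rw [show d - j - 2 + 1 = d - j - 1 by omega, show d - j - 2 + 2 = d - j by omega] at h2
        rw [show d - (j+1) = d - j - 1 by omega, show d - j - 1 - 1 = d - j - 2 by omega]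
        omega
    have := this (d - k - 1) (by omega)
    rw [show d - (d - k - 1) - 1 = k by omega] at this
    omega

theorem kfconvex (s n c x : ℕ) (hs : 2 ≤ s) (hx : x + 2 ≤ c) (hn : c ≤ n) :
    2 * f s n (x+1) c ≤ f s n x c + f s n (x+2) c := by
  obtain ⟨r, rfl⟩ : ∃ r, s = r + 2 := ⟨s - 2, by omega⟩
  obtain ⟨u, rfl⟩ : ∃ u, c = x + 2 + u := ⟨c - (x+2), by omega⟩
  obtain ⟨N, rfl⟩ : ∃ N, n = u + 2 + N := ⟨n - (u+2), by omega⟩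
  unfold f
  rw [show x + 2 + u - (x+1) = u + 1 by omega, show x + 2 + u - x = u + 2 by omega,
    show x + 2 + u - (x+2) = u by omega, show u + 2 + N - (u+1) = N + 1 by omega,
    show u + 2 + N - (u+2) = N by omega, show u + 2 + N - u = N + 2 by omega,
    show r + 2 - 1 = r + 1 by omega]
  have e1 := Nat.choose_succ_succ' (u+1) (r+1)
  have e2 := Nat.choose_succ_succ' u (r+1)
  have e3 := Nat.choose_succ_succ' (x+1) r
  have e4 := Nat.choose_succ_succ' x r
  have m1 : u.choose (r+1) ≤ (u+1).choose (r+1) := Nat.choose_le_choose _ (by omega)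
  have m2 : x.choose r ≤ (x+1).choose r := Nat.choose_le_choose _ (by omega)
  have m3 : N * x.choose r ≤ N * (x+1).choose r := Nat.mul_le_mul_left _ m2
  rw [show u + 1 + 1 = u + 2 by rfl, show r + 1 + 1 = r + 2 by rfl] at e1
  rw [show x + 1 + 1 = x + 2 by rfl] at e3
  rw [show r + 1 + 1 = r + 2 by rfl] at e2
  rw [e1, e3, e2, e4]
  rw [e2] at *
  nlinarith

theorem kclique_path {V : Type*} {G : SimpleGraph V} (H : Finset V)
    (hH : ∀ x ∈ H, ∀ y ∈ H, x ≠ y → G.Adj x y) (hne : H.Nonempty) :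
    ∃ q, KPathOn G (H.card - 1) q := by
  classical
  obtain ⟨x0, hx0⟩ := hne
  have hpos := Finset.card_pos.2 ⟨x0, hx0⟩
  refine ⟨fun i => if h : i < H.card then (H.equivFin.symm ⟨i, h⟩ : V) else x0, ?_, ?_⟩
  · intro i hi
    simp only [show i < H.card by omega, show i + 1 < H.card by omega, dif_pos]
    apply hH _ (Subtype.prop _) _ (Subtype.prop _)
    intro h
    have := H.equivFin.symm.injective (Subtype.ext h)
    simp at this
  · intro i hi j hj e
    simp only [show i < H.card by omega, show j < H.card by omega, dif_pos] at e
    have := H.equivFin.symm.injective (Subtype.ext e)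
    simpa using this

open Classical in
theorem kmain {V : Type*} [Fintype V] {G : SimpleGraph V} (hG : G.Connected) (l s k : ℕ) (hl : 4 ≤ l)
    (hn : l ≤ Fintype.card V) (hs : 2 ≤ s)
    (hno : ∀ q, ¬ KPathOn G (l - 1) q)
    (hmax : ∀ u v, u ≠ v → ¬ G.Adj u v → ∃ p, KPathOn (KCone G) l p ∧ p 0 = some u ∧ p l = some v)
    (hdeg : KCore G k Finset.univ) :
    kcnt G s Finset.univ ≤
      max (f s (Fintype.card V) k (l - 1)) (f s (Fintype.card V) (l / 2 - 1) (l - 1)) := by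
  set t := l / 2 - 1 with ht
  by_cases hcore : ∀ H, KCore G (t+1) H → H = ∅
  · have := kpeel2 G s t (l - 1 - t) hs hcore (by omega) Finset.univ (by simp; omega)
    exact le_max_of_le_right this
  push Not at hcore
  obtain ⟨H, hH, hHm⟩ := (Set.toFinite {H : Finset V | KCore G (t+1) H}).exists_le_maximal hcore.choose_spec.1
  have hHne : H.Nonempty := (hcore.choose_spec.2).mono hH
  have hHc : KCore G (t+1) H := hHm.prop
  have hcl : ∀ x ∈ H, ∀ y ∈ H, x ≠ y → G.Adj x y := by
    intro x hx y hy hne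
    by_contra hna
    have := kpair hG l hl hno hmax H H (t+1) (t+1) hHc hHc ⟨x, hx, y, hy, hne, hna⟩
    omega
  have hfil : ∀ x ∈ H, (H.filter (fun z => G.Adj x z)).card = H.card - 1 := by
    intro x hx
    rw [← Finset.card_erase_of_mem hx]
    congr 1
    ext z
    simp only [Finset.mem_filter, Finset.mem_erase]
    exact ⟨fun h => ⟨h.2.ne', h.1⟩, fun h => ⟨h.2, hcl x hx z h.2 (Ne.symm h.1)⟩⟩
  obtain ⟨x0, hx0⟩ := hHne
  have hr : t + 2 ≤ H.card := by
    have h1 := hHc x0 hx0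
    rw [hfil x0 hx0] at h1
    omega
  have hrl : H.card < l := by
    by_contra hcon
    obtain ⟨q, hq⟩ := kclique_path H hcl ⟨x0, hx0⟩
    exact hno q (hq.mono (by omega))
  have hout : ∀ y, y ∉ H → ∃ x ∈ H, x ≠ y ∧ ¬ G.Adj x y := by
    intro y hy
    by_contra hcon
    push Not at hcon
    have hall : ∀ x ∈ H, G.Adj x y := fun x hx => hcon x hx (by rintro rfl; exact hy hx)
    have : KCore G (t+1) (insert y H) := by
      intro v hv
      rcases Finset.mem_insert.1 hv with rfl | hv
      · have hsub : H ⊆ (insert v H).filter (fun z => G.Adj v z) := by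
          intro z hz
          exact Finset.mem_filter.2 ⟨Finset.mem_insert_of_mem hz, (hall z hz).symm⟩
        have := Finset.card_le_card hsub
        omega
      · exact (hHc v hv).trans (Finset.card_le_card (Finset.filter_subset_filter _ (Finset.subset_insert _ _)))
    exact hy (hHm.le_of_ge this (Finset.subset_insert _ _) (Finset.mem_insert_self _ _))
  have hHr : ∀ x ∈ H, H.card - 1 ≤ (H.filter (fun z => G.Adj x z)).card :=
    fun x hx => (hfil x hx).ge
  obtain ⟨y0, hy0⟩ : ∃ y, y ∉ H := by
    by_contra hcon
    push Not at hcon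
    have : H = Finset.univ := Finset.eq_univ_iff_forall.2 hcon
    rw [this, Finset.card_univ] at hrl
    omega
  have hrk : H.card + k + 1 ≤ l := by
    obtain ⟨x, hx, hne, hna⟩ := hout y0 hy0
    have := kpair hG l hl hno hmax H Finset.univ (H.card - 1) k hHr hdeg
      ⟨x, hx, y0, Finset.mem_univ _, hne, hna⟩
    omega
  obtain ⟨H2, hHH2, -, hc2, hcnt⟩ := kpeel1 G s (l - 1 - H.card) hs H
    (fun x hx => by
      have := hHr x hx
      omega) Finset.univ (Finset.subset_univ _)
  have hEq : H2 = H := by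
    by_contra hne
    obtain ⟨y, hy2, hy⟩ : ∃ y ∈ H2, y ∉ H := by
      by_contra hcon
      push Not at hcon
      exact hne (Finset.Subset.antisymm hcon hHH2)
    obtain ⟨x, hx, hxy, hna⟩ := hout y hy
    have := kpair hG l hl hno hmax H H2 (H.card - 1) (l - 1 - H.card + 1) hHr hc2
      ⟨x, hx, y, hy2, hxy, hna⟩
    omega
  subst hEq
  have h1 : kcnt G s Finset.univ ≤ f s (Fintype.card V) (l - 1 - H2.card) (l - 1) := by
    unfold f
    rw [show l - 1 - (l - 1 - H2.card) = H2.card by omega]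
    have := kcnt_le G s H2
    rw [Finset.card_univ] at hcnt
    omega
  refine h1.trans ?_
  exact kconvex (fun x => f s (Fintype.card V) x (l-1)) k t _ (by omega) (by omega)
    (fun x hx hxt => kfconvex s _ _ x hs (by omega) (by omega))

theorem kcliqueCount_eq {V : Type*} [Fintype V] (G : SimpleGraph V) (s : ℕ) :
    cliqueCount G s = kcnt G s Finset.univ := by
  classical
  unfold cliqueCount kcnt
  rw [← Set.ncard_coe_finset]
  congr 1
  ext t
  simp [SimpleGraph.isNClique_iff, and_comm]

theorem kcliqueCount_mono {V : Type*} [Fintype V] {G G' : SimpleGraph V} (h : G ≤ G') (s : ℕ) :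
    cliqueCount G s ≤ cliqueCount G' s :=
  Set.ncard_le_ncard (fun _ ht => SimpleGraph.IsNClique.mono h ht) (Set.toFinite _)

/-- A connected graph on `n` vertices with minimum degree at least `k` and no path on
`l` vertices (where `n ≥ l ≥ 4`, `s ≥ 2`, `k ≥ 1`) has at most
`max{f_s(n,k,l-1), f_s(n,⌊l/2⌋-1,l-1)}` copies of `K_s`. -/
theorem luo_kopylov_paths_minDegree {V : Type*} [Fintype V] (G : SimpleGraph V) (l s k : ℕ)
    (hl : 4 ≤ l) (hn : l ≤ Fintype.card V) (hs : 2 ≤ s) (hk : 1 ≤ k)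
    (hconn : G.Connected)
    (hdeg : ∀ v : V, k ≤ Nat.card (G.neighborSet v))
    (hpath : ¬ ∃ (u v : V) (p : G.Walk u v), p.IsPath ∧ p.length + 1 = l) :
    cliqueCount G s ≤
      max (f s (Fintype.card V) k (l - 1)) (f s (Fintype.card V) (l / 2 - 1) (l - 1)) := by

  classical
  have hno : ∀ q, ¬ KPathOn G (l - 1) q := by
    intro q hq
    obtain ⟨w, hw, hwl⟩ := KPathOn.toWalk _ q hq
    exact hpath ⟨_, _, w, hw, by omega⟩
  obtain ⟨G', hle, hm⟩ := (Set.toFinite {G' : SimpleGraph V | ∀ q, ¬ KPathOn G' (l - 1) q}).exists_le_maximal hno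
  have hno' : ∀ q, ¬ KPathOn G' (l - 1) q := hm.prop
  refine (kcliqueCount_mono hle s).trans ?_
  rw [kcliqueCount_eq]
  refine kmain (hconn.mono hle) l s k hl hn hs hno' ?_ ?_
  · intro u v hne hna
    apply kedge l hl hno' u v
    by_contra hcon
    push Not at hcon
    have h1 : G' ⊔ SimpleGraph.edge u v ≤ G' := hm.le_of_ge hcon le_sup_left
    apply hna
    apply h1
    rw [SimpleGraph.sup_adj, SimpleGraph.edge_adj]
    exact Or.inr ⟨Or.inl ⟨rfl, rfl⟩, hne⟩
  · intro v _
    refine (hdeg v).trans ?_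
    rw [Nat.card_coe_set_eq, ← Set.ncard_coe_finset]
    apply Set.ncard_le_ncard _ (Set.toFinite _)
    intro z hz
    simpa using hle hz
end
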